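/- Let C = {v, w} be a mild contour from x to y in a ray category P such that v⃗ is transit, with v = v_1⋯v_n, w = w_1⋯w_m, α = v⃗_1, β = w⃗_1 and ρ = π(y). Then at least one of the following holds: (a) ρ factors through α or through β; (b) v⃗ is also cotransit and the generator π(x) of the radical of P(x,x) factors through v⃗_n or through w⃗_m. -/

import Mathlib

set_option autoImplicit false

/-- A ray category (Bautista–Gabriel–Roiter–Salmerón).  The fields `pipow x`
record the powers of the generator `π(x)` of the radical of `P(x,x)`. -/
structure RayCategory : Type 1 where
  Obj : Type
  Hom : Obj → Obj → Type
  id : ∀ x : Obj, Hom x x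
  comp : ∀ {x y z : Obj}, Hom y z → Hom x y → Hom x z
  zero : ∀ x y : Obj, Hom x y
  comp_id : ∀ {x y : Obj} (f : Hom x y), comp f (id x) = f
  id_comp : ∀ {x y : Obj} (f : Hom x y), comp (id y) f = f
  assoc : ∀ {x y z w : Obj} (h : Hom z w) (g : Hom y z) (f : Hom x y),
      comp (comp h g) f = comp h (comp g f)
  /-- axiom b : zero morphisms -/
  zero_comp : ∀ {x y z : Obj} (f : Hom x y), comp (zero y z) f = zero x z
  comp_zero : ∀ {x y z : Obj} (f : Hom y z), comp f (zero x y) = zero x z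
  /-- axiom a : the objects are pairwise non-isomorphic -/
  no_iso : ∀ {x y : Obj} (f : Hom x y) (g : Hom y x),
      comp g f = id x → comp f g = id y → x = y
  /-- axiom c : local finiteness -/
  finite_target : ∀ x : Obj, {y : Obj | ∃ f : Hom x y, f ≠ zero x y}.Finite
  finite_source : ∀ x : Obj, {y : Obj | ∃ f : Hom y x, f ≠ zero y x}.Finite
  /-- the powers of the generator `π(x)` of `P(x,x)`; `pipow x 1 = π(x)`. -/
  pipow : ∀ x : Obj, ℕ → Hom x x
  pipow_zero : ∀ x, pipow x 0 = id x
  pipow_succ : ∀ x n, pipow x (n + 1) = comp (pipow x 1) (pipow x n)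
  nilp : Obj → ℕ
  nilp_pos : ∀ x, 1 ≤ nilp x
  /-- axiom d : `P(x,x) = {id, σ, …, σ^{n-1} ≠ 0 = σ^n}` -/
  endo_cyclic : ∀ (x : Obj) (f : Hom x x), ∃ i : ℕ, f = pipow x i
  pipow_nilp : ∀ x, pipow x (nilp x) = zero x x
  pipow_nilp_ne : ∀ x, pipow x (nilp x - 1) ≠ zero x x
  /-- axiom e : `P(x,y)` is cyclic under the action of `P(x,x)` or of `P(y,y)` -/
  hom_cyclic : ∀ x y : Obj, ∃ g : Hom x y,
      (∀ f : Hom x y, ∃ i : ℕ, f = comp (pipow y i) g) ∨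
      (∀ f : Hom x y, ∃ i : ℕ, f = comp g (pipow x i))
  /-- axiom f : cancellation -/
  cancel : ∀ {x y z w : Obj} (kappa : Hom x y) (mu nu : Hom y z) (lam : Hom z w),
      comp lam (comp mu kappa) = comp lam (comp nu kappa) →
      comp lam (comp mu kappa) ≠ zero x w → mu = nu

namespace RayCategory

variable (P : RayCategory)

/-- the generator of the radical of `P(x,x)` -/
def pi (x : P.Obj) : P.Hom x x := P.pipow x 1

/-- powers of an endomorphism -/
def pow {x : P.Obj} (f : P.Hom x x) : ℕ → P.Hom x x
  | 0 => P.id x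
  | n + 1 => P.comp f (pow f n)

/-- `f` is an identity morphism -/
def IsId {x y : P.Obj} (f : P.Hom x y) : Prop := ∃ _ : x = y, HEq f (P.id x)

/-- irreducible morphisms (= arrows of the quiver of `P`): nonzero morphisms which are
not identities and cannot be written as a product of two non-identity morphisms -/
def IsIrreducible {x y : P.Obj} (f : P.Hom x y) : Prop :=
  f ≠ P.zero x y ∧ ¬ P.IsId f ∧
    ∀ (z : P.Obj) (g : P.Hom z y) (h : P.Hom x z), f = P.comp g h → P.IsId g ∨ P.IsId h

/-- irreducibility inside the full subcategory supported by `S` -/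
def IsIrreducibleOn (S : Set P.Obj) {x y : P.Obj} (f : P.Hom x y) : Prop :=
  f ≠ P.zero x y ∧ ¬ P.IsId f ∧
    ∀ z ∈ S, ∀ (g : P.Hom z y) (h : P.Hom x z), f = P.comp g h → P.IsId g ∨ P.IsId h

/-- the sub-bimodule `P(y,y) μ P(x,x)` of `P(x,y)` generated by `μ` -/
def Bimod {x y : P.Obj} (mu : P.Hom x y) : Set (P.Hom x y) :=
  {f | ∃ i j : ℕ, f = P.comp (P.pipow y i) (P.comp mu (P.pipow x j))}

/-- `μ` is transit : the sub-bimodule generated by `μ` is cyclic over `P(y,y)` -/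
def IsTransit {x y : P.Obj} (mu : P.Hom x y) : Prop :=
  mu ≠ P.zero x y ∧
    ∃ g ∈ P.Bimod mu, ∀ f ∈ P.Bimod mu, ∃ i : ℕ, f = P.comp (P.pipow y i) g

/-- `μ` is cotransit : the sub-bimodule generated by `μ` is cyclic over `P(x,x)` -/
def IsCotransit {x y : P.Obj} (mu : P.Hom x y) : Prop :=
  mu ≠ P.zero x y ∧
    ∃ g ∈ P.Bimod mu, ∀ f ∈ P.Bimod mu, ∃ j : ℕ, f = P.comp g (P.pipow x j)

/-- `μ` is deep : `π(y)μ = 0 = μπ(x)` -/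
def IsDeep {x y : P.Obj} (mu : P.Hom x y) : Prop :=
  mu ≠ P.zero x y ∧ P.comp (P.pi y) mu = P.zero x y ∧ P.comp mu (P.pi x) = P.zero x y

/-- transport of a morphism along equalities of objects -/
def castHom {a b c d : P.Obj} (h1 : a = c) (h2 : b = d) (f : P.Hom a b) : P.Hom c d :=
  cast (by rw [h1, h2]) f

/-- the composite `a_{i+j-1} ⋯ a_{i+1} a_i : x_i → x_{i+j}` of a chain of morphisms -/
def chain (x : ℕ → P.Obj) (a : ∀ i : ℕ, P.Hom (x i) (x (i + 1))) (i : ℕ) :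
    ∀ j : ℕ, P.Hom (x i) (x (i + j))
  | 0 => P.id (x i)
  | j + 1 => P.comp (a (i + j)) (chain x a i j)

end RayCategory

/-- Paths in the quiver `Q_P` of a ray category `P` (the arrow `f` of `cons f hf p`
is the *last* arrow of the path). -/
inductive RPath (P : RayCategory) : P.Obj → P.Obj → Type
  | nil (x : P.Obj) : RPath P x x
  | cons {x y z : P.Obj} (f : P.Hom y z) (hf : P.IsIrreducible f) (p : RPath P x y) :
      RPath P x z

namespace RPath

variable {P : RayCategory}

/-- the morphism `v⃗` of `P` obtained by composing the arrows of a path `v` -/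
def toHom : ∀ {x y : P.Obj}, RPath P x y → P.Hom x y
  | _, _, .nil x => P.id x
  | _, _, .cons f _ p => P.comp f p.toHom

def length : ∀ {x y : P.Obj}, RPath P x y → ℕ
  | _, _, .nil _ => 0
  | _, _, .cons _ _ p => p.length + 1

/-- the set of points visited by a path -/
def points : ∀ {x y : P.Obj}, RPath P x y → Set P.Obj
  | _, _, .nil x => {x}
  | _, _, @RPath.cons _ _ _ z _ _ p => insert z p.points

/-- concatenation of paths -/
def append : ∀ {x y z : P.Obj}, RPath P y z → RPath P x y → RPath P x z
  | _, _, _, .nil _, p => p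
  | _, _, _, .cons f hf q, p => .cons f hf (q.append p)

/-- the arrow `g` occurs in the path -/
def HasArrow : ∀ {x y : P.Obj}, RPath P x y → ∀ {a b : P.Obj}, P.Hom a b → Prop
  | _, _, .nil _, _, _, _ => False
  | _, _, .cons f _ p, _, _, g => HEq f g ∨ p.HasArrow g

/-- one step of the interlacing relation: `v = p v' q`, `w = p w' q` with
`v⃗' = w⃗' ≠ 0` and `p`, `q` not both identities -/
def InterlaceStep {x y : P.Obj} (v w : RPath P x y) : Prop :=
  ∃ (a b : P.Obj) (p : RPath P b y) (v' w' : RPath P a b) (q : RPath P x a),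
    v = p.append (v'.append q) ∧ w = p.append (w'.append q) ∧
    v'.toHom = w'.toHom ∧ v'.toHom ≠ P.zero a b ∧ ¬ (p.length = 0 ∧ q.length = 0)

/-- two paths are interlaced if they lie in the transitive closure of the relation above -/
def Interlaced {x y : P.Obj} (v w : RPath P x y) : Prop :=
  Relation.TransGen (fun v' w' : RPath P x y => InterlaceStep v' w') v w

end RPath

/-- a chain of arrows as a path -/
def pchain (P : RayCategory) (x : ℕ → P.Obj) (a : ∀ i : ℕ, P.Hom (x i) (x (i + 1)))
    (ha : ∀ i, P.IsIrreducible (a i)) (i : ℕ) : ∀ j : ℕ, RPath P (x i) (x (i + j))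
  | 0 => .nil (x i)
  | j + 1 => .cons (a (i + j)) (ha (i + j)) (pchain P x a ha i j)

/-- A contour `C = {v,w}` of `P` from `x` to `y` : a pair of different, non-interlaced
paths with `v⃗ = w⃗ ≠ 0`. -/
structure Contour (P : RayCategory) (x y : P.Obj) : Type where
  v : RPath P x y
  w : RPath P x y
  ne : v ≠ w
  hom_eq : v.toHom = w.toHom
  nz : v.toHom ≠ P.zero x y
  nint : ¬ RPath.Interlaced v w
/-- A module over the linearization `k(D/I)` of the quotient by the ideal generated by the
morphisms in `I` of the full subcategory of `P` supported by `D`: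
a `k`-linear functor defined on the morphisms between points of `D`, vanishing on `I`.
For `D = Set.univ` and `I = fun _ _ _ => False` this is exactly a `k(P)`-module. -/
structure RMod (P : RayCategory) (k : Type) [Field k] (D : Set P.Obj)
    (I : ∀ a b : P.Obj, P.Hom a b → Prop) where
  M : P.Obj → Type
  [acg : ∀ x, AddCommGroup (M x)]
  [mod : ∀ x, Module k (M x)]
  act : ∀ {x y : P.Obj}, P.Hom x y → (M x →ₗ[k] M y)
  act_id : ∀ x ∈ D, act (P.id x) = LinearMap.id
  act_comp : ∀ {x y z : P.Obj}, x ∈ D → y ∈ D → z ∈ D →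
      ∀ (g : P.Hom y z) (f : P.Hom x y), act (P.comp g f) = (act g).comp (act f)
  act_zero : ∀ {x y : P.Obj}, x ∈ D → y ∈ D → act (P.zero x y) = 0
  supp : ∀ x : P.Obj, x ∉ D → ∀ m : M x, m = 0
  killed : ∀ {a b : P.Obj} (f : P.Hom a b), I a b f → act f = 0

attribute [instance] RMod.acg RMod.mod

/-- morphisms of modules -/
structure RModHom {P : RayCategory} {k : Type} [Field k] {D : Set P.Obj}
    {I : ∀ a b : P.Obj, P.Hom a b → Prop} (M N : RMod P k D I) where
  app : ∀ x : P.Obj, M.M x →ₗ[k] N.M x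
  natural : ∀ {x y : P.Obj} (f : P.Hom x y), (N.act f).comp (app x) = (app y).comp (M.act f)

/-- isomorphism of modules -/
def RModIso {P : RayCategory} {k : Type} [Field k] {D : Set P.Obj}
    {I : ∀ a b : P.Obj, P.Hom a b → Prop} (M N : RMod P k D I) : Prop :=
  ∃ φ : RModHom M N, ∀ x, Function.Bijective (φ.app x)

namespace RMod

variable {P : RayCategory} {k : Type} [Field k] {D : Set P.Obj}
  {I : ∀ a b : P.Obj, P.Hom a b → Prop}

/-- finite-dimensional: the sum of the dimensions of all `M x` is finite -/
def FinDim (M : RMod P k D I) : Prop :=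
  (∀ x, FiniteDimensional k (M.M x)) ∧ {x : P.Obj | ∃ m : M.M x, m ≠ 0}.Finite

def Nonzero (M : RMod P k D I) : Prop := ∃ x, ∃ m : M.M x, m ≠ 0

/-- indecomposable: nonzero, and the only idempotent endomorphisms are `0` and `id` -/
def Indec (M : RMod P k D I) : Prop :=
  M.Nonzero ∧ ∀ e : RModHom M M, (∀ x, (e.app x).comp (e.app x) = e.app x) →
    (∀ x, e.app x = 0) ∨ (∀ x, e.app x = LinearMap.id)

end RMod

/-- the full subcategory supported by `D` of the quotient of `P` by the ideal generated
by `I` is (locally) representation-finite: for any field `k`, every point lies in the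
support of only finitely many isomorphism classes of finite-dimensional indecomposables -/
def RepFin (P : RayCategory) (D : Set P.Obj) (I : ∀ a b : P.Obj, P.Hom a b → Prop) : Prop :=
  ∀ (k : Type) [Field k], ∀ x : P.Obj,
    ∃ (ι : Type) (_ : Finite ι) (rep : ι → RMod P k D I),
      ∀ M : RMod P k D I, M.FinDim → M.Indec → (∃ m : M.M x, m ≠ 0) →
        ∃ i : ι, RModIso (rep i) M

/-- the trivial ideal -/
def RayCategory.noIdeal (P : RayCategory) : ∀ a b : P.Obj, P.Hom a b → Prop :=
  fun _ _ _ => False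

/-- `P` is locally representation-finite -/
def LocRepFin (P : RayCategory) : Prop := RepFin P Set.univ P.noIdeal

/-- the ideal of `P` generated by the morphism `μ` -/
def IdealOf (P : RayCategory) {a b : P.Obj} (mu : P.Hom a b) :
    ∀ s t : P.Obj, P.Hom s t → Prop :=
  fun s t f => ∃ (g : P.Hom b t) (h : P.Hom s a), f = P.comp g (P.comp mu h)

/-- an ideal of a ray category -/
structure RIdeal (P : RayCategory) where
  mem : ∀ a b : P.Obj, P.Hom a b → Prop
  zero_mem : ∀ a b : P.Obj, mem a b (P.zero a b)
  comp_mem_left : ∀ {a b c : P.Obj} (g : P.Hom b c) (f : P.Hom a b),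
      mem a b f → mem a c (P.comp g f)
  comp_mem_right : ∀ {a b c : P.Obj} (g : P.Hom b c) (f : P.Hom a b),
      mem b c g → mem a c (P.comp g f)

/-- `P` is minimal representation-infinite: not locally representation-finite, but every
proper quotient (quotient by an ideal containing a nonzero morphism) is locally
representation-finite -/
def MinRepInfinite (P : RayCategory) : Prop :=
  ¬ LocRepFin P ∧ ∀ J : RIdeal P,
    (∃ (a b : P.Obj) (f : P.Hom a b), f ≠ P.zero a b ∧ J.mem a b f) →
      RepFin P Set.univ J.mem

/-- support of the indecomposable projective module `P_x` over the quotient of `P` by `I` -/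
def ProjSupp (P : RayCategory) (I : ∀ a b : P.Obj, P.Hom a b → Prop) (x : P.Obj) :
    Set P.Obj :=
  {y : P.Obj | ∃ f : P.Hom x y, f ≠ P.zero x y ∧ ¬ I x y f}

/-- support of the indecomposable injective module `I_y` over the quotient of `P` by `I` -/
def InjSupp (P : RayCategory) (I : ∀ a b : P.Obj, P.Hom a b → Prop) (y : P.Obj) :
    Set P.Obj :=
  {z : P.Obj | ∃ f : P.Hom z y, f ≠ P.zero z y ∧ ¬ I z y f}

namespace Contour

variable {P : RayCategory} {x y : P.Obj} (C : Contour P x y)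

/-- points of the contour = points of the full subcategory `P(C)` -/
def points : Set P.Obj := C.v.points ∪ C.w.points

/-- the contour is non-deep -/
def NonDeep : Prop := ¬ P.IsDeep C.v.toHom

/-- the ideal generated by `π(y)v⃗`, so that `P' = P/π(y)v⃗` (transit case) -/
def It : ∀ a b : P.Obj, P.Hom a b → Prop := IdealOf P (P.comp (P.pi y) C.v.toHom)

/-- the ideal generated by `v⃗π(x)` (cotransit case) -/
def Ic : ∀ a b : P.Obj, P.Hom a b → Prop := IdealOf P (P.comp C.v.toHom (P.pi x))

/-- decisive subcategories of `P' = P/π(y)v⃗` for `C` (transit case) -/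
def DecisiveT (D : Set P.Obj) : Prop :=
  x ∈ D ∧ y ∈ D ∧ D ⊆ ProjSupp P C.It x ∪ InjSupp P C.It y

/-- decisive subcategories (cotransit case) -/
def DecisiveC (D : Set P.Obj) : Prop :=
  x ∈ D ∧ y ∈ D ∧ D ⊆ ProjSupp P C.Ic x ∪ InjSupp P C.Ic y

/-- mildness in the transit case: `C` is non-deep, `v⃗` is transit, and every decisive
full subcategory of `P/π(y)v⃗` with at most 4 points is representation-finite -/
def MildTransit : Prop :=
  C.NonDeep ∧ P.IsTransit C.v.toHom ∧
    ∀ D : Set P.Obj, C.DecisiveT D → D.Finite → D.ncard ≤ 4 → RepFin P D C.It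

/-- mildness in the cotransit case (dual) -/
def MildCotransit : Prop :=
  C.NonDeep ∧ P.IsCotransit C.v.toHom ∧
    ∀ D : Set P.Obj, C.DecisiveC D → D.Finite → D.ncard ≤ 4 → RepFin P D C.Ic

/-- a mild contour -/
def Mild : Prop := C.MildTransit ∨ C.MildCotransit

/-- equality of contours (with possibly different endpoints), as sets `{v,w}` -/
def Same {x' y' : P.Obj} (C' : Contour P x' y') : Prop :=
  ∃ (_ : x = x') (_ : y = y'),
    (HEq C.v C'.v ∧ HEq C.w C'.w) ∨ (HEq C.v C'.w ∧ HEq C.w C'.v)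

end Contour
/-- the full subcategory on `{x,y}` is a dumb-bell with loops `lam`, `rho`, arrow `mu`
and nilpotency indices `r`, `s` -/
def DumbBellData (P : RayCategory) (x y : P.Obj) (lam : P.Hom x x) (mu : P.Hom x y)
    (rho : P.Hom y y) (r s : ℕ) : Prop :=
  x ≠ y ∧
  P.IsIrreducibleOn {x, y} lam ∧ P.IsIrreducibleOn {x, y} mu ∧ P.IsIrreducibleOn {x, y} rho ∧
  (∀ a b : P.Obj, a ∈ ({x, y} : Set P.Obj) → b ∈ ({x, y} : Set P.Obj) →
      ∀ f : P.Hom a b, P.IsIrreducibleOn {x, y} f → HEq f lam ∨ HEq f mu ∨ HEq f rho) ∧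
  P.comp mu lam = P.comp rho mu ∧
  P.pow lam r = P.zero x x ∧ P.pow rho s = P.zero y y ∧
  P.pow lam (r - 1) ≠ P.zero x x ∧ P.pow rho (s - 1) ≠ P.zero y y ∧
  min r s = 3 ∧ max r s ≤ 5 ∧
  (∀ f : P.Hom x x, ∃ i : ℕ, f = P.pow lam i) ∧
  (∀ f : P.Hom y y, ∃ i : ℕ, f = P.pow rho i) ∧
  (∀ f : P.Hom x y, f = P.zero x y ∨ ∃ i : ℕ, f = P.comp mu (P.pow lam i)) ∧
  (∀ i : ℕ, i < min r s → P.comp mu (P.pow lam i) ≠ P.zero x y) ∧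
  (∀ f : P.Hom y x, f = P.zero y x)

/-- the full subcategory supported by `S` is a dumb-bell -/
def IsDumbBellOn (P : RayCategory) (S : Set P.Obj) : Prop :=
  ∃ (x y : P.Obj) (lam : P.Hom x x) (mu : P.Hom x y) (rho : P.Hom y y) (r s : ℕ),
    DumbBellData P x y lam mu rho r s ∧ S = {x, y}

/-- the full subcategory on the points `x 0, …, x (n-1)` is a penny-farthing with arrows
`a i` (`a i = α_{i+1} : x_i → x_{i+1}`, indices mod `n`) and loop `rho` at `x 0` -/
def PennyData (P : RayCategory) (n : ℕ) (x : ℕ → P.Obj)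
    (a : ∀ i : ℕ, P.Hom (x i) (x (i + 1))) (rho : P.Hom (x 0) (x 0)) : Prop :=
  1 ≤ n ∧
  (∀ i, x (i + n) = x i) ∧ (∀ i, HEq (a (i + n)) (a i)) ∧
  (∀ i j, i < n → j < n → x i = x j → i = j) ∧
  (∀ i, P.IsIrreducibleOn (Set.range x) (a i)) ∧
  P.IsIrreducibleOn (Set.range x) rho ∧
  (∀ b c : P.Obj, b ∈ Set.range x → c ∈ Set.range x → ∀ f : P.Hom b c,
      P.IsIrreducibleOn (Set.range x) f → HEq f rho ∨ ∃ i, i < n ∧ HEq f (a i)) ∧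
  -- relation α₁αₙ = 0
  P.chain x a (n - 1) 2 = P.zero (x (n - 1)) (x (n - 1 + 2)) ∧
  -- relation αₙ⋯α₁ = ρ²
  (∀ h : x (0 + n) = x 0, P.castHom rfl h (P.chain x a 0 n) = P.comp rho rho) ∧
  -- relations 0 = α_{e i}⋯α₁ ρ αₙ⋯α_{i+1} for a non-decreasing e : {1,…,n-1} → {1,…,n}
  ∃ e : ℕ → ℕ,
    (∀ i, 1 ≤ i → i ≤ n - 1 → 1 ≤ e i ∧ e i ≤ n) ∧
    (∀ i j, 1 ≤ i → i ≤ j → j ≤ n - 1 → e i ≤ e j) ∧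
    (∀ i, 1 ≤ i → i ≤ n - 1 → ∀ h : x (i + (n - i)) = x 0,
      P.comp (P.chain x a 0 (e i))
        (P.comp rho (P.castHom rfl h (P.chain x a i (n - i)))) =
      P.zero (x i) (x (0 + e i)))

/-- the full subcategory supported by `S` is a penny-farthing -/
def IsPennyFarthingOn (P : RayCategory) (S : Set P.Obj) : Prop :=
  ∃ (n : ℕ) (x : ℕ → P.Obj) (a : ∀ i : ℕ, P.Hom (x i) (x (i + 1))) (rho : P.Hom (x 0) (x 0)),
    PennyData P n x a rho ∧ S = Set.range x

/-- the full subcategory on `{x,z,t,y}` is a diamond with arrows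
`gam : x → z`, `lam : z → x`, `del : x → t`, `bet : t → y`, `alp : z → y`, `kap : y → z` -/
def DiamondData (P : RayCategory) (x z t y : P.Obj) (gam : P.Hom x z) (lam : P.Hom z x)
    (del : P.Hom x t) (bet : P.Hom t y) (alp : P.Hom z y) (kap : P.Hom y z) : Prop :=
  (x ≠ z ∧ x ≠ t ∧ x ≠ y ∧ z ≠ t ∧ z ≠ y ∧ t ≠ y) ∧
  P.IsIrreducibleOn {x, z, t, y} gam ∧ P.IsIrreducibleOn {x, z, t, y} lam ∧
  P.IsIrreducibleOn {x, z, t, y} del ∧ P.IsIrreducibleOn {x, z, t, y} bet ∧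
  P.IsIrreducibleOn {x, z, t, y} alp ∧ P.IsIrreducibleOn {x, z, t, y} kap ∧
  (∀ a b : P.Obj, a ∈ ({x, z, t, y} : Set P.Obj) → b ∈ ({x, z, t, y} : Set P.Obj) →
      ∀ f : P.Hom a b, P.IsIrreducibleOn {x, z, t, y} f →
        HEq f gam ∨ HEq f lam ∨ HEq f del ∨ HEq f bet ∨ HEq f alp ∨ HEq f kap) ∧
  P.comp alp gam = P.comp bet del ∧
  P.comp lam kap = P.zero y x ∧
  P.comp kap alp = P.comp gam lam

/-- the full subcategory supported by `S` is a diamond -/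
def IsDiamondOn (P : RayCategory) (S : Set P.Obj) : Prop :=
  ∃ (x z t y : P.Obj) (gam : P.Hom x z) (lam : P.Hom z x) (del : P.Hom x t)
    (bet : P.Hom t y) (alp : P.Hom z y) (kap : P.Hom y z),
    DiamondData P x z t y gam lam del bet alp kap ∧ S = {x, z, t, y}

namespace RayCategory

variable {P : RayCategory}

local infixr:80 "⊚" => RayCategory.comp _

theorem id_ne_zero (x : P.Obj) : P.id x ≠ P.zero x x := by
  intro h
  apply P.pipow_nilp_ne x
  rw [← P.comp_id (P.pipow x (P.nilp x - 1)), h, P.comp_zero]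

theorem pipow_add (x : P.Obj) (i j : ℕ) :
    P.pipow x (i + j) = P.pipow x i ⊚ P.pipow x j := by
  induction i with
  | zero => rw [Nat.zero_add, P.pipow_zero, P.id_comp]
  | succ i ih => rw [Nat.succ_add, P.pipow_succ, ih, ← P.assoc, ← P.pipow_succ]

theorem pipow_comp {x y : P.Obj} (i j : ℕ) (f : P.Hom x y) :
    P.pipow y i ⊚ P.pipow y j ⊚ f = P.pipow y (i + j) ⊚ f := by
  rw [pipow_add, P.assoc]

theorem comp_pipow {x y : P.Obj} (i j : ℕ) (f : P.Hom x y) :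
    (f ⊚ P.pipow x i) ⊚ P.pipow x j = f ⊚ P.pipow x (i + j) := by
  rw [pipow_add, P.assoc]

theorem pipow_one (x : P.Obj) : P.pipow x 1 = P.pi x := rfl

theorem pipow_eq_zero {x : P.Obj} {n : ℕ} (h : P.nilp x ≤ n) : P.pipow x n = P.zero x x := by
  obtain ⟨m, rfl⟩ := Nat.exists_eq_add_of_le h
  rw [pipow_add, P.pipow_nilp, P.zero_comp]

theorem ne_zero_left {x y z : P.Obj} {g : P.Hom y z} {f : P.Hom x y}
    (h : g ⊚ f ≠ P.zero x z) : g ≠ P.zero y z := by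
  rintro rfl; exact h (P.zero_comp f)

theorem ne_zero_right {x y z : P.Obj} {g : P.Hom y z} {f : P.Hom x y}
    (h : g ⊚ f ≠ P.zero x z) : f ≠ P.zero x y := by
  rintro rfl; exact h (P.comp_zero g)

theorem cancel_left {y z w : P.Obj} {l : P.Hom z w} {m n : P.Hom y z}
    (h : l ⊚ m = l ⊚ n) (h0 : l ⊚ m ≠ P.zero y w) : m = n := by
  apply P.cancel (P.id y) m n l <;> simpa only [P.comp_id]

theorem cancel_right {x y z : P.Obj} {k : P.Hom x y} {m n : P.Hom y z}
    (h : m ⊚ k = n ⊚ k) (h0 : m ⊚ k ≠ P.zero x z) : m = n := by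
  apply P.cancel k m n (P.id z) <;> simpa only [P.id_comp]

theorem eq_of_loop {x y : P.Obj} {f : P.Hom x y} {i j : ℕ} (h0 : f ≠ P.zero x y)
    (h : f = P.pipow y i ⊚ f ⊚ P.pipow x j) : i = 0 ∧ j = 0 := by
  have key : ∀ n : ℕ, f = P.pipow y (n * i) ⊚ f ⊚ P.pipow x (n * j) := by
    intro n
    induction n with
    | zero => simp [P.pipow_zero, P.id_comp, P.comp_id]
    | succ n ih =>
      calc f = P.pipow y i ⊚ f ⊚ P.pipow x j := h
        _ = P.pipow y i ⊚ (P.pipow y (n * i) ⊚ f ⊚ P.pipow x (n * j)) ⊚ P.pipow x j := by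
          rw [← ih]
        _ = _ := by
          simp only [P.assoc, pipow_comp, ← pipow_add]
          rw [Nat.add_mul, Nat.add_mul, Nat.one_mul, Nat.one_mul, Nat.add_comm i]
  constructor
  · by_contra hi
    apply h0
    rw [key (P.nilp y), pipow_eq_zero (x := y) (Nat.le_mul_of_pos_right _ (Nat.pos_of_ne_zero hi)),
      P.zero_comp]
  · by_contra hj
    apply h0
    rw [key (P.nilp x), pipow_eq_zero (x := x) (Nat.le_mul_of_pos_right _ (Nat.pos_of_ne_zero hj)),
      P.comp_zero, P.comp_zero]

theorem left_loop {x y : P.Obj} {f : P.Hom x y} {i : ℕ} (h0 : f ≠ P.zero x y)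
    (h : f = P.pipow y i ⊚ f) : i = 0 :=
  (eq_of_loop (j := 0) h0 (by rwa [P.pipow_zero, P.comp_id])).1

theorem right_loop {x y : P.Obj} {f : P.Hom x y} {j : ℕ} (h0 : f ≠ P.zero x y)
    (h : f = f ⊚ P.pipow x j) : j = 0 :=
  (eq_of_loop (i := 0) h0 (by rwa [P.pipow_zero, P.id_comp])).2

theorem left_pow_inj {x y : P.Obj} {f : P.Hom x y} {i j : ℕ}
    (h : P.pipow y i ⊚ f = P.pipow y j ⊚ f) (h0 : P.pipow y i ⊚ f ≠ P.zero x y) : i = j := by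
  wlog hij : i ≤ j generalizing i j
  · exact (this h.symm (h ▸ h0) (by omega)).symm
  obtain ⟨m, rfl⟩ := Nat.exists_eq_add_of_le hij
  rw [Nat.add_comm, ← pipow_comp] at h
  have := left_loop h0 h
  omega

theorem right_pow_inj {x y : P.Obj} {f : P.Hom x y} {i j : ℕ}
    (h : f ⊚ P.pipow x i = f ⊚ P.pipow x j) (h0 : f ⊚ P.pipow x i ≠ P.zero x y) : i = j := by
  wlog hij : i ≤ j generalizing i j
  · exact (this h.symm (h ▸ h0) (by omega)).symm
  obtain ⟨m, rfl⟩ := Nat.exists_eq_add_of_le hij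
  rw [← comp_pipow] at h
  have := right_loop h0 h
  omega

theorem pipow_inj {x : P.Obj} {i j : ℕ} (h : P.pipow x i = P.pipow x j)
    (h0 : P.pipow x i ≠ P.zero x x) : i = j := by
  apply right_pow_inj (f := P.id x) <;> simpa only [P.id_comp]

theorem isId_iff {x : P.Obj} {f : P.Hom x x} : P.IsId f ↔ f = P.id x :=
  ⟨fun ⟨_, h⟩ => eq_of_heq h, fun h => ⟨rfl, heq_of_eq h⟩⟩

theorem isId_id (x : P.Obj) : P.IsId (P.id x) := isId_iff.2 rfl

theorem not_isId {x y : P.Obj} (h : x ≠ y) (f : P.Hom x y) : ¬ P.IsId f := fun ⟨h', _⟩ => h h'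

theorem isId_pipow {x : P.Obj} {i : ℕ} : P.IsId (P.pipow x i) ↔ i = 0 := by
  rw [isId_iff]
  constructor
  · intro h
    rw [← P.pipow_zero] at h
    by_contra hi
    have h1 := pipow_inj h.symm (by rw [P.pipow_zero]; exact id_ne_zero x)
    omega
  · rintro rfl; exact P.pipow_zero x

theorem eq_of_comp_eq_id {x y : P.Obj} {g : P.Hom y x} {h : P.Hom x y}
    (e : g ⊚ h = P.id x) : x = y := by
  obtain ⟨k, hk⟩ := P.endo_cyclic y (h ⊚ g)
  have hne : h ⊚ g ≠ P.zero y y := by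
    intro h0
    apply id_ne_zero x
    calc P.id x = (g ⊚ h) ⊚ (g ⊚ h) := by rw [e, P.comp_id]
      _ = g ⊚ (h ⊚ g) ⊚ h := by simp only [P.assoc]
      _ = _ := by rw [h0, P.zero_comp, P.comp_zero]
  have hh : h ⊚ g = P.pipow y k ⊚ h ⊚ g := by
    rw [← hk, P.assoc, ← P.assoc _ _ g, e, P.id_comp]
  have := left_loop hne hh
  subst this
  rw [P.pipow_zero] at hk
  exact P.no_iso h g e hk

theorem isId_of_comp_isId {x y z : P.Obj} {g : P.Hom y z} {h : P.Hom x y}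
    (e : P.IsId (g ⊚ h)) : P.IsId g ∧ P.IsId h := by
  obtain ⟨rfl, e⟩ := e
  replace e := eq_of_heq e
  obtain rfl := eq_of_comp_eq_id e
  obtain ⟨i, rfl⟩ := P.endo_cyclic _ g
  obtain ⟨j, rfl⟩ := P.endo_cyclic _ h
  rw [← pipow_add] at e
  have := isId_pipow.1 (isId_iff.2 e)
  rw [isId_pipow, isId_pipow]; omega

/-- every morphism `x → y` is `π(y)ⁱ g` -/
def LGen {x y : P.Obj} (g : P.Hom x y) : Prop := ∀ f : P.Hom x y, ∃ i : ℕ, f = P.pipow y i ⊚ g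

/-- every morphism `x → y` is `g π(x)ⁱ` -/
def RGen {x y : P.Obj} (g : P.Hom x y) : Prop := ∀ f : P.Hom x y, ∃ i : ℕ, f = g ⊚ P.pipow x i

/-- `g` is a nonzero generator of `P(x,y)` -/
def Gen {x y : P.Obj} (g : P.Hom x y) : Prop := g ≠ P.zero x y ∧ (P.LGen g ∨ P.RGen g)

theorem exists_gen {x y : P.Obj} {f : P.Hom x y} (hf : f ≠ P.zero x y) :
    ∃ g : P.Hom x y, P.Gen g := by
  obtain ⟨g, hg⟩ := P.hom_cyclic x y
  refine ⟨g, ?_, hg⟩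
  rintro rfl
  rcases hg with hg | hg <;> obtain ⟨i, rfl⟩ := hg f
  · exact hf (P.comp_zero _)
  · exact hf (P.zero_comp _)

/-- a morphism which is not divisible by a loop is a generator -/
theorem gen_of_reduced {x y : P.Obj} {f : P.Hom x y}
    (hl : ∀ i g, f = P.pipow y i ⊚ g → i = 0) (hr : ∀ i g, f = g ⊚ P.pipow x i → i = 0) :
    P.LGen f ∨ P.RGen f := by
  obtain ⟨g, hg⟩ := P.hom_cyclic x y
  rcases hg with hg | hg <;> obtain ⟨i, hi⟩ := hg f
  · obtain rfl := hl i g hi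
    rw [P.pipow_zero, P.id_comp] at hi
    subst hi; exact Or.inl hg
  · obtain rfl := hr i g hi
    rw [P.pipow_zero, P.comp_id] at hi
    subst hi; exact Or.inr hg

theorem IsIrreducible.gen {x y : P.Obj} {f : P.Hom x y} (hf : P.IsIrreducible f) (hxy : x ≠ y) :
    P.LGen f ∨ P.RGen f := by
  refine gen_of_reduced (fun i g h => ?_) (fun i g h => ?_)
  · exact isId_pipow.1 ((hf.2.2 _ _ _ h).resolve_right (not_isId hxy g))
  · exact isId_pipow.1 ((hf.2.2 _ _ _ h).resolve_left (not_isId hxy g))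

theorem IsIrreducible.eq_pi {x : P.Obj} {f : P.Hom x x} (hf : P.IsIrreducible f) : f = P.pi x := by
  obtain ⟨i, rfl⟩ := P.endo_cyclic x f
  obtain _ | i := i
  · exact absurd (P.pipow_zero x ▸ isId_id x) hf.2.1
  · rcases hf.2.2 _ _ _ (P.pipow_succ x i) with h | h
    · exact absurd (isId_pipow.1 h) (by omega)
    · rw [isId_pipow.1 h]; rfl

end RayCategory

namespace RMod

variable {P : RayCategory} {k : Type} [Field k] {D : Set P.Obj}
  {I : ∀ a b : P.Obj, P.Hom a b → Prop}

theorem iso_symm {M N : RMod P k D I} (h : RModIso M N) : RModIso N M := by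
  obtain ⟨φ, hφ⟩ := h
  refine ⟨⟨fun x => ((LinearEquiv.ofBijective (φ.app x) (hφ x)).symm : N.M x →ₗ[k] M.M x), ?_⟩,
    fun x => (LinearEquiv.ofBijective (φ.app x) (hφ x)).symm.bijective⟩
  intro x y f
  ext n
  obtain ⟨m, rfl⟩ := (hφ x).2 n
  apply (hφ y).1
  have h1 := LinearMap.congr_fun (φ.natural f) m
  simp only [LinearMap.comp_apply, LinearEquiv.coe_coe] at h1 ⊢
  have h2 : (LinearEquiv.ofBijective (φ.app x) (hφ x)).symm (φ.app x m) = m :=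
    LinearEquiv.ofBijective_symm_apply_apply _ m
  rw [h2, ← h1]
  exact ((LinearEquiv.ofBijective (φ.app y) (hφ y)).apply_symm_apply _).symm

theorem iso_trans {M N L : RMod P k D I} (h : RModIso M N) (h' : RModIso N L) :
    RModIso M L := by
  obtain ⟨φ, hφ⟩ := h
  obtain ⟨ψ, hψ⟩ := h'
  refine ⟨⟨fun x => (ψ.app x).comp (φ.app x), ?_⟩, fun x => (hψ x).comp (hφ x)⟩
  intro x y f
  rw [← LinearMap.comp_assoc, ψ.natural, LinearMap.comp_assoc, φ.natural, LinearMap.comp_assoc]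

/-- the zero module -/
def zeroMod : RMod P k D I where
  M _ := PUnit
  act _ := 0
  act_id _ _ := by ext
  act_comp _ _ _ _ _ := by ext
  act_zero _ _ := rfl
  supp _ _ _ := rfl
  killed _ _ := rfl

/-- the submodule of `M` with underlying spaces `S x` -/
def subMod (M : RMod P k D I) (S : ∀ x, Submodule k (M.M x))
    (hS : ∀ {x y : P.Obj} (f : P.Hom x y), ∀ m ∈ S x, M.act f m ∈ S y) : RMod P k D I where
  M x := S x
  act f := (M.act f).restrict (hS f)
  act_id x hx := by
    ext m
    simp [M.act_id x hx]
  act_comp hx hy hz g f := by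
    ext m
    simp [M.act_comp hx hy hz g f]
  act_zero hx hy := by
    ext m
    simp [M.act_zero hx hy]
  supp x hx m := Subtype.ext (M.supp x hx m)
  killed f hf := by
    ext m
    simp [M.killed f hf]

/-- the direct sum of two modules -/
def sumMod (M N : RMod P k D I) : RMod P k D I where
  M x := M.M x × N.M x
  act f := (M.act f).prodMap (N.act f)
  act_id x hx := by rw [M.act_id x hx, N.act_id x hx, LinearMap.prodMap_id]
  act_comp hx hy hz g f := by
    rw [M.act_comp hx hy hz g f, N.act_comp hx hy hz g f, LinearMap.prodMap_comp]
  act_zero hx hy := by rw [M.act_zero hx hy, N.act_zero hx hy, LinearMap.prodMap_zero]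
  supp x hx m := Prod.ext (M.supp x hx m.1) (N.supp x hx m.2)
  killed f hf := by rw [M.killed f hf, N.killed f hf, LinearMap.prodMap_zero]

theorem iso_sum_of_idempotent {M R K : RMod P k D I} (e : RModHom M M)
    (he : ∀ x, (e.app x).comp (e.app x) = e.app x)
    (hr : ∀ {x y : P.Obj} (f : P.Hom x y), ∀ m ∈ LinearMap.range (e.app x),
      M.act f m ∈ LinearMap.range (e.app y))
    (hk : ∀ {x y : P.Obj} (f : P.Hom x y), ∀ m ∈ LinearMap.ker (e.app x),
      M.act f m ∈ LinearMap.ker (e.app y))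
    (hR : RModIso R (M.subMod (fun x => LinearMap.range (e.app x)) hr))
    (hK : RModIso K (M.subMod (fun x => LinearMap.ker (e.app x)) hk)) :
    RModIso (R.sumMod K) M := by
  obtain ⟨φ, hφ⟩ := hR
  obtain ⟨ψ, hψ⟩ := hK
  have hc : ∀ x, IsCompl (LinearMap.range (e.app x)) (LinearMap.ker (e.app x)) := fun x =>
    LinearMap.IsIdempotentElem.isCompl (he x)
  refine ⟨⟨fun x => LinearMap.coprod ((LinearMap.range (e.app x)).subtype.comp (φ.app x))
    ((LinearMap.ker (e.app x)).subtype.comp (ψ.app x)), ?_⟩, ?_⟩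
  · intro x y f
    refine LinearMap.ext fun m => ?_
    have h1 := congrArg Subtype.val (LinearMap.congr_fun (φ.natural f) m.1)
    have h2 := congrArg Subtype.val (LinearMap.congr_fun (ψ.natural f) m.2)
    change M.act f ((φ.app x m.1).1 + (ψ.app x m.2).1) = _
    rw [map_add]
    exact congrArg₂ (· + ·) h1 h2
  · intro x
    have h1 : Function.Bijective (Prod.map (φ.app x) (ψ.app x)) := (hφ x).prodMap (hψ x)
    exact (Submodule.prodEquivOfIsCompl _ _ (hc x)).bijective.comp h1

/-- the total dimension over a finite set of points -/
noncomputable def dim (M : RMod P k D I) (hD : D.Finite) : ℕ :=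
  ∑ x ∈ hD.toFinset, Module.finrank k (M.M x)

theorem dim_subMod_lt (M : RMod P k D I) (hD : D.Finite) (hM : ∀ x, FiniteDimensional k (M.M x))
    (S : ∀ x, Submodule k (M.M x))
    (hS : ∀ {x y : P.Obj} (f : P.Hom x y), ∀ m ∈ S x, M.act f m ∈ S y)
    {x : P.Obj} (hx : S x ≠ ⊤) : (M.subMod S hS).dim hD < M.dim hD := by
  refine Finset.sum_lt_sum (fun z _ => Submodule.finrank_le (S z)) ⟨x, ?_, ?_⟩
  · rw [Set.Finite.mem_toFinset]
    by_contra h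
    exact hx (Submodule.eq_top_iff'.2 fun m => by rw [M.supp x h m]; exact zero_mem _)
  · exact Submodule.finrank_lt hx

theorem exists_reps (hD : D.Finite) (hI : RepFin P D I) (n : ℕ) :
    ∃ (ι : Type) (_ : Finite ι) (rep : ι → RMod P k D I), ∀ M : RMod P k D I,
      (∀ x, FiniteDimensional k (M.M x)) → M.dim hD ≤ n → ∃ i, RModIso (rep i) M := by
  have hzero : ∀ M : RMod P k D I, ¬ M.Nonzero → RModIso (zeroMod : RMod P k D I) M := by
    intro M hM
    have h0 : ∀ x, ∀ m : M.M x, m = 0 := fun x m => by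
      by_contra h
      exact hM ⟨x, m, h⟩
    refine ⟨⟨fun x => 0, fun f => by ext; simp⟩, fun x => ⟨fun _ _ _ => rfl, fun m => ⟨0, ?_⟩⟩⟩
    rw [h0 x m]; rfl
  induction n with
  | zero =>
    refine ⟨Unit, inferInstance, fun _ => zeroMod, fun M hM hd => ⟨(), hzero M ?_⟩⟩
    rintro ⟨x, m, hm⟩
    have hx : x ∈ D := by
      by_contra h
      exact hm (M.supp x h m)
    have := Finset.sum_eq_zero_iff.1 (Nat.le_zero.1 hd) x (hD.mem_toFinset.2 hx)
    have := hM x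
    have : Subsingleton (M.M x) := Module.finrank_zero_iff.1 ‹_›
    exact hm (Subsingleton.elim _ _)
  | succ n ih =>
    obtain ⟨ι, _, rep, hrep⟩ := ih
    choose κ hκ rep' hrep' using fun x : P.Obj => hI k x
    have : Finite D := hD
    refine ⟨Unit ⊕ (Σ x : D, κ x) ⊕ (ι × ι), inferInstance,
      Sum.elim (fun _ => zeroMod) (Sum.elim (fun p => rep' p.1 p.2)
        fun p => (rep p.1).sumMod (rep p.2)), fun M hM hd => ?_⟩
    by_cases h0 : M.Nonzero
    swap
    · exact ⟨Sum.inl (), hzero M h0⟩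
    by_cases hi : M.Indec
    · obtain ⟨x, m, hm⟩ := h0
      have hx : x ∈ D := by
        by_contra h
        exact hm (M.supp x h m)
      have hfd : M.FinDim := ⟨hM, hD.subset fun z ⟨m, hm⟩ => by
        by_contra h
        exact hm (M.supp z h m)⟩
      obtain ⟨i, hi⟩ := hrep' x M hfd hi ⟨m, hm⟩
      exact ⟨Sum.inr (Sum.inl ⟨⟨x, hx⟩, i⟩), hi⟩
    · have : ∃ e : RModHom M M, (∀ x, (e.app x).comp (e.app x) = e.app x) ∧
          (∃ x, e.app x ≠ 0) ∧ ∃ x, e.app x ≠ LinearMap.id := by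
        by_contra hcon
        refine hi ⟨h0, fun e he => ?_⟩
        by_contra hne
        push Not at hne
        exact hcon ⟨e, he, hne.1, hne.2⟩
      obtain ⟨e, he, ⟨x, hx⟩, x', hx'⟩ := this
      have hnat : ∀ {x y : P.Obj} (f : P.Hom x y) (m : M.M x),
          M.act f (e.app x m) = e.app y (M.act f m) := fun f m =>
        LinearMap.congr_fun (e.natural f) m
      have hr : ∀ {x y : P.Obj} (f : P.Hom x y), ∀ m ∈ LinearMap.range (e.app x),
          M.act f m ∈ LinearMap.range (e.app y) := by
        rintro x y f _ ⟨m, rfl⟩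
        exact ⟨M.act f m, (hnat f m).symm⟩
      have hk : ∀ {x y : P.Obj} (f : P.Hom x y), ∀ m ∈ LinearMap.ker (e.app x),
          M.act f m ∈ LinearMap.ker (e.app y) := by
        intro x y f m hm
        rw [LinearMap.mem_ker] at hm ⊢
        rw [← hnat, hm, map_zero]
      have hrt : LinearMap.range (e.app x') ≠ ⊤ := by
        intro h
        apply hx'
        ext m
        obtain ⟨m', rfl⟩ := LinearMap.range_eq_top.1 h m
        exact LinearMap.congr_fun (he x') m'
      have hkt : LinearMap.ker (e.app x) ≠ ⊤ := fun h => hx (LinearMap.ker_eq_top.1 h)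
      have d1 := dim_subMod_lt M hD hM _ hr hrt
      have d2 := dim_subMod_lt M hD hM _ hk hkt
      obtain ⟨i, hi⟩ := hrep (M.subMod (fun x => LinearMap.range (e.app x)) hr) (fun z => by
        have := hM z
        exact inferInstanceAs (FiniteDimensional k (LinearMap.range (e.app z)))) (by omega)
      obtain ⟨j, hj⟩ := hrep (M.subMod (fun x => LinearMap.ker (e.app x)) hk) (fun z => by
        have := hM z
        exact inferInstanceAs (FiniteDimensional k (LinearMap.ker (e.app z)))) (by omega)
      exact ⟨Sum.inr (Sum.inr (i, j)), iso_sum_of_idempotent e he hr hk hi hj⟩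

/-- in a representation-finite situation, an infinite family of modules of bounded dimension
contains two isomorphic members -/
theorem exists_iso_of_repFin (hD : D.Finite) (hI : RepFin P D I) {κ : Type} [Infinite κ]
    (F : κ → RMod P k D I) (hF : ∀ c x, FiniteDimensional k ((F c).M x)) (n : ℕ)
    (hn : ∀ c, (F c).dim hD ≤ n) : ∃ c d, c ≠ d ∧ RModIso (F c) (F d) := by
  obtain ⟨ι, _, rep, hrep⟩ := exists_reps (k := k) hD hI n
  choose i hi using fun c => hrep (F c) (hF c) (hn c)
  obtain ⟨c, d, hcd, h⟩ := Finite.exists_ne_map_eq_of_infinite i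
  exact ⟨c, d, hcd, iso_trans (iso_symm (hi c)) (h ▸ hi d)⟩

end RMod

namespace RayCategory

local infixr:80 "⊚" => RayCategory.comp _

/-- morphisms with unspecified endpoints -/
abbrev Arr (P : RayCategory) : Type := Σ s t : P.Obj, P.Hom s t

variable {P : RayCategory}

/-- bundle a morphism with its endpoints -/
abbrev arr {s t : P.Obj} (f : P.Hom s t) : P.Arr := ⟨s, t, f⟩

/-- A finite diagram of points and morphisms over `D`, each morphism of `D` lifting uniquely
at most once at each vertex, such that the listed morphisms are closed under composition and
under factorization in `D`. -/
structure IsCover (D : Set P.Obj) (I : ∀ a b : P.Obj, P.Hom a b → Prop) {ι : Type}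
    (obj : ι → P.Obj) (E : ι → ι → P.Arr → Prop) : Prop where
  mem : ∀ p, obj p ∈ D
  src : ∀ {p q F}, E p q F → F.1 = obj p
  tgt : ∀ {p q F}, E p q F → F.2.1 = obj q
  refl : ∀ p, E p p (arr (P.id (obj p)))
  comp : ∀ {p q r} {s t u : P.Obj} {f : P.Hom s t} {g : P.Hom t u},
    E p q (arr f) → E q r (arr g) → E p r (arr (g ⊚ f))
  lift : ∀ {p q} {s z t : P.Obj} {f : P.Hom s z} {g : P.Hom z t}, z ∈ D →
    E p q (arr (g ⊚ f)) → ∃ r, E p r (arr f) ∧ E r q (arr g)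
  det : ∀ {p q r F}, E p q F → E p r F → q = r
  codet : ∀ {p q r F}, E p r F → E q r F → p = q
  nz : ∀ {p q} {s t : P.Obj} {f : P.Hom s t}, E p q (arr f) → f ≠ P.zero s t
  nI : ∀ {p q} {s t : P.Obj} {f : P.Hom s t}, E p q (arr f) → ¬ I s t f

namespace IsCover

variable {D : Set P.Obj} {I : ∀ a b : P.Obj, P.Hom a b → Prop} {ι : Type} [Fintype ι]
  {obj : ι → P.Obj} {E : ι → ι → P.Arr → Prop} {n : ℕ}

/-- a representation of the diagram by `n × n` matrices -/
structure IsRep (E : ι → ι → P.Arr → Prop) (A : ι → ι → Matrix (Fin n) (Fin n) ℚ) : Prop where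
  one : ∀ p, A p p = 1
  mul : ∀ {p q r} {s t u : P.Obj} {f : P.Hom s t} {g : P.Hom t u},
    E p q (arr f) → E q r (arr g) → A p r = A q r * A p q

open Classical in
/-- the action of a morphism on the total space -/
noncomputable def total (E : ι → ι → P.Arr → Prop) (A : ι → ι → Matrix (Fin n) (Fin n) ℚ)
    (F : P.Arr) : (ι → Fin n → ℚ) →ₗ[ℚ] (ι → Fin n → ℚ) :=
  LinearMap.pi fun q => ∑ p, if E p q F then (Matrix.toLin' (A p q)).comp (LinearMap.proj p) else 0

open Classical in
theorem total_apply (A : ι → ι → Matrix (Fin n) (Fin n) ℚ) (F : P.Arr)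
    (m : ι → Fin n → ℚ) (q : ι) :
    total E A F m q = ∑ p, if E p q F then (A p q).mulVec (m p) else 0 := by
  simp only [total, LinearMap.pi_apply, LinearMap.sum_apply]
  refine Finset.sum_congr rfl fun p _ => ?_
  split <;> simp

/-- vectors concentrated at the vertices over `z` -/
def fiber (obj : ι → P.Obj) (n : ℕ) (z : P.Obj) : Submodule ℚ (ι → Fin n → ℚ) where
  carrier := {m | ∀ p, obj p ≠ z → m p = 0}
  add_mem' h h' p hp := by simp [h p hp, h' p hp]
  zero_mem' _ _ := rfl
  smul_mem' c m h p hp := by simp [h p hp]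

theorem total_mem (hc : IsCover D I obj E) (A : ι → ι → Matrix (Fin n) (Fin n) ℚ) {s t : P.Obj}
    (f : P.Hom s t) (m : ι → Fin n → ℚ) : total E A (arr f) m ∈ fiber obj n t := by
  classical
  intro q hq
  rw [total_apply]
  refine Finset.sum_eq_zero fun p _ => if_neg fun h => hq (hc.tgt h).symm

theorem total_eq_zero (A : ι → ι → Matrix (Fin n) (Fin n) ℚ) {F : P.Arr}
    (h : ∀ p q, ¬ E p q F) : total E A F = 0 := by
  classical
  refine LinearMap.ext fun m => funext fun q => ?_
  rw [total_apply]
  exact Finset.sum_eq_zero fun p _ => if_neg (h p q)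

theorem total_of (hc : IsCover D I obj E) (A : ι → ι → Matrix (Fin n) (Fin n) ℚ) {p q : ι}
    {F : P.Arr} (h : E p q F) (m : ι → Fin n → ℚ) :
    total E A F m q = (A p q).mulVec (m p) := by
  classical
  rw [total_apply, Finset.sum_eq_single p, if_pos h]
  · exact fun r _ hr => if_neg fun h' => hr (hc.codet h' h)
  · exact fun h' => absurd (Finset.mem_univ p) h'

theorem total_of_not (A : ι → ι → Matrix (Fin n) (Fin n) ℚ) {q : ι}
    {F : P.Arr} (h : ∀ p, ¬ E p q F) (m : ι → Fin n → ℚ) :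
    total E A F m q = 0 := by
  classical
  rw [total_apply]
  exact Finset.sum_eq_zero fun p _ => if_neg (h p)

theorem total_id (hc : IsCover D I obj E) {A : ι → ι → Matrix (Fin n) (Fin n) ℚ}
    (hA : IsRep E A) {z : P.Obj} {m : ι → Fin n → ℚ} (hm : m ∈ fiber obj n z) :
    total E A (arr (P.id z)) m = m := by
  funext q
  by_cases hq : obj q = z
  · subst hq
    rw [hc.total_of A (hc.refl q), hA.one, Matrix.one_mulVec]
  · rw [hm q hq, total_of_not]
    exact fun p h => hq (hc.tgt h).symm

theorem total_comp (hc : IsCover D I obj E) {A : ι → ι → Matrix (Fin n) (Fin n) ℚ}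
    (hA : IsRep E A) {s t u : P.Obj} (ht : t ∈ D) (g : P.Hom t u) (f : P.Hom s t)
    (m : ι → Fin n → ℚ) :
    total E A (arr (g ⊚ f)) m = total E A (arr g) (total E A (arr f) m) := by
  funext q
  by_cases h : ∃ p, E p q (arr (g ⊚ f))
  · obtain ⟨p, h⟩ := h
    obtain ⟨r, h1, h2⟩ := hc.lift ht h
    rw [hc.total_of A h, hc.total_of A h2, hc.total_of A h1, hA.mul h1 h2, Matrix.mulVec_mulVec]
  · rw [total_of_not A (fun p hp => h ⟨p, hp⟩)]
    by_cases h' : ∃ r, E r q (arr g)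
    · obtain ⟨r, h2⟩ := h'
      rw [hc.total_of A h2, total_of_not A (fun p hp => h ⟨p, hc.comp hp h2⟩), Matrix.mulVec_zero]
    · rw [total_of_not A (fun p hp => h' ⟨p, hp⟩)]

/-- the module attached to a representation of the diagram -/
noncomputable def toMod (hc : IsCover D I obj E) (A : ι → ι → Matrix (Fin n) (Fin n) ℚ)
    (hA : IsRep E A) : RMod P ℚ D I where
  M z := fiber obj n z
  act f := ((total E A (arr f)).comp (Submodule.subtype _)).codRestrict _
    fun m => hc.total_mem A f m
  act_id z _ := by
    refine LinearMap.ext fun m => Subtype.ext ?_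
    exact hc.total_id hA m.2
  act_comp _ ht _ g f := by
    refine LinearMap.ext fun m => Subtype.ext ?_
    exact hc.total_comp hA ht g f m
  act_zero _ _ := by
    refine LinearMap.ext fun m => Subtype.ext ?_
    simp [total_eq_zero A (fun p q h => hc.nz h rfl)]
  supp z hz m := Subtype.ext (funext fun p => m.2 p fun h => hz (h ▸ hc.mem p))
  killed f hf := by
    refine LinearMap.ext fun m => Subtype.ext ?_
    simp [total_eq_zero A (fun p q h => hc.nI h hf)]

theorem not_repFin (hc : IsCover D I obj E) (hD : D.Finite)
    (A : ℚ → ι → ι → Matrix (Fin n) (Fin n) ℚ) (hA : ∀ c, IsRep E (A c)) {p₀ q₀ : ι} {F₀ : P.Arr}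
    (h₀ : E p₀ q₀ F₀) (hiso : ∀ p q, E p q F₀ → p = p₀) (hA₀ : ∀ c, A c p₀ q₀ ≠ 0)
    (horth : ∀ c d, c ≠ d → ∀ X : ι → Matrix (Fin n) (Fin n) ℚ,
      (∀ p q F, E p q F → A d p q * X p = X q * A c p q) → X q₀ * A c p₀ q₀ = 0) :
    ¬ RepFin P D I := by
  classical
  intro hI
  obtain ⟨c, d, hcd, φ, hφ⟩ := RMod.exists_iso_of_repFin hD hI
    (fun c => hc.toMod (A c) (hA c)) (fun c z => inferInstanceAs (FiniteDimensional ℚ (fiber obj n z)))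
    (hD.toFinset.card * Module.finrank ℚ (ι → Fin n → ℚ))
    (fun c => by
      rw [← smul_eq_mul]
      exact Finset.sum_le_card_nsmul _ _ _ fun z _ => Submodule.finrank_le (fiber obj n z))
  have hsingle : ∀ p v, (Pi.single p v : ι → Fin n → ℚ) ∈ fiber obj n (obj p) := by
    intro p v r hr
    have h : r ≠ p := by
      rintro rfl
      exact hr rfl
    exact Pi.single_eq_of_ne (M := fun _ : ι => Fin n → ℚ) h v
  let inc : ∀ p, (Fin n → ℚ) →ₗ[ℚ] fiber obj n (obj p) := fun p =>
    (LinearMap.single ℚ (fun _ : ι => Fin n → ℚ) p).codRestrict _ (hsingle p)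
  let φ' : ∀ p, (Fin n → ℚ) →ₗ[ℚ] (Fin n → ℚ) := fun p =>
    (LinearMap.proj p).comp ((Submodule.subtype _).comp ((φ.app (obj p)).comp (inc p)))
  have hact : ∀ {p q} {f : P.Hom (obj p) (obj q)}, E p q (arr f) → ∀ v,
      (hc.toMod (A c) (hA c)).act f (inc p v) = inc q ((A c p q).mulVec v) := by
    intro p q f h v
    refine Subtype.ext (funext fun r => ?_)
    change total E (A c) (arr f) (Pi.single p v) r = (Pi.single q _ : ι → Fin n → ℚ) r
    by_cases hr : r = q
    · subst hr
      rw [hc.total_of (A c) h, Pi.single_eq_same, Pi.single_eq_same]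
    · rw [Pi.single_eq_of_ne hr]
      by_cases h' : ∃ p', E p' r (arr f)
      · obtain ⟨p', h'⟩ := h'
        rw [hc.total_of (A c) h', Pi.single_eq_of_ne, Matrix.mulVec_zero]
        rintro rfl
        exact hr (hc.det h' h)
      · exact total_of_not (A c) (fun p' hp' => h' ⟨p', hp'⟩) _
  have hφ' : ∀ {p q F}, E p q F → ∀ v,
      (A d p q).mulVec (φ' p v) = φ' q ((A c p q).mulVec v) := by
    rintro p q ⟨s, t, f⟩ h v
    obtain rfl : s = obj p := hc.src h
    obtain rfl : t = obj q := hc.tgt h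
    have h1 : (hc.toMod (A d) (hA d)).act f (φ.app (obj p) (inc p v)) =
        φ.app (obj q) ((hc.toMod (A c) (hA c)).act f (inc p v)) :=
      LinearMap.congr_fun (φ.natural f) (inc p v)
    rw [hact h] at h1
    have h2 := congrFun (congrArg Subtype.val h1) q
    change total E (A d) (arr f) (φ.app (obj p) (inc p v)).1 q = _ at h2
    rw [hc.total_of (A d) h] at h2
    exact h2
  have hX := horth c d hcd (fun p => LinearMap.toMatrix' (φ' p)) (fun p q F h => by
    rw [← LinearMap.toMatrix'_toLin' (A d p q), ← LinearMap.toMatrix'_toLin' (A c p q),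
      ← LinearMap.toMatrix'_comp, ← LinearMap.toMatrix'_comp]
    congr 1
    refine LinearMap.ext fun v => ?_
    simpa using hφ' h v)
  obtain ⟨s, t, f⟩ := F₀
  obtain rfl : s = obj p₀ := hc.src h₀
  obtain rfl : t = obj q₀ := hc.tgt h₀
  have hz : ∀ v, φ' q₀ ((A c p₀ q₀).mulVec v) = 0 := by
    intro v
    have := congrArg (fun B => Matrix.mulVec B v) hX
    simp only [← Matrix.mulVec_mulVec, LinearMap.toMatrix'_mulVec, Matrix.zero_mulVec] at this
    exact this
  apply hA₀ c
  apply Matrix.toLin'.injective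
  refine LinearMap.ext fun v => ?_
  rw [Matrix.toLin'_apply, map_zero, LinearMap.zero_apply]
  have h1 : (hc.toMod (A d) (hA d)).act f (φ.app (obj p₀) (inc p₀ v)) =
      φ.app (obj q₀) ((hc.toMod (A c) (hA c)).act f (inc p₀ v)) :=
    LinearMap.congr_fun (φ.natural f) (inc p₀ v)
  have h2 : (hc.toMod (A d) (hA d)).act f (φ.app (obj p₀) (inc p₀ v)) = 0 := by
    refine Subtype.ext (funext fun r => ?_)
    change total E (A d) (arr f) (φ.app (obj p₀) (inc p₀ v)).1 r = 0
    by_cases hr : ∃ p, E p r (arr f)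
    · obtain ⟨p, hr⟩ := hr
      obtain rfl := hiso p r hr
      obtain rfl := hc.det hr h₀
      rw [hc.total_of (A d) h₀]
      exact (hφ' h₀ v).trans (hz v)
    · exact total_of_not (A d) (fun p hp => hr ⟨p, hp⟩) _
  rw [h2, hact h₀] at h1
  have h3 := (hφ (obj q₀)).1 (h1.symm.trans (map_zero _).symm)
  have h4 := congrFun (congrArg Subtype.val h3) q₀
  change (Pi.single q₀ _ : ι → Fin n → ℚ) q₀ = 0 at h4
  rwa [Pi.single_eq_same] at h4

end IsCover

end RayCategory

namespace RayCategory

local infixr:80 "⊚" => RayCategory.comp _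

variable {P : RayCategory} {D : Set P.Obj} {I : ∀ a b : P.Obj, P.Hom a b → Prop}

namespace IsCover

variable {ι : Type} [Fintype ι] [DecidableEq ι]
  {obj : ι → P.Obj} {E : ι → ι → P.Arr → Prop}

/-- four lines in the plane with cross-ratio `c` -/
def line (c : ℚ) : Fin 4 → Fin 2 → ℚ := ![![1, 0], ![0, 1], ![1, 1], ![1, c]]

/-- a matrix with image spanned by the given line -/
def embMat (c : ℚ) : Option (Fin 4) → Matrix (Fin 2) (Fin 2) ℚ
  | none => 1
  | some i => !![line c i 0, 0; line c i 1, 0]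

/-- a matrix with kernel spanned by the given line -/
def projMat (c : ℚ) : Option (Fin 4) → Matrix (Fin 2) (Fin 2) ℚ
  | none => 1
  | some i => !![-line c i 1, line c i 0; 0, 0]

theorem embMat_ne_zero (c : ℚ) (o : Option (Fin 4)) : embMat c o ≠ 0 := by
  intro h
  have h0 := congrFun (congrFun h 0) 0
  have h1 := congrFun (congrFun h 1) 0
  rcases o with _ | i
  · simp [embMat] at h0
  · fin_cases i <;> simp [embMat, line] at h0 h1

theorem projMat_ne_zero (c : ℚ) (o : Option (Fin 4)) : projMat c o ≠ 0 := by
  intro h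
  have h0 := congrFun (congrFun h 0) 0
  have h1 := congrFun (congrFun h 0) 1
  rcases o with _ | i
  · simp [projMat] at h0
  · fin_cases i <;> simp [projMat, line] at h0 h1

theorem line_relation_of_emb {c d : ℚ} {i : Fin 4} {X Y : Matrix (Fin 2) (Fin 2) ℚ}
    (h : embMat d (some i) * Y = X * embMat c (some i)) :
    line d i 0 * (X 1 0 * line c i 0 + X 1 1 * line c i 1) =
      line d i 1 * (X 0 0 * line c i 0 + X 0 1 * line c i 1) := by
  have h0 := congrFun (congrFun h 0) 0
  have h1 := congrFun (congrFun h 1) 0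
  simp [embMat, Matrix.mul_apply, Fin.sum_univ_two] at h0 h1
  rw [← h0, ← h1]; ring

theorem line_relation_of_proj {c d : ℚ} {i : Fin 4} {X Y : Matrix (Fin 2) (Fin 2) ℚ}
    (h : projMat d (some i) * X = Y * projMat c (some i)) :
    line d i 0 * (X 1 0 * line c i 0 + X 1 1 * line c i 1) =
      line d i 1 * (X 0 0 * line c i 0 + X 0 1 * line c i 1) := by
  have h0 := congrFun (congrFun h 0) 0
  have h1 := congrFun (congrFun h 0) 1
  simp [projMat, Matrix.mul_apply, Fin.sum_univ_two] at h0 h1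
  linear_combination line c i 0 * h0 + line c i 1 * h1

theorem eq_zero_of_line_relations {c d : ℚ} (hcd : c ≠ d) {X : Matrix (Fin 2) (Fin 2) ℚ}
    (h : ∀ i, line d i 0 * (X 1 0 * line c i 0 + X 1 1 * line c i 1) =
      line d i 1 * (X 0 0 * line c i 0 + X 0 1 * line c i 1)) : X = 0 := by
  have h0 := h 0
  have h1 := h 1
  have h2 := h 2
  have h3 := h 3
  simp [line] at h0 h1 h2 h3
  rw [h0] at h2 h3
  have h4 : X 1 1 = X 0 0 := by linarith
  have h5 : X 0 0 = 0 := by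
    have : X 0 0 * (c - d) = 0 := by linear_combination h3 - c * h4 - c * d * h1
    exact (mul_eq_zero.1 this).resolve_right (sub_ne_zero.2 hcd)
  ext i j
  fin_cases i <;> fin_cases j <;> simp [h0, h1, h4, h5]

/-- diagrams of extended type `D`: central vertices carrying a plane and four leaves -/
theorem not_repFin_of_leaves (hc : IsCover D I obj E) (hD : D.Finite) (lf : ι → Option (Fin 4))
    (hshape : ∀ {p q r F G}, E p q F → E q r G → p ≠ q → q ≠ r → lf q = none ∧ p ≠ r)
    (c₀ : ι)
    (hconn : ∀ G : ι → Matrix (Fin 2) (Fin 2) ℚ,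
      (∀ p q F, lf p = none → lf q = none → E p q F → G p = G q) → ∀ p, lf p = none → G p = G c₀)
    (hatt : ∀ i, ∃ p m F, lf p = some i ∧ lf m = none ∧ (E p m F ∨ E m p F))
    {p₀ q₀ : ι} {F₀ : P.Arr} (h₀ : E p₀ q₀ F₀) (hpq : p₀ ≠ q₀)
    (hmid : lf p₀ = none ∨ lf q₀ = none) (hiso : ∀ p q, E p q F₀ → p = p₀) :
    ¬ RepFin P D I := by
  have hA : ∀ c : ℚ, ∀ p q, p ≠ q → (if p = q then 1 else projMat c (lf q) * embMat c (lf p)) =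
      projMat c (lf q) * embMat c (lf p) := fun c p q h => if_neg h
  refine hc.not_repFin hD
    (fun c p q => if p = q then 1 else projMat c (lf q) * embMat c (lf p))
    (fun c => ⟨fun p => if_pos rfl, ?_⟩) h₀ hiso ?_ ?_
  · intro p q r s t u f g h1 h2
    by_cases hp : p = q
    · subst hp; simp
    by_cases hq : q = r
    · subst hq; simp
    obtain ⟨h3, h4⟩ := hshape h1 h2 hp hq
    rw [hA c p r h4, hA c p q hp, hA c q r hq, h3]
    simp [embMat, projMat]
  · intro c
    simp only [hA c p₀ q₀ hpq]
    rcases hmid with h | h <;> rw [h]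
    · simpa [embMat] using projMat_ne_zero c _
    · simpa [projMat] using embMat_ne_zero c _
  · intro c d hcd X hX
    have hXm : ∀ m, lf m = none → X m = X c₀ := by
      refine hconn X fun p q F hp hq hE => ?_
      by_cases h : p = q
      · rw [h]
      have := hX p q F hE
      simp only [if_neg h, hp, hq] at this
      simpa [embMat, projMat] using this
    have hX₀ : X c₀ = 0 := by
      refine eq_zero_of_line_relations hcd fun i => ?_
      obtain ⟨p, m, F, hp, hm, h | h⟩ := hatt i
      · have hpm : p ≠ m := by
          rintro rfl
          simp [hm] at hp
        have := hX p m F h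
        simp only [if_neg hpm, hp, hm, hXm m hm] at this
        refine line_relation_of_emb (Y := X p) ?_
        simpa [projMat] using this
      · have hpm : m ≠ p := by
          rintro rfl
          simp [hm] at hp
        have := hX m p F h
        simp only [if_neg hpm, hp, hm, hXm m hm] at this
        refine line_relation_of_proj (Y := X p) ?_
        simpa [embMat] using this
    rcases hmid with h | h
    · rw [← hX p₀ q₀ F₀ h₀, hXm p₀ h, hX₀, mul_zero]
    · rw [hXm q₀ h, hX₀, zero_mul]

end IsCover

/-- the diagram with prescribed non-identity morphisms -/
def listRel {N : ℕ} (obj : Fin N → P.Obj) (L : List (Fin N × Fin N × P.Arr)) (p q : Fin N)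
    (F : P.Arr) : Prop :=
  (p = q ∧ F = arr (P.id (obj p))) ∨ (p, q, F) ∈ L

/-- conditions on a list of morphisms which make it a diagram as in `IsCover` -/
structure IsCoverList (D : Set P.Obj) {x y : P.Obj} (mu : P.Hom x y) {N : ℕ}
    (obj : Fin N → P.Obj) (L : List (Fin N × Fin N × P.Arr)) : Prop where
  mem : ∀ p, obj p ∈ D
  left_mem : x ∈ D
  right_mem : y ∈ D
  nid_mu : ¬ P.IsId mu
  src : ∀ l ∈ L, l.2.2.1 = obj l.1
  tgt : ∀ l ∈ L, l.2.2.2.1 = obj l.2.1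
  nid : ∀ l ∈ L, ¬ P.IsId l.2.2.2.2
  nz : ∀ l ∈ L, l.2.2.2.2 ≠ P.zero _ _
  ne_mu : ∀ l ∈ L, l.2.2 ≠ arr mu
  dist : L.Pairwise fun l l' => l.1 = l'.1 ∨ l.2.1 = l'.2.1 → l.2.2 ≠ l'.2.2
  comp : ∀ l ∈ L, ∀ l' ∈ L, l.2.1 = l'.1 → ∃ (s t u : P.Obj) (f : P.Hom s t) (g : P.Hom t u),
    l.2.2 = arr f ∧ l'.2.2 = arr g ∧ (l.1, l'.2.1, arr (g ⊚ f)) ∈ L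
  lift : ∀ l ∈ L, ∀ z ∈ D, ∀ (g : P.Hom z l.2.2.2.1) (h : P.Hom l.2.2.1 z), l.2.2.2.2 = g ⊚ h →
    P.IsId g ∨ P.IsId h ∨ ∃ r, (l.1, r, arr h) ∈ L ∧ (r, l.2.1, arr g) ∈ L

theorem eq_of_pairwise {α : Type} {R : α → α → Prop} (hs : ∀ a b, R a b → R b a) {L : List α}
    (h : L.Pairwise R) {a b : α} (ha : a ∈ L) (hb : b ∈ L) (hn : ¬ R a b) : a = b := by
  by_contra hab
  have : Std.Symm R := ⟨hs⟩
  exact hn (h.forall ha hb hab)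

variable {x y : P.Obj} {mu : P.Hom x y}

theorem IsCoverList.isCover {N : ℕ} {obj : Fin N → P.Obj} {L : List (Fin N × Fin N × P.Arr)}
    (hL : IsCoverList D mu obj L) : IsCover D (IdealOf P mu) obj (listRel obj L) := by
  have huniq : ∀ {p q p' q' F}, (p, q, F) ∈ L → (p', q', F) ∈ L → (p = p' ∨ q = q') →
      p = p' ∧ q = q' := by
    intro p q p' q' F h h' hpq
    have := eq_of_pairwise (fun a b h h1 => (h (h1.imp Eq.symm Eq.symm)).symm) hL.dist h h'
      (fun h => h hpq rfl)
    simp only [Prod.mk.injEq] at this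
    exact ⟨this.1, this.2.1⟩
  have hlift : ∀ {p q} {s z t : P.Obj} {f : P.Hom s z} {g : P.Hom z t}, z ∈ D →
      listRel obj L p q (arr (g ⊚ f)) →
        ∃ r, listRel obj L p r (arr f) ∧ listRel obj L r q (arr g) := by
    rintro p q s z t f g hz (⟨rfl, h⟩ | h)
    · have h1 : P.IsId (g ⊚ f) := by
        obtain ⟨h2, h3⟩ := Sigma.mk.inj_iff.1 h
        subst h2
        obtain ⟨h4, h5⟩ := Sigma.mk.inj_iff.1 (eq_of_heq h3)
        subst h4
        rw [eq_of_heq h5]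
        exact isId_id _
      obtain ⟨⟨rfl, hg⟩, ⟨rfl, hf⟩⟩ := isId_of_comp_isId h1
      cases hg
      cases hf
      rw [P.comp_id] at h
      exact ⟨p, Or.inl ⟨rfl, h⟩, Or.inl ⟨rfl, h⟩⟩
    · rcases hL.lift _ h z hz g f rfl with hg | hf | ⟨r, h1, h2⟩
      · have hq := hL.tgt _ h
        obtain ⟨rfl, hg⟩ := hg
        cases hg
        dsimp only at hq
        subst hq
        rw [P.id_comp] at h
        exact ⟨q, Or.inr h, Or.inl ⟨rfl, rfl⟩⟩
      · have hp : s = obj p := hL.src _ h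
        obtain ⟨hz', hf⟩ := hf
        change s = z at hz'
        subst hz' hp
        obtain rfl : f = P.id _ := eq_of_heq hf
        rw [P.comp_id] at h
        exact ⟨p, Or.inl ⟨rfl, rfl⟩, Or.inr h⟩
      · exact ⟨r, Or.inr h1, Or.inr h2⟩
  refine
  { mem := hL.mem
    src := ?_
    tgt := ?_
    refl := fun p => Or.inl ⟨rfl, rfl⟩
    comp := ?_
    lift := hlift
    det := ?_
    codet := ?_
    nz := ?_
    nI := ?_ }
  · rintro p q F (⟨rfl, rfl⟩ | h)
    · rfl
    · exact hL.src _ h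
  · rintro p q F (⟨rfl, rfl⟩ | h)
    · rfl
    · exact hL.tgt _ h
  · rintro p q r s t u f g (⟨rfl, h⟩ | h) (⟨rfl, h'⟩ | h')
    · cases h
      cases h'
      exact Or.inl ⟨rfl, by rw [P.comp_id]⟩
    · cases h
      rw [P.comp_id]
      exact Or.inr h'
    · cases h'
      rw [P.id_comp]
      exact Or.inr h
    · obtain ⟨s', t', u', f', g', h1, h2, h3⟩ := hL.comp _ h _ h' rfl
      cases h1
      cases h2
      exact Or.inr h3
  · rintro p q r F (⟨rfl, rfl⟩ | h) (⟨rfl, h'⟩ | h')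
    · rfl
    · exact absurd (isId_id _) (hL.nid _ h')
    · subst h'
      exact absurd (isId_id _) (hL.nid _ h)
    · exact (huniq h h' (Or.inl rfl)).2
  · rintro p q r F (⟨rfl, rfl⟩ | h) (⟨rfl, h'⟩ | h')
    · rfl
    · exact absurd (isId_id _) (hL.nid _ h')
    · subst h'
      exact absurd (isId_id _) (hL.nid _ h)
    · exact (huniq h h' (Or.inr rfl)).1
  · rintro p q s t f (⟨rfl, h⟩ | h)
    · cases h
      exact id_ne_zero _
    · exact hL.nz _ h
  · rintro p q s t f h ⟨g, k, rfl⟩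
    obtain ⟨r, h1, -⟩ := hlift hL.right_mem h
    obtain ⟨r', -, h2⟩ := hlift hL.left_mem h1
    rcases h2 with ⟨-, h3⟩ | h3
    · have := hL.nid_mu
      obtain ⟨h4, h5⟩ := Sigma.mk.inj_iff.1 h3
      subst h4
      obtain ⟨h6, h7⟩ := Sigma.mk.inj_iff.1 (eq_of_heq h5)
      subst h6
      rw [eq_of_heq h7] at this
      exact this (isId_id _)
    · exact hL.ne_mu _ h3 rfl

theorem IsCoverList.not_repFin_of_leaves {N : ℕ} {obj : Fin N → P.Obj}
    {L : List (Fin N × Fin N × P.Arr)} (hL : IsCoverList D mu obj L) (hD : D.Finite)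
    (lf : Fin N → Option (Fin 4))
    (hshape : ∀ l ∈ L, ∀ l' ∈ L, l.2.1 = l'.1 → lf l.2.1 = none ∧ l.1 ≠ l'.2.1)
    (c₀ : Fin N)
    (hconn : ∀ G : Fin N → Matrix (Fin 2) (Fin 2) ℚ,
      (∀ l ∈ L, lf l.1 = none → lf l.2.1 = none → G l.1 = G l.2.1) →
        ∀ p, lf p = none → G p = G c₀)
    (hatt : ∀ i, ∃ l ∈ L, (lf l.1 = some i ∧ lf l.2.1 = none) ∨ (lf l.1 = none ∧ lf l.2.1 = some i))
    (l₀ : Fin N × Fin N × P.Arr) (h₀ : l₀ ∈ L) (hpq : l₀.1 ≠ l₀.2.1)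
    (hmid : lf l₀.1 = none ∨ lf l₀.2.1 = none)
    (hiso : ∀ l ∈ L, l.2.2 = l₀.2.2 → l.1 = l₀.1) : ¬ RepFin P D (IdealOf P mu) := by
  refine hL.isCover.not_repFin_of_leaves hD lf ?_ c₀ ?_ ?_ (Or.inr h₀) hpq hmid ?_
  · rintro p q r F G (⟨h, _⟩ | h) (⟨h', _⟩ | h') hp hq
    · exact absurd h hp
    · exact absurd h hp
    · exact absurd h' hq
    · exact hshape _ h _ h' rfl
  · exact fun G hG => hconn G fun l hl h1 h2 => hG _ _ l.2.2 h1 h2 (Or.inr hl)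
  · intro i
    obtain ⟨l, hl, ⟨h1, h2⟩ | ⟨h1, h2⟩⟩ := hatt i
    · exact ⟨_, _, l.2.2, h1, h2, Or.inl (Or.inr hl)⟩
    · exact ⟨_, _, l.2.2, h2, h1, Or.inr (Or.inr hl)⟩
  · rintro p q (⟨rfl, h⟩ | h)
    · have := hL.nid _ h₀
      rw [show l₀.2.2 = arr (P.id (obj p)) from h] at this
      exact absurd (isId_id _) this
    · exact hiso _ h rfl

theorem IsCoverList.not_repFin_of_cycle {N : ℕ} {obj : Fin N → P.Obj}
    {L : List (Fin N × Fin N × P.Arr)} (hL : IsCoverList D mu obj L) (hD : D.Finite)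
    (hshape : ∀ l ∈ L, ∀ l' ∈ L, l.2.1 ≠ l'.1) (l₀ l₁ : Fin N × Fin N × P.Arr)
    (h₀ : l₀ ∈ L) (h₁ : l₁ ∈ L) (h₀₁ : l₁.1 ≠ l₀.1)
    (hconn : ∀ G : Fin N → ℚ,
      (∀ l ∈ L, (l.1 ≠ l₀.1 ∨ l.2.1 ≠ l₀.2.1) → G l.1 = G l.2.1) → ∀ p, G p = G l₀.1)
    (hiso : ∀ l ∈ L, l.2.2 = l₁.2.2 → l.1 = l₁.1) : ¬ RepFin P D (IdealOf P mu) := by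
  have hne : l₀.1 ≠ l₀.2.1 := (hshape _ h₀ _ h₀).symm
  refine hL.isCover.not_repFin hD (n := 1) (p₀ := l₁.1) (q₀ := l₁.2.1) (F₀ := l₁.2.2)
    (fun c p q => if p = l₀.1 ∧ q = l₀.2.1 then !![c] else 1)
    (fun c => ⟨fun p => if_neg fun h => hne (h.1.symm.trans h.2), ?_⟩) (Or.inr h₁) ?_ ?_ ?_
  · have hid : ∀ p, (if p = l₀.1 ∧ p = l₀.2.1 then !![c] else 1 : Matrix (Fin 1) (Fin 1) ℚ) = 1 :=
      fun p => if_neg fun h => hne (h.1.symm.trans h.2)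
    rintro p q r s t u f g (⟨rfl, -⟩ | h) (⟨rfl, -⟩ | h')
    · simp only [hid, mul_one]
    · simp only [hid, mul_one]
    · simp only [hid, one_mul]
    · exact absurd rfl (hshape _ h _ h')
  · rintro p q (⟨rfl, h⟩ | h)
    · have := hL.nid _ h₁
      rw [show l₁.2.2 = arr (P.id (obj p)) from h] at this
      exact absurd (isId_id _) this
    · exact hiso _ h rfl
  · intro c
    simp [h₀₁]
  · intro c d hcd X hX
    have hG := hconn (fun p => X p 0 0) fun l hl hl' => by
      have := hX l.1 l.2.1 l.2.2 (Or.inr hl)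
      rw [if_neg (by tauto), if_neg (by tauto), one_mul, mul_one] at this
      simp only [this]
    have h2 := congrFun (congrFun (hX l₀.1 l₀.2.1 l₀.2.2 (Or.inr h₀)) 0) 0
    simp [Matrix.mul_apply] at h2
    have hG1 := hG l₀.2.1
    have hG2 := hG l₁.2.1
    rw [hG1] at h2
    have h3 : X l₀.1 0 0 * (c - d) = 0 := by linear_combination -h2
    have h4 := (mul_eq_zero.1 h3).resolve_right (sub_ne_zero.2 hcd)
    have h5 : X l₁.2.1 = 0 := by
      ext i j
      fin_cases i
      fin_cases j
      simpa [h4] using hG2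
    rw [h5, zero_mul]

/-- lists of morphisms irreducible in `D` from top vertices to socle vertices -/
theorem isCoverList_of_irreducible {N : ℕ} {obj : Fin N → P.Obj}
    {L : List (Fin N × Fin N × P.Arr)} (hx : x ∈ D) (hy : y ∈ D)
    (hmu : ¬ P.IsIrreducibleOn D mu) (hmu' : ¬ P.IsId mu)
    (mem : ∀ p, obj p ∈ D) (src : ∀ l ∈ L, l.2.2.1 = obj l.1) (tgt : ∀ l ∈ L, l.2.2.2.1 = obj l.2.1)
    (irr : ∀ l ∈ L, P.IsIrreducibleOn D l.2.2.2.2)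
    (dist : L.Pairwise fun l l' => (l.1 = l'.1 → l.2.2.2.1 ≠ l'.2.2.2.1) ∧
      (l.2.1 = l'.2.1 → l.2.2.1 ≠ l'.2.2.1))
    (hshape : ∀ l ∈ L, ∀ l' ∈ L, l.2.1 ≠ l'.1) : IsCoverList D mu obj L where
  mem := mem
  left_mem := hx
  right_mem := hy
  nid_mu := hmu'
  src := src
  tgt := tgt
  nid l hl := (irr l hl).2.1
  nz l hl := (irr l hl).1
  ne_mu l hl h := hmu (by
    have := irr l hl
    rw [h] at this
    exact this)
  dist := by
    refine dist.imp ?_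
    rintro l l' ⟨h1, h2⟩ (h | h) h'
    · exact h1 h (by rw [h'])
    · exact h2 h (by rw [h'])
  comp l hl l' hl' h := absurd h (hshape l hl l' hl')
  lift l hl z hz g h e := ((irr l hl).2.2 z hz g h e).imp_right Or.inl

end RayCategory

namespace RayCategory

local infixr:80 "⊚" => RayCategory.comp _

variable {P : RayCategory} {D : Set P.Obj} {x y : P.Obj} {mu : P.Hom x y}

/-- a finite full subcategory containing `x` and `y` which becomes representation-finite modulo
the morphism `mu : x → y`, where `mu` is neither an identity nor irreducible in `D` -/
structure RepFinOn (D : Set P.Obj) {x y : P.Obj} (mu : P.Hom x y) : Prop where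
  fin : D.Finite
  left_mem : x ∈ D
  right_mem : y ∈ D
  nirr : ¬ P.IsIrreducibleOn D mu
  nid : ¬ P.IsId mu
  rep : RepFin P D (IdealOf P mu)

namespace RepFinOn

theorem no_cycle_four (h : RepFinOn D mu) {s₁ s₂ t₁ t₂ : P.Obj}
    (hs₁ : s₁ ∈ D) (hs₂ : s₂ ∈ D) (ht₁ : t₁ ∈ D) (ht₂ : t₂ ∈ D) (hs : s₁ ≠ s₂) (ht : t₁ ≠ t₂)
    {f₁₁ : P.Hom s₁ t₁} {f₁₂ : P.Hom s₁ t₂} {f₂₁ : P.Hom s₂ t₁} {f₂₂ : P.Hom s₂ t₂}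
    (h₁₁ : P.IsIrreducibleOn D f₁₁) (h₁₂ : P.IsIrreducibleOn D f₁₂)
    (h₂₁ : P.IsIrreducibleOn D f₂₁) (h₂₂ : P.IsIrreducibleOn D f₂₂) : False := by
  have hL : IsCoverList D mu ![s₁, s₂, t₁, t₂]
      [(0, 2, arr f₁₁), (0, 3, arr f₁₂), (1, 2, arr f₂₁), (1, 3, arr f₂₂)] := by
    apply isCoverList_of_irreducible h.left_mem h.right_mem h.nirr h.nid
    · simp [Fin.forall_fin_succ, *]
    · simp
    · simp
    · simp [*]
    · simp [hs, ht]
    · simp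
  refine hL.not_repFin_of_cycle h.fin (by simp) (0, 2, arr f₁₁) (1, 2, arr f₂₁) (by simp) (by simp)
    (by simp) ?_ ?_ h.rep
  · simp [Fin.forall_fin_succ]
    grind
  · simp [hs]

theorem no_cycle_six (h : RepFinOn D mu) {s₁ s₂ s₃ t₁ t₂ t₃ : P.Obj}
    (hs₁ : s₁ ∈ D) (hs₂ : s₂ ∈ D) (hs₃ : s₃ ∈ D) (ht₁ : t₁ ∈ D) (ht₂ : t₂ ∈ D) (ht₃ : t₃ ∈ D)
    (hs₁₂ : s₁ ≠ s₂) (hs₂₃ : s₂ ≠ s₃) (ht₁₂ : t₁ ≠ t₂) (ht₁₃ : t₁ ≠ t₃)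
    (ht₂₃ : t₂ ≠ t₃) (hs₁₃ : s₁ ≠ s₃)
    {f₁₁ : P.Hom s₁ t₁} {f₁₂ : P.Hom s₁ t₂} {f₂₁ : P.Hom s₂ t₁} {f₂₃ : P.Hom s₂ t₃}
    {f₃₂ : P.Hom s₃ t₂} {f₃₃ : P.Hom s₃ t₃}
    (h₁₁ : P.IsIrreducibleOn D f₁₁) (h₁₂ : P.IsIrreducibleOn D f₁₂)
    (h₂₁ : P.IsIrreducibleOn D f₂₁) (h₂₃ : P.IsIrreducibleOn D f₂₃)
    (h₃₂ : P.IsIrreducibleOn D f₃₂) (h₃₃ : P.IsIrreducibleOn D f₃₃) : False := by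
  have hL : IsCoverList D mu ![s₁, s₂, s₃, t₁, t₂, t₃]
      [(0, 3, arr f₁₁), (0, 4, arr f₁₂), (1, 3, arr f₂₁), (1, 5, arr f₂₃), (2, 4, arr f₃₂),
        (2, 5, arr f₃₃)] := by
    apply isCoverList_of_irreducible h.left_mem h.right_mem h.nirr h.nid
    · simp [Fin.forall_fin_succ, *]
    · simp
    · simp
    · simp [*]
    · simp [*]
    · simp
  refine hL.not_repFin_of_cycle h.fin (by simp) (0, 3, arr f₁₁) (1, 3, arr f₂₁) (by simp) (by simp)
    (by simp) ?_ ?_ h.rep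
  · simp [Fin.forall_fin_succ]
    grind
  · simp [hs₁₂, hs₂₃.symm]

theorem no_four_in (h : RepFinOn D mu) {s₁ s₂ s₃ s₄ t : P.Obj}
    (hs₁ : s₁ ∈ D) (hs₂ : s₂ ∈ D) (hs₃ : s₃ ∈ D) (hs₄ : s₄ ∈ D) (ht : t ∈ D)
    (h₁₂ : s₁ ≠ s₂) (h₁₃ : s₁ ≠ s₃) (h₁₄ : s₁ ≠ s₄) (h₂₃ : s₂ ≠ s₃) (h₂₄ : s₂ ≠ s₄)
    (h₃₄ : s₃ ≠ s₄) {f₁ : P.Hom s₁ t} {f₂ : P.Hom s₂ t} {f₃ : P.Hom s₃ t} {f₄ : P.Hom s₄ t}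
    (h₁ : P.IsIrreducibleOn D f₁) (h₂ : P.IsIrreducibleOn D f₂)
    (h₃ : P.IsIrreducibleOn D f₃) (h₄ : P.IsIrreducibleOn D f₄) : False := by
  have hL : IsCoverList D mu ![s₁, s₂, s₃, s₄, t]
      [(0, 4, arr f₁), (1, 4, arr f₂), (2, 4, arr f₃), (3, 4, arr f₄)] := by
    apply isCoverList_of_irreducible h.left_mem h.right_mem h.nirr h.nid
    · simp [Fin.forall_fin_succ, *]
    · simp
    · simp
    · simp [*]
    · simp [*]
    · simp
  refine hL.not_repFin_of_leaves h.fin ![some 0, some 1, some 2, some 3, none] (by simp) 4 ?_ ?_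
    (0, 4, arr f₁) (by simp) (by simp) (by simp) ?_ h.rep
  · simp [Fin.forall_fin_succ]
  · simp [Fin.forall_fin_succ]
  · simp [h₁₂.symm, h₁₃.symm, h₁₄.symm]

theorem no_three_in_three_out (h : RepFinOn D mu) {s₁ s₂ s₃ t₁ t₂ t₃ : P.Obj}
    (hs₁ : s₁ ∈ D) (hs₂ : s₂ ∈ D) (hs₃ : s₃ ∈ D) (ht₁ : t₁ ∈ D) (ht₂ : t₂ ∈ D) (ht₃ : t₃ ∈ D)
    (hs₁₂ : s₁ ≠ s₂) (hs₁₃ : s₁ ≠ s₃) (hs₂₃ : s₂ ≠ s₃) (ht₁₂ : t₁ ≠ t₂) (ht₁₃ : t₁ ≠ t₃)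
    (ht₂₃ : t₂ ≠ t₃) {f₁₁ : P.Hom s₁ t₁} {f₂₁ : P.Hom s₂ t₁} {f₃₁ : P.Hom s₃ t₁}
    {f₃₂ : P.Hom s₃ t₂} {f₃₃ : P.Hom s₃ t₃}
    (h₁₁ : P.IsIrreducibleOn D f₁₁) (h₂₁ : P.IsIrreducibleOn D f₂₁)
    (h₃₁ : P.IsIrreducibleOn D f₃₁) (h₃₂ : P.IsIrreducibleOn D f₃₂)
    (h₃₃ : P.IsIrreducibleOn D f₃₃) : False := by
  have hL : IsCoverList D mu ![s₁, s₂, s₃, t₁, t₂, t₃]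
      [(0, 3, arr f₁₁), (1, 3, arr f₂₁), (2, 3, arr f₃₁), (2, 4, arr f₃₂), (2, 5, arr f₃₃)] := by
    apply isCoverList_of_irreducible h.left_mem h.right_mem h.nirr h.nid
    · simp [Fin.forall_fin_succ, *]
    · simp
    · simp
    · simp [*]
    · simp [*]
    · simp
  refine hL.not_repFin_of_leaves h.fin ![some 0, some 1, none, none, some 2, some 3] (by simp) 2
    ?_ ?_ (0, 3, arr f₁₁) (by simp) (by simp) (by simp) ?_ h.rep
  · simp [Fin.forall_fin_succ]
    grind
  · simp [Fin.forall_fin_succ]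
  · simp [hs₁₂.symm, hs₁₃.symm]

/-- a top with three arrows and a socle with three arrows, joined through an intermediate arrow -/
theorem no_joined_stars (h : RepFinOn D mu) {s t r u t₁ t₂ s₁ s₂ : P.Obj}
    (hs : s ∈ D) (ht : t ∈ D) (hr : r ∈ D) (hu : u ∈ D) (ht₁ : t₁ ∈ D) (ht₂ : t₂ ∈ D)
    (hs₁ : s₁ ∈ D) (hs₂ : s₂ ∈ D) (hs₁₂ : s₁ ≠ s₂) (hrs₁ : r ≠ s₁) (hrs₂ : r ≠ s₂)
    (ht₁₂ : t₁ ≠ t₂) (hut₁ : u ≠ t₁) (hut₂ : u ≠ t₂) (hsr : s ≠ r) (htu : t ≠ u) (htt₁ : t ≠ t₁)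
    {f₁ : P.Hom s t₁} {f₂ : P.Hom s t₂} {f₃ : P.Hom s u} {g : P.Hom r u} {k₁ : P.Hom s₁ t}
    {k₂ : P.Hom s₂ t} {k₃ : P.Hom r t}
    (hf₁ : P.IsIrreducibleOn D f₁) (hf₂ : P.IsIrreducibleOn D f₂)
    (hf₃ : P.IsIrreducibleOn D f₃) (hg : P.IsIrreducibleOn D g)
    (hk₁ : P.IsIrreducibleOn D k₁) (hk₂ : P.IsIrreducibleOn D k₂)
    (hk₃ : P.IsIrreducibleOn D k₃) : False := by
  have hL : IsCoverList D mu ![s, r, u, t, t₁, t₂, s₁, s₂]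
      [(0, 4, arr f₁), (0, 5, arr f₂), (0, 2, arr f₃), (1, 2, arr g), (6, 3, arr k₁),
        (7, 3, arr k₂), (1, 3, arr k₃)] := by
    apply isCoverList_of_irreducible h.left_mem h.right_mem h.nirr h.nid
    · simp [Fin.forall_fin_succ, *]
    · simp
    · simp
    · simp [*]
    · simp [*, hut₁.symm, hut₂.symm, htu.symm, hrs₁.symm, hrs₂.symm]
    · simp
  refine hL.not_repFin_of_leaves h.fin
    ![none, none, none, none, some 0, some 1, some 2, some 3] (by simp) 0
    ?_ ?_ (0, 4, arr f₁) (by simp) (by simp) (by simp) ?_ h.rep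
  · simp [Fin.forall_fin_succ]
    grind
  · simp [Fin.forall_fin_succ]
  · simp [hsr.symm]
    grind

end RepFinOn

end RayCategory

namespace RayCategory

local infixr:80 "⊚" => RayCategory.comp _

variable {P : RayCategory} {D : Set P.Obj} {x y : P.Obj} {mu : P.Hom x y}

/-- the nontrivial factorizations of `f` in `D` are listed in `S` -/
def OnlyFactors (D : Set P.Obj) {s t : P.Obj} (f : P.Hom s t) (S : List (P.Arr × P.Arr)) : Prop :=
  ∀ z ∈ D, ∀ (g : P.Hom z t) (h : P.Hom s z), f = g ⊚ h →
    P.IsId g ∨ P.IsId h ∨ (arr g, arr h) ∈ S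

theorem IsIrreducibleOn.ne_comp {s t s' z t' : P.Obj} {f : P.Hom s t}
    (hf : P.IsIrreducibleOn D f) {g : P.Hom z t'} {k : P.Hom s' z} (hz : z ∈ D)
    (hg : ¬ P.IsId g) (hk : ¬ P.IsId k) : arr (g ⊚ k) ≠ arr f := by
  intro h
  cases h
  exact (hf.2.2 z hz g k rfl).elim hg hk

theorem arr_ne_of_left {s t s' t' : P.Obj} (h : s ≠ s') (f : P.Hom s t) (f' : P.Hom s' t') :
    arr f ≠ arr f' := fun e => h (congrArg Sigma.fst e)

theorem arr_ne_of_right {s t s' t' : P.Obj} (h : t ≠ t') (f : P.Hom s t) (f' : P.Hom s' t') :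
    arr f ≠ arr f' := fun e => h (congrArg (fun a => a.2.1) e)

/-- lists formed by irreducible morphisms `A` and composed morphisms `B` -/
theorem isCoverList_append_of_ne {N : ℕ} {obj : Fin N → P.Obj}
    {A B : List (Fin N × Fin N × P.Arr)} (hx : x ∈ D) (hy : y ∈ D)
    (hmu : ¬ P.IsIrreducibleOn D mu) (hmu' : ¬ P.IsId mu)
    (mem : ∀ p, obj p ∈ D) (src : ∀ l ∈ A ++ B, l.2.2.1 = obj l.1)
    (tgt : ∀ l ∈ A ++ B, l.2.2.2.1 = obj l.2.1)
    (irr : ∀ l ∈ A, P.IsIrreducibleOn D l.2.2.2.2)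
    (nz : ∀ l ∈ B, l.2.2.2.2 ≠ P.zero _ _) (ne_mu : ∀ l ∈ B, l.2.2 ≠ arr mu)
    (red : ∀ l ∈ B, ∃ z ∈ D, ∃ (s t : P.Obj) (g : P.Hom z t) (h : P.Hom s z), l.2.2 = arr (g ⊚ h) ∧
      ¬ P.IsId g ∧ ¬ P.IsId h)
    (distA : A.Pairwise fun l l' => (l.1 = l'.1 → l.2.2.2.1 ≠ l'.2.2.2.1) ∧
      (l.2.1 = l'.2.1 → l.2.2.1 ≠ l'.2.2.1))
    (distB : B.Pairwise fun l l' => l.1 = l'.1 ∨ l.2.1 = l'.2.1 → l.2.2 ≠ l'.2.2)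
    (lift : ∀ l ∈ B, ∃ S, OnlyFactors D l.2.2.2.2 S ∧
      ∀ pr ∈ S, ∃ r, (l.1, r, pr.2) ∈ A ++ B ∧ (r, l.2.1, pr.1) ∈ A ++ B)
    (comp : ∀ l ∈ A ++ B, ∀ l' ∈ A ++ B, l.2.1 = l'.1 →
      ∃ (s t u : P.Obj) (f : P.Hom s t) (g : P.Hom t u),
        l.2.2 = arr f ∧ l'.2.2 = arr g ∧ (l.1, l'.2.1, arr (g ⊚ f)) ∈ A ++ B) :
    IsCoverList D mu obj (A ++ B) where
  mem := mem
  left_mem := hx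
  right_mem := hy
  nid_mu := hmu'
  src := src
  tgt := tgt
  nid l hl := by
    rcases List.mem_append.1 hl with hl | hl
    · exact (irr l hl).2.1
    · obtain ⟨z, hz, s, t, g, h, e, hg, hh⟩ := red l hl
      rw [e]
      exact fun hgh => hg (isId_of_comp_isId hgh).1
  nz l hl := (List.mem_append.1 hl).elim (fun hl => (irr l hl).1) (nz l)
  ne_mu l hl := by
    rcases List.mem_append.1 hl with hl | hl
    · intro h
      have := irr l hl
      rw [h] at this
      exact hmu this
    · exact ne_mu l hl
  dist := by
    have key : ∀ l l' : Fin N × Fin N × P.Arr, ((l.1 = l'.1 → l.2.2.2.1 ≠ l'.2.2.2.1) ∧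
        (l.2.1 = l'.2.1 → l.2.2.1 ≠ l'.2.2.1)) → (l.1 = l'.1 ∨ l.2.1 = l'.2.1 → l.2.2 ≠ l'.2.2) := by
      rintro l l' ⟨h1, h2⟩ (h | h) h'
      · exact h1 h (by rw [h'])
      · exact h2 h (by rw [h'])
    refine List.pairwise_append.2 ⟨distA.imp (key _ _), distB, ?_⟩
    rintro l hl l' hl' - h
    obtain ⟨z, hz, s, t, g, k, e, hg, hh⟩ := red l' hl'
    have := irr l hl
    rw [h, e] at this
    exact (this.2.2 z hz g k rfl).elim hg hh
  comp := comp
  lift l hl z hz g h e := by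
    rcases List.mem_append.1 hl with hl | hl
    · exact ((irr l hl).2.2 z hz g h e).imp_right Or.inl
    · obtain ⟨S, hS, hS'⟩ := lift l hl
      exact (hS z hz g h e).imp_right (Or.imp_right fun h' => hS' _ h')

theorem isCoverList_append {N : ℕ} {obj : Fin N → P.Obj}
    {A B : List (Fin N × Fin N × P.Arr)} (hx : x ∈ D) (hy : y ∈ D)
    (hmu : ¬ P.IsIrreducibleOn D mu) (hmu' : ¬ P.IsId mu)
    (mem : ∀ p, obj p ∈ D) (src : ∀ l ∈ A ++ B, l.2.2.1 = obj l.1)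
    (tgt : ∀ l ∈ A ++ B, l.2.2.2.1 = obj l.2.1)
    (irr : ∀ l ∈ A, P.IsIrreducibleOn D l.2.2.2.2)
    (nz : ∀ l ∈ B, l.2.2.2.2 ≠ P.zero _ _) (ne_mu : ∀ l ∈ B, l.2.2 ≠ arr mu)
    (red : ∀ l ∈ B, ∃ z ∈ D, ∃ (s t : P.Obj) (g : P.Hom z t) (h : P.Hom s z), l.2.2 = arr (g ⊚ h) ∧
      ¬ P.IsId g ∧ ¬ P.IsId h)
    (distA : A.Pairwise fun l l' => (l.1 = l'.1 → l.2.2.2.1 ≠ l'.2.2.2.1) ∧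
      (l.2.1 = l'.2.1 → l.2.2.1 ≠ l'.2.2.1))
    (distB : B.Pairwise fun l l' => (l.1 = l'.1 → l.2.2.2.1 ≠ l'.2.2.2.1) ∧
      (l.2.1 = l'.2.1 → l.2.2.1 ≠ l'.2.2.1))
    (lift : ∀ l ∈ B, ∃ S, OnlyFactors D l.2.2.2.2 S ∧
      ∀ pr ∈ S, ∃ r, (l.1, r, pr.2) ∈ A ++ B ∧ (r, l.2.1, pr.1) ∈ A ++ B)
    (comp : ∀ l ∈ A ++ B, ∀ l' ∈ A ++ B, l.2.1 = l'.1 →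
      ∃ (s t u : P.Obj) (f : P.Hom s t) (g : P.Hom t u),
        l.2.2 = arr f ∧ l'.2.2 = arr g ∧ (l.1, l'.2.1, arr (g ⊚ f)) ∈ A ++ B) :
    IsCoverList D mu obj (A ++ B) := by
  refine isCoverList_append_of_ne hx hy hmu hmu' mem src tgt irr nz ne_mu red distA
    (distB.imp ?_) lift comp
  rintro l l' ⟨h1, h2⟩ (h | h) h'
  · exact h1 h (by rw [h'])
  · exact h2 h (by rw [h'])

theorem exists_mid {N : ℕ} {L : List (Fin N × Fin N × P.Arr)} {p q : Fin N} {F G : P.Arr} (r : Fin N)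
    (hF : (p, r, F) ∈ L) (hG : (r, q, G) ∈ L) :
    ∀ pr ∈ [(G, F)], ∃ r, (p, r, pr.2) ∈ L ∧ (r, q, pr.1) ∈ L := by
  intro pr h
  rw [List.mem_singleton.1 h]
  exact ⟨r, hF, hG⟩

namespace RepFinOn

theorem no_star_two_two (h : RepFinOn D mu) {s₁ s₂ c t₁ t₂ : P.Obj}
    (hs₁ : s₁ ∈ D) (hs₂ : s₂ ∈ D) (hc : c ∈ D) (ht₁ : t₁ ∈ D) (ht₂ : t₂ ∈ D)
    (hs : s₁ ≠ s₂) (ht : t₁ ≠ t₂) (hsc : s₁ ≠ c)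
    {f₁ : P.Hom s₁ c} {f₂ : P.Hom s₂ c} {g₁ : P.Hom c t₁} {g₂ : P.Hom c t₂}
    (hf₁ : P.IsIrreducibleOn D f₁) (hf₂ : P.IsIrreducibleOn D f₂)
    (hg₁ : P.IsIrreducibleOn D g₁) (hg₂ : P.IsIrreducibleOn D g₂)
    (h₁₁ : g₁ ⊚ f₁ ≠ P.zero _ _) (h₁₂ : g₁ ⊚ f₂ ≠ P.zero _ _)
    (h₂₁ : g₂ ⊚ f₁ ≠ P.zero _ _) (h₂₂ : g₂ ⊚ f₂ ≠ P.zero _ _)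
    (n₁₁ : arr (g₁ ⊚ f₁) ≠ arr mu) (n₁₂ : arr (g₁ ⊚ f₂) ≠ arr mu)
    (n₂₁ : arr (g₂ ⊚ f₁) ≠ arr mu) (n₂₂ : arr (g₂ ⊚ f₂) ≠ arr mu)
    (o₁₁ : OnlyFactors D (g₁ ⊚ f₁) [(arr g₁, arr f₁)])
    (o₁₂ : OnlyFactors D (g₁ ⊚ f₂) [(arr g₁, arr f₂)])
    (o₂₁ : OnlyFactors D (g₂ ⊚ f₁) [(arr g₂, arr f₁)])
    (o₂₂ : OnlyFactors D (g₂ ⊚ f₂) [(arr g₂, arr f₂)]) : False := by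
  have hL : IsCoverList D mu ![s₁, s₂, c, t₁, t₂]
      ([(0, 2, arr f₁), (1, 2, arr f₂), (2, 3, arr g₁), (2, 4, arr g₂)] ++
        [(0, 3, arr (g₁ ⊚ f₁)), (1, 3, arr (g₁ ⊚ f₂)), (0, 4, arr (g₂ ⊚ f₁)),
          (1, 4, arr (g₂ ⊚ f₂))]) := by
    apply isCoverList_append h.left_mem h.right_mem h.nirr h.nid
    · simp [Fin.forall_fin_succ, *]
    · simp
    · simp
    · simp [*]
    · simp [*]
    · simp only [List.forall_mem_cons]
      exact ⟨n₁₁, n₁₂, n₂₁, n₂₂, List.forall_mem_nil _⟩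
    · simp only [List.forall_mem_cons]
      exact ⟨⟨_, hc, _, _, _, _, rfl, hg₁.2.1, hf₁.2.1⟩, ⟨_, hc, _, _, _, _, rfl, hg₁.2.1, hf₂.2.1⟩,
        ⟨_, hc, _, _, _, _, rfl, hg₂.2.1, hf₁.2.1⟩, ⟨_, hc, _, _, _, _, rfl, hg₂.2.1, hf₂.2.1⟩,
        List.forall_mem_nil _⟩
    · simp [*]
    · simp [*]
    · simp only [List.forall_mem_cons]
      exact ⟨⟨_, o₁₁, exists_mid 2 (by simp) (by simp)⟩, ⟨_, o₁₂, exists_mid 2 (by simp) (by simp)⟩,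
        ⟨_, o₂₁, exists_mid 2 (by simp) (by simp)⟩, ⟨_, o₂₂, exists_mid 2 (by simp) (by simp)⟩,
        List.forall_mem_nil _⟩
    · simp only [List.forall_mem_cons, List.cons_append, List.nil_append]
      and_intros
      all_goals first
        | exact fun h => absurd h (by decide)
        | exact List.forall_mem_nil _
        | exact fun _ => ⟨_, _, _, _, _, rfl, rfl, by simp⟩
  refine hL.not_repFin_of_leaves h.fin ![some 0, some 1, none, some 2, some 3] ?_ 2
    ?_ ?_ (0, 2, arr f₁) ?_ ?_ ?_ ?_ h.rep
  · simp
  · simp [Fin.forall_fin_succ]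
  · simp [Fin.forall_fin_succ]
  · simp
  · simp
  · simp
  · simp only [List.forall_mem_cons, List.cons_append, List.nil_append]
    exact ⟨fun _ => trivial, fun e => absurd e (arr_ne_of_left hs.symm _ _),
      fun e => absurd e (arr_ne_of_left hsc.symm _ _), fun e => absurd e (arr_ne_of_left hsc.symm _ _),
      fun e => absurd e (hf₁.ne_comp hc hg₁.2.1 hf₁.2.1),
      fun e => absurd e (hf₁.ne_comp hc hg₁.2.1 hf₂.2.1),
      fun e => absurd e (hf₁.ne_comp hc hg₂.2.1 hf₁.2.1),
      fun e => absurd e (hf₁.ne_comp hc hg₂.2.1 hf₂.2.1), List.forall_mem_nil _⟩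

theorem no_star_one_three (h : RepFinOn D mu) {s c t₁ t₂ t₃ : P.Obj}
    (hs : s ∈ D) (hc : c ∈ D) (ht₁ : t₁ ∈ D) (ht₂ : t₂ ∈ D) (ht₃ : t₃ ∈ D)
    (ht₁₂ : t₁ ≠ t₂) (ht₁₃ : t₁ ≠ t₃) (ht₂₃ : t₂ ≠ t₃) (hsc : s ≠ c)
    {f : P.Hom s c} {g₁ : P.Hom c t₁} {g₂ : P.Hom c t₂} {g₃ : P.Hom c t₃}
    (hf : P.IsIrreducibleOn D f) (hg₁ : P.IsIrreducibleOn D g₁)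
    (hg₂ : P.IsIrreducibleOn D g₂) (hg₃ : P.IsIrreducibleOn D g₃)
    (h₁ : g₁ ⊚ f ≠ P.zero _ _) (h₂ : g₂ ⊚ f ≠ P.zero _ _) (h₃ : g₃ ⊚ f ≠ P.zero _ _)
    (n₁ : arr (g₁ ⊚ f) ≠ arr mu) (n₂ : arr (g₂ ⊚ f) ≠ arr mu) (n₃ : arr (g₃ ⊚ f) ≠ arr mu)
    (o₁ : OnlyFactors D (g₁ ⊚ f) [(arr g₁, arr f)])
    (o₂ : OnlyFactors D (g₂ ⊚ f) [(arr g₂, arr f)])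
    (o₃ : OnlyFactors D (g₃ ⊚ f) [(arr g₃, arr f)]) : False := by
  have hL : IsCoverList D mu ![s, c, t₁, t₂, t₃]
      ([(0, 1, arr f), (1, 2, arr g₁), (1, 3, arr g₂), (1, 4, arr g₃)] ++
        [(0, 2, arr (g₁ ⊚ f)), (0, 3, arr (g₂ ⊚ f)), (0, 4, arr (g₃ ⊚ f))]) := by
    apply isCoverList_append h.left_mem h.right_mem h.nirr h.nid
    · simp [Fin.forall_fin_succ, *]
    · simp
    · simp
    · simp [*]
    · simp [*]
    · simp only [List.forall_mem_cons]
      exact ⟨n₁, n₂, n₃, List.forall_mem_nil _⟩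
    · simp only [List.forall_mem_cons]
      exact ⟨⟨_, hc, _, _, _, _, rfl, hg₁.2.1, hf.2.1⟩,
        ⟨_, hc, _, _, _, _, rfl, hg₂.2.1, hf.2.1⟩,
        ⟨_, hc, _, _, _, _, rfl, hg₃.2.1, hf.2.1⟩,
        List.forall_mem_nil _⟩
    · simp [*]
    · simp [*]
    · simp only [List.forall_mem_cons]
      exact ⟨⟨_, o₁, exists_mid 1 (by simp) (by simp)⟩,
        ⟨_, o₂, exists_mid 1 (by simp) (by simp)⟩,
        ⟨_, o₃, exists_mid 1 (by simp) (by simp)⟩,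
        List.forall_mem_nil _⟩
    · simp only [List.forall_mem_cons, List.cons_append, List.nil_append]
      and_intros
      all_goals first
        | exact fun h => absurd h (by decide)
        | exact List.forall_mem_nil _
        | exact fun _ => ⟨_, _, _, _, _, rfl, rfl, by simp⟩
  refine hL.not_repFin_of_leaves h.fin ![some 0, none, some 1, some 2, some 3] ?_ 1
    ?_ ?_ (0, 1, arr f) ?_ ?_ ?_ ?_ h.rep
  · simp
  · simp [Fin.forall_fin_succ]
  · simp [Fin.forall_fin_succ]
  · simp
  · simp
  · simp
  · simp only [List.forall_mem_cons, List.cons_append, List.nil_append]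
    exact ⟨fun _ => trivial,
      fun e => absurd e (arr_ne_of_left hsc.symm _ _),
      fun e => absurd e (arr_ne_of_left hsc.symm _ _),
      fun e => absurd e (arr_ne_of_left hsc.symm _ _),
      fun e => absurd e (hf.ne_comp hc hg₁.2.1 hf.2.1),
      fun e => absurd e (hf.ne_comp hc hg₂.2.1 hf.2.1),
      fun e => absurd e (hf.ne_comp hc hg₃.2.1 hf.2.1),
      List.forall_mem_nil _⟩

theorem no_star_three_one (h : RepFinOn D mu) {s₁ s₂ s₃ c t : P.Obj}
    (hs₁ : s₁ ∈ D) (hs₂ : s₂ ∈ D) (hs₃ : s₃ ∈ D) (hc : c ∈ D) (ht : t ∈ D)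
    (hs₁₂ : s₁ ≠ s₂) (hs₁₃ : s₁ ≠ s₃) (hs₂₃ : s₂ ≠ s₃) (hsc : s₁ ≠ c)
    {f₁ : P.Hom s₁ c} {f₂ : P.Hom s₂ c} {f₃ : P.Hom s₃ c} {g : P.Hom c t}
    (hf₁ : P.IsIrreducibleOn D f₁) (hf₂ : P.IsIrreducibleOn D f₂)
    (hf₃ : P.IsIrreducibleOn D f₃) (hg : P.IsIrreducibleOn D g)
    (h₁ : g ⊚ f₁ ≠ P.zero _ _) (h₂ : g ⊚ f₂ ≠ P.zero _ _) (h₃ : g ⊚ f₃ ≠ P.zero _ _)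
    (n₁ : arr (g ⊚ f₁) ≠ arr mu) (n₂ : arr (g ⊚ f₂) ≠ arr mu) (n₃ : arr (g ⊚ f₃) ≠ arr mu)
    (o₁ : OnlyFactors D (g ⊚ f₁) [(arr g, arr f₁)])
    (o₂ : OnlyFactors D (g ⊚ f₂) [(arr g, arr f₂)])
    (o₃ : OnlyFactors D (g ⊚ f₃) [(arr g, arr f₃)]) : False := by
  have hL : IsCoverList D mu ![s₁, s₂, s₃, c, t]
      ([(0, 3, arr f₁), (1, 3, arr f₂), (2, 3, arr f₃), (3, 4, arr g)] ++
        [(0, 4, arr (g ⊚ f₁)), (1, 4, arr (g ⊚ f₂)), (2, 4, arr (g ⊚ f₃))]) := by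
    apply isCoverList_append h.left_mem h.right_mem h.nirr h.nid
    · simp [Fin.forall_fin_succ, *]
    · simp
    · simp
    · simp [*]
    · simp [*]
    · simp only [List.forall_mem_cons]
      exact ⟨n₁, n₂, n₃, List.forall_mem_nil _⟩
    · simp only [List.forall_mem_cons]
      exact ⟨⟨_, hc, _, _, _, _, rfl, hg.2.1, hf₁.2.1⟩,
        ⟨_, hc, _, _, _, _, rfl, hg.2.1, hf₂.2.1⟩,
        ⟨_, hc, _, _, _, _, rfl, hg.2.1, hf₃.2.1⟩,
        List.forall_mem_nil _⟩
    · simp [*]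
    · simp [*]
    · simp only [List.forall_mem_cons]
      exact ⟨⟨_, o₁, exists_mid 3 (by simp) (by simp)⟩,
        ⟨_, o₂, exists_mid 3 (by simp) (by simp)⟩,
        ⟨_, o₃, exists_mid 3 (by simp) (by simp)⟩,
        List.forall_mem_nil _⟩
    · simp only [List.forall_mem_cons, List.cons_append, List.nil_append]
      and_intros
      all_goals first
        | exact fun h => absurd h (by decide)
        | exact List.forall_mem_nil _
        | exact fun _ => ⟨_, _, _, _, _, rfl, rfl, by simp⟩
  refine hL.not_repFin_of_leaves h.fin ![some 0, some 1, some 2, none, some 3] ?_ 3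
    ?_ ?_ (0, 3, arr f₁) ?_ ?_ ?_ ?_ h.rep
  · simp
  · simp [Fin.forall_fin_succ]
  · simp [Fin.forall_fin_succ]
  · simp
  · simp
  · simp
  · simp only [List.forall_mem_cons, List.cons_append, List.nil_append]
    exact ⟨fun _ => trivial,
      fun e => absurd e (arr_ne_of_left hs₁₂.symm _ _),
      fun e => absurd e (arr_ne_of_left hs₁₃.symm _ _),
      fun e => absurd e (arr_ne_of_left hsc.symm _ _),
      fun e => absurd e (hf₁.ne_comp hc hg.2.1 hf₁.2.1),
      fun e => absurd e (hf₁.ne_comp hc hg.2.1 hf₂.2.1),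
      fun e => absurd e (hf₁.ne_comp hc hg.2.1 hf₃.2.1),
      List.forall_mem_nil _⟩

/-- two copies of the target `c`, joined by an endomorphism -/
theorem no_double_star (h : RepFinOn D mu) {a b c : P.Obj}
    (ha : a ∈ D) (hb : b ∈ D) (hc : c ∈ D) (hab : a ≠ b) (hac : a ≠ c) (hbc : b ≠ c)
    {f : P.Hom a c} {g : P.Hom b c} {r : P.Hom c c}
    (hf : P.IsIrreducibleOn D f) (hg : P.IsIrreducibleOn D g) (hr : P.IsIrreducibleOn D r)
    (h₁ : r ⊚ f ≠ P.zero _ _) (h₂ : r ⊚ g ≠ P.zero _ _)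
    (n₁ : arr (r ⊚ f) ≠ arr mu) (n₂ : arr (r ⊚ g) ≠ arr mu)
    (o₁ : OnlyFactors D (r ⊚ f) [(arr r, arr f)])
    (o₂ : OnlyFactors D (r ⊚ g) [(arr r, arr g)]) : False := by
  have hL : IsCoverList D mu ![a, b, c, c, a, b]
      ([(0, 2, arr f), (1, 2, arr g), (2, 3, arr r), (4, 3, arr f), (5, 3, arr g)] ++
        [(0, 3, arr (r ⊚ f)), (1, 3, arr (r ⊚ g))]) := by
    apply isCoverList_append h.left_mem h.right_mem h.nirr h.nid
    · simp [Fin.forall_fin_succ, *]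
    · simp
    · simp
    · simp [*]
    · simp [*]
    · simp only [List.forall_mem_cons]
      exact ⟨n₁, n₂, List.forall_mem_nil _⟩
    · simp only [List.forall_mem_cons]
      exact ⟨⟨_, hc, _, _, _, _, rfl, hr.2.1, hf.2.1⟩,
        ⟨_, hc, _, _, _, _, rfl, hr.2.1, hg.2.1⟩,
        List.forall_mem_nil _⟩
    · simp [*, hac.symm, hbc.symm]
    · simp [*]
    · simp only [List.forall_mem_cons]
      exact ⟨⟨_, o₁, exists_mid 2 (by simp) (by simp)⟩,
        ⟨_, o₂, exists_mid 2 (by simp) (by simp)⟩,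
        List.forall_mem_nil _⟩
    · simp only [List.forall_mem_cons, List.cons_append, List.nil_append]
      and_intros
      all_goals first
        | exact fun h => absurd h (by decide)
        | exact List.forall_mem_nil _
        | exact fun _ => ⟨_, _, _, _, _, rfl, rfl, by simp⟩
  refine hL.not_repFin_of_leaves h.fin ![some 0, some 1, none, none, some 2, some 3] ?_ 2
    ?_ ?_ (2, 3, arr r) ?_ ?_ ?_ ?_ h.rep
  · simp
  · simp [Fin.forall_fin_succ]
    grind
  · simp [Fin.forall_fin_succ]
  · simp
  · simp
  · simp
  · simp only [List.forall_mem_cons, List.cons_append, List.nil_append]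
    exact ⟨fun e => absurd e (arr_ne_of_left hac _ _),
      fun e => absurd e (arr_ne_of_left hbc _ _),
      fun _ => trivial,
      fun e => absurd e (arr_ne_of_left hac _ _),
      fun e => absurd e (arr_ne_of_left hbc _ _),
      fun e => absurd e (hr.ne_comp hc hr.2.1 hf.2.1),
      fun e => absurd e (hr.ne_comp hc hr.2.1 hg.2.1),
      List.forall_mem_nil _⟩

/-- the morphisms `r : c → c`, `g : b → c`, `f : a → c`, `m : s → a` and `t : a → a` -/
theorem no_linked_stars (h : RepFinOn D mu) {s a b c : P.Obj}
    (hs : s ∈ D) (ha : a ∈ D) (hb : b ∈ D) (hc : c ∈ D) (hab : a ≠ b) (hac : a ≠ c) (hbc : b ≠ c)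
    {f : P.Hom a c} {g : P.Hom b c} {r : P.Hom c c} {m : P.Hom s a} {t : P.Hom a a}
    (hf : P.IsIrreducibleOn D f) (hg : P.IsIrreducibleOn D g) (hr : P.IsIrreducibleOn D r)
    (hm : P.IsIrreducibleOn D m) (ht : P.IsIrreducibleOn D t)
    (h₁ : f ⊚ m ≠ P.zero _ _) (h₂ : t ⊚ m ≠ P.zero _ _)
    (n₁ : arr (f ⊚ m) ≠ arr mu) (n₂ : arr (t ⊚ m) ≠ arr mu)
    (o₁ : OnlyFactors D (f ⊚ m) [(arr f, arr m)])
    (o₂ : OnlyFactors D (t ⊚ m) [(arr t, arr m)]) : False := by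
  have hL : IsCoverList D mu ![c, b, s, a, c, a]
      ([(0, 4, arr r), (1, 4, arr g), (3, 4, arr f), (2, 3, arr m), (3, 5, arr t)] ++
        [(2, 4, arr (f ⊚ m)), (2, 5, arr (t ⊚ m))]) := by
    apply isCoverList_append h.left_mem h.right_mem h.nirr h.nid
    · simp [Fin.forall_fin_succ, *]
    · simp
    · simp
    · simp [*]
    · simp [*]
    · simp only [List.forall_mem_cons]
      exact ⟨n₁, n₂, List.forall_mem_nil _⟩
    · simp only [List.forall_mem_cons]
      exact ⟨⟨_, ha, _, _, _, _, rfl, hf.2.1, hm.2.1⟩,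
        ⟨_, ha, _, _, _, _, rfl, ht.2.1, hm.2.1⟩,
        List.forall_mem_nil _⟩
    · simp [*, hac.symm, hbc.symm, hab.symm]
    · simp [*, hac.symm]
    · simp only [List.forall_mem_cons]
      exact ⟨⟨_, o₁, exists_mid 3 (by simp) (by simp)⟩,
        ⟨_, o₂, exists_mid 3 (by simp) (by simp)⟩,
        List.forall_mem_nil _⟩
    · simp only [List.forall_mem_cons, List.cons_append, List.nil_append]
      and_intros
      all_goals first
        | exact fun h => absurd h (by decide)
        | exact List.forall_mem_nil _
        | exact fun _ => ⟨_, _, _, _, _, rfl, rfl, by simp⟩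
  refine hL.not_repFin_of_leaves h.fin ![some 0, some 1, some 2, none, none, some 3] ?_ 3
    ?_ ?_ (0, 4, arr r) ?_ ?_ ?_ ?_ h.rep
  · simp
  · simp [Fin.forall_fin_succ]
    grind
  · simp [Fin.forall_fin_succ]
  · simp
  · simp
  · simp
  · simp only [List.forall_mem_cons, List.cons_append, List.nil_append]
    exact ⟨fun _ => trivial,
      fun e => absurd e (arr_ne_of_left hbc _ _),
      fun e => absurd e (arr_ne_of_left hac _ _),
      fun e => absurd e (arr_ne_of_right hac _ _),
      fun e => absurd e (arr_ne_of_left hac _ _),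
      fun e => absurd e (hr.ne_comp ha hf.2.1 hm.2.1),
      fun e => absurd e (hr.ne_comp ha ht.2.1 hm.2.1),
      List.forall_mem_nil _⟩

end RepFinOn

end RayCategory

namespace RayCategory

local infixr:80 "⊚" => RayCategory.comp _

variable {P : RayCategory} {D : Set P.Obj} {x y : P.Obj} {mu : P.Hom x y}

theorem IsCoverList.isRep {N n : ℕ} {obj : Fin N → P.Obj} {L : List (Fin N × Fin N × P.Arr)}
    {A : Fin N → Fin N → Matrix (Fin n) (Fin n) ℚ} (one : ∀ p, A p p = 1)
    (mul : ∀ l ∈ L, ∀ l' ∈ L, l.2.1 = l'.1 → A l.1 l'.2.1 = A l'.1 l'.2.1 * A l.1 l.2.1) :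
    IsCover.IsRep (listRel obj L) A where
  one := one
  mul := by
    rintro p q r s t u f g (⟨rfl, -⟩ | h) (⟨rfl, -⟩ | hl)
    · rw [one, mul_one]
    · rw [one, mul_one]
    · rw [one, one_mul]
    · exact mul _ h _ hl rfl

/-- a one-parameter family of flags with three-dimensional ambient space -/
def flagMat (c : ℚ) : Fin 8 → Fin 8 → Matrix (Fin 3) (Fin 3) ℚ
  | 0, 1 => !![1, 0, 0; 1, 0, 0; 0, 0, 0]
  | 0, 5 => !![1, 0, 0; 1, 0, 0; 0, 0, 0]
  | 1, 5 => !![1, 0, 0; 0, 1, 0; 0, 0, 0]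
  | 2, 3 => !![1, 0, 0; 1, 0, 0; 0, 0, 0]
  | 3, 5 => !![0, 0, 0; 1, 0, 0; 0, 1, 0]
  | 2, 4 => !![0, 0, 0; 1, 0, 0; 1, 0, 0]
  | 2, 5 => !![0, 0, 0; 1, 0, 0; 1, 0, 0]
  | 4, 6 => !![0, 1, 0; 1, 0, -c; 0, 0, 0]
  | 2, 6 => !![1, 0, 0; -c, 0, 0; 0, 0, 0]
  | 7, 6 => !![0, 0, 0; 1, 0, 0; 0, 0, 0]
  | _, _ => 1

theorem flagMat_orthogonal {c d : ℚ} (hcd : c ≠ d) {X : Fin 8 → Matrix (Fin 3) (Fin 3) ℚ}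
    (h15 : flagMat d 1 5 * X 1 = X 5 * flagMat c 1 5)
    (h05 : flagMat d 0 5 * X 0 = X 5 * flagMat c 0 5)
    (h35 : flagMat d 3 5 * X 3 = X 5 * flagMat c 3 5)
    (h25 : flagMat d 2 5 * X 2 = X 5 * flagMat c 2 5)
    (h45 : flagMat d 4 5 * X 4 = X 5 * flagMat c 4 5)
    (h46 : flagMat d 4 6 * X 4 = X 6 * flagMat c 4 6)
    (h76 : flagMat d 7 6 * X 7 = X 6 * flagMat c 7 6) : X 5 = 0 := by
  have e45 : X 4 = X 5 := by simpa [flagMat] using h45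
  rw [e45] at h46
  have k : ∀ {M N : Matrix (Fin 3) (Fin 3) ℚ}, M = N → ∀ i j, M i j = N i j := fun h i j => by rw [h]
  have a1 := k h15 2 0
  have a2 := k h15 2 1
  have b1 := k h05 0 0
  have b2 := k h05 1 0
  have c1 := k h35 0 0
  have c2 := k h35 0 1
  have d1 := k h25 1 0
  have d2 := k h25 2 0
  have f1 := k h76 0 0
  have e00 := k h46 0 0
  have e01 := k h46 0 1
  have e02 := k h46 0 2
  have e10 := k h46 1 0
  have e12 := k h46 1 2
  simp [flagMat, Matrix.mul_apply, Fin.sum_univ_three] at a1 a2 b1 b2 c1 c2 d1 d2 f1 e00 e01 e02 e10 e12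
  have g0 : X 5 1 0 = 0 := by linarith
  have g1 : X 5 1 2 = 0 := by rw [e02, ← f1]; simp
  have g2 : X 5 1 1 = X 5 0 0 := by linarith
  have g3 : X 5 2 2 = X 5 0 0 := by linarith
  have g4 : X 5 0 0 = 0 := by
    have : X 5 0 0 * (c - d) = 0 := by
      rw [← e10] at e12
      linear_combination e12 + d * g3 + c2 - c * d * a1
    exact (mul_eq_zero.1 this).resolve_right (sub_ne_zero.2 hcd)
  have := a1.symm
  have := a2.symm
  have := c1.symm
  have := c2.symm
  have := g2.trans g4
  have := g3.trans g4
  ext i j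
  fin_cases i <;> fin_cases j <;> simpa

theorem isId_of_arr_eq {s t z : P.Obj} {f : P.Hom s t} (h : arr f = arr (P.id z)) : P.IsId f := by
  obtain ⟨rfl, h⟩ := Sigma.mk.inj_iff.1 h
  obtain ⟨rfl, h⟩ := Sigma.mk.inj_iff.1 (eq_of_heq h)
  exact ⟨rfl, h⟩

namespace RepFinOn

/-- the configuration of a commutative square `f m = g n` ending in `c` together with
endomorphisms `t` of `a` and `r` of `c` -/
theorem no_linked_square (h : RepFinOn D mu) {s a b c : P.Obj}
    (hs : s ∈ D) (ha : a ∈ D) (hb : b ∈ D) (hc : c ∈ D) (hab : a ≠ b) (hac : a ≠ c) (hbc : b ≠ c)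
    (hsa : s ≠ a) (hsb : s ≠ b) (hsc : s ≠ c)
    {f : P.Hom a c} {g : P.Hom b c} {r : P.Hom c c} {m : P.Hom s a} {n : P.Hom s b} {t : P.Hom a a}
    (hf : P.IsIrreducibleOn D f) (hg : P.IsIrreducibleOn D g) (hr : P.IsIrreducibleOn D r)
    (hm : P.IsIrreducibleOn D m) (hn : P.IsIrreducibleOn D n) (ht : P.IsIrreducibleOn D t)
    (e : g ⊚ n = f ⊚ m)
    (h₁ : r ⊚ g ≠ P.zero _ _) (h₂ : f ⊚ m ≠ P.zero _ _) (h₃ : t ⊚ m ≠ P.zero _ _)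
    (n₁ : arr (r ⊚ g) ≠ arr mu) (n₂ : arr (f ⊚ m) ≠ arr mu) (n₃ : arr (t ⊚ m) ≠ arr mu)
    (o₁ : OnlyFactors D (r ⊚ g) [(arr r, arr g)])
    (o₂ : OnlyFactors D (f ⊚ m) [(arr f, arr m), (arr g, arr n)])
    (o₃ : OnlyFactors D (t ⊚ m) [(arr t, arr m)]) : False := by
  have hL : IsCoverList D mu ![b, c, s, b, a, c, a, s]
      ([(1, 5, arr r), (0, 1, arr g), (2, 4, arr m), (2, 3, arr n), (4, 5, arr f), (4, 6, arr t),
        (3, 5, arr g), (7, 6, arr m)] ++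
        [(0, 5, arr (r ⊚ g)), (2, 5, arr (f ⊚ m)), (2, 6, arr (t ⊚ m))]) := by
    apply isCoverList_append h.left_mem h.right_mem h.nirr h.nid
    · simp [Fin.forall_fin_succ, *]
    · simp
    · simp
    · simp [hf, hg, hr, hm, hn, ht]
    · simp [h₁, h₂, h₃]
    · simp only [List.forall_mem_cons]
      exact ⟨n₁, n₂, n₃, List.forall_mem_nil _⟩
    · simp only [List.forall_mem_cons]
      exact ⟨⟨_, hc, _, _, _, _, rfl, hr.2.1, hg.2.1⟩,
        ⟨_, ha, _, _, _, _, rfl, hf.2.1, hm.2.1⟩,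
        ⟨_, ha, _, _, _, _, rfl, ht.2.1, hm.2.1⟩,
        List.forall_mem_nil _⟩
    · simp [*, hac.symm, hab.symm, hsa.symm, hbc.symm]
    · simp [hsb.symm, hac.symm]
    · simp only [List.forall_mem_cons]
      refine ⟨⟨_, o₁, exists_mid 1 (by simp) (by simp)⟩,
        ⟨_, o₂, ?_⟩,
        ⟨_, o₃, exists_mid 4 (by simp) (by simp)⟩,
        List.forall_mem_nil _⟩
      rintro pr hpr
      rcases List.mem_pair.1 hpr with rfl | rfl
      · exact ⟨4, by simp, by simp⟩
      · exact ⟨3, by simp, by simp⟩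
    · simp only [List.forall_mem_cons, List.cons_append, List.nil_append]
      and_intros
      all_goals first
        | exact fun h => absurd h (by decide)
        | exact List.forall_mem_nil _
        | exact fun _ => ⟨_, _, _, _, _, rfl, rfl, by first | (simp; done) | simp; exact e⟩
  refine hL.isCover.not_repFin h.fin flagMat (fun c => IsCoverList.isRep ?_ ?_)
    (p₀ := 1) (q₀ := 5) (F₀ := arr r) (Or.inr (by simp)) ?_ ?_ ?_ h.rep
  · intro p
    fin_cases p <;> rfl
  · simp only [List.forall_mem_cons, List.cons_append, List.nil_append]
    and_intros
    all_goals first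
      | exact fun h => absurd h (by decide)
      | exact List.forall_mem_nil _
      | (intro; simp [flagMat])
  · rintro p q (⟨rfl, h'⟩ | hl)
    · exact absurd (isId_of_arr_eq h') hr.2.1
    · have key : ∀ l ∈ ([(1, 5, arr r), (0, 1, arr g), (2, 4, arr m), (2, 3, arr n), (4, 5, arr f),
          (4, 6, arr t), (3, 5, arr g), (7, 6, arr m)] ++ [(0, 5, arr (r ⊚ g)),
          (2, 5, arr (f ⊚ m)), (2, 6, arr (t ⊚ m))] : List (Fin 8 × Fin 8 × P.Arr)),
          l.2.2 = arr r → l.1 = 1 := by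
        simp only [List.forall_mem_cons, List.cons_append, List.nil_append]
        refine ⟨fun _ => trivial, fun h => absurd h (arr_ne_of_left hbc _ _),
          fun h => absurd h (arr_ne_of_right hac _ _), fun h => absurd h (arr_ne_of_right hbc _ _),
          fun h => absurd h (arr_ne_of_left hac _ _), fun h => absurd h (arr_ne_of_left hac _ _),
          fun h => absurd h (arr_ne_of_left hbc _ _), fun h => absurd h (arr_ne_of_right hac _ _),
          fun h => absurd h (arr_ne_of_left hbc _ _), fun h => absurd h (arr_ne_of_left hsc _ _),
          fun h => absurd h (arr_ne_of_left hsc _ _), List.forall_mem_nil _⟩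
      exact key _ hl rfl
  · intro c h
    have := congrFun (congrFun h 0) 0
    simp [flagMat] at this
  · intro c d hcd X hX
    rw [flagMat_orthogonal hcd (hX 1 5 (arr r) (Or.inr (by simp))) (hX 0 5 (arr (r ⊚ g)) (Or.inr (by simp)))
      (hX 3 5 (arr g) (Or.inr (by simp))) (hX 2 5 (arr (f ⊚ m)) (Or.inr (by simp)))
      (hX 4 5 (arr f) (Or.inr (by simp))) (hX 4 6 (arr t) (Or.inr (by simp)))
      (hX 7 6 (arr m) (Or.inr (by simp))), zero_mul]

end RepFinOn

end RayCategory

namespace RayCategory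

local infixr:80 "⊚" => RayCategory.comp _

variable {P : RayCategory} {D : Set P.Obj}

instance finite_hom (x y : P.Obj) : Finite (P.Hom x y) := by
  obtain ⟨g, hg | hg⟩ := P.hom_cyclic x y
  · refine Finite.of_surjective (fun i : Fin (P.nilp y + 1) => P.pipow y i ⊚ g) fun f => ?_
    obtain ⟨i, rfl⟩ := hg f
    rcases Nat.lt_or_ge i (P.nilp y + 1) with h | h
    · exact ⟨⟨i, h⟩, rfl⟩
    · exact ⟨Fin.last _, by simp [P.pipow_nilp, pipow_eq_zero (Nat.le_of_succ_le h)]⟩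
  · refine Finite.of_surjective (fun i : Fin (P.nilp x + 1) => g ⊚ P.pipow x i) fun f => ?_
    obtain ⟨i, rfl⟩ := hg f
    rcases Nat.lt_or_ge i (P.nilp x + 1) with h | h
    · exact ⟨⟨i, h⟩, rfl⟩
    · exact ⟨Fin.last _, by simp [P.pipow_nilp, pipow_eq_zero (Nat.le_of_succ_le h)]⟩

/-- every nonzero morphism of `D` between different points ends, up to a loop, with an
irreducible morphism of `D` starting at a different point -/
theorem exists_last_irreducibleOn (hD : D.Finite) {s t : P.Obj} (hs : s ∈ D) (ht : t ∈ D)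
    (hst : s ≠ t) {h : P.Hom s t} (h0 : h ≠ P.zero s t) :
    ∃ z ∈ D, z ≠ t ∧ ∃ (g : P.Hom z t) (k : P.Hom s z) (l : ℕ),
      P.IsIrreducibleOn D g ∧ h = P.pipow t l ⊚ g ⊚ k := by
  have := hD.to_subtype
  let T : Type := Σ u : D, P.Hom u t
  let r : T → T → Prop := fun g f => f.2 ≠ P.zero _ _ ∧ ∃ (l : ℕ) (k : P.Hom f.1 g.1),
    f.2 = P.pipow t l ⊚ g.2 ⊚ k ∧ (l = 0 → ¬ P.IsId k)
  have : IsTrans T r := by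
    refine ⟨fun a b c hab hbc => ?_⟩
    obtain ⟨-, l, k, e, hn⟩ := hab
    obtain ⟨h0, l', k', e', hn'⟩ := hbc
    refine ⟨h0, l' + l, k ⊚ k', ?_, fun hl hk => ?_⟩
    · rw [e', e]
      simp only [P.assoc, pipow_comp]
    · exact hn (by omega) (isId_of_comp_isId hk).1
  have : Std.Irrefl r := by
    refine ⟨fun f ⟨h0, l, k, e, hn⟩ => ?_⟩
    obtain ⟨j, rfl⟩ := P.endo_cyclic _ k
    obtain ⟨rfl, rfl⟩ := eq_of_loop h0 e
    exact hn rfl (isId_pipow.2 rfl)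
  have wf : WellFounded r := Finite.wellFounded_of_trans_of_irrefl r
  let S : Set T := {g | (g.1 : P.Obj) ≠ t ∧ ∃ (l : ℕ) (k : P.Hom s g.1), h = P.pipow t l ⊚ g.2 ⊚ k}
  have hS : S.Nonempty := ⟨⟨⟨s, hs⟩, h⟩, hst, 0, P.id s, by
    rw [P.pipow_zero, P.id_comp, P.comp_id]⟩
  obtain ⟨⟨z, g⟩, ⟨hz, l, k, e⟩, hmin⟩ := wf.has_min S hS
  dsimp only at g k e hz
  have hg0 : g ≠ P.zero _ _ := ne_zero_left (ne_zero_right (e ▸ h0))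
  refine ⟨z, z.2, hz, g, k, l, ⟨hg0, not_isId hz g, ?_⟩, e⟩
  intro u hu g₁ h₁ e₁
  by_contra! hc
  by_cases hut : u = t
  · subst hut
    obtain ⟨i, rfl⟩ := P.endo_cyclic _ g₁
    refine hmin ⟨z, h₁⟩ ⟨hz, l + i, k, ?_⟩ ⟨hg0, i, P.id _, ?_, ?_⟩
    · rw [e, e₁]
      simp only [P.assoc, pipow_comp]
    · rw [P.comp_id, e₁]
    · rintro rfl
      exact absurd (isId_pipow.2 rfl) hc.1
  · refine hmin ⟨⟨u, hu⟩, g₁⟩ ⟨hut, l, h₁ ⊚ k, ?_⟩ ⟨hg0, 0, h₁, ?_, fun _ => hc.2⟩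
    · rw [e, e₁]
      simp only [P.assoc]
    · rw [P.pipow_zero, P.id_comp, e₁]

theorem Gen.exists_eq {s t : P.Obj} {f : P.Hom s t} (hf : P.Gen f) (g : P.Hom s t) :
    ∃ i j : ℕ, g = P.pipow t i ⊚ f ⊚ P.pipow s j := by
  rcases hf.2 with h | h <;> obtain ⟨i, rfl⟩ := h g
  · exact ⟨i, 0, by rw [P.pipow_zero, P.comp_id]⟩
  · exact ⟨0, i, by rw [P.pipow_zero, P.id_comp]⟩

theorem Gen.isIrreducibleOn {s t : P.Obj} {f : P.Hom s t} (hf : P.Gen f) (hst : s ≠ t)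
    (h : ∀ z ∈ D, z ≠ s → z ≠ t → ∀ (g : P.Hom z t) (k : P.Hom s z), f ≠ g ⊚ k) :
    P.IsIrreducibleOn D f := by
  refine ⟨hf.1, not_isId hst f, fun z hz g k e => ?_⟩
  by_cases hzs : z = s
  · subst hzs
    obtain ⟨j, rfl⟩ := P.endo_cyclic _ k
    obtain ⟨l, m, rfl⟩ := hf.exists_eq g
    simp only [P.assoc, ← pipow_add] at e
    have := (eq_of_loop hf.1 e).2
    exact Or.inr (isId_pipow.2 (by omega))
  by_cases hzt : z = t
  · subst hzt
    obtain ⟨j, rfl⟩ := P.endo_cyclic _ g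
    obtain ⟨l, m, rfl⟩ := hf.exists_eq k
    simp only [pipow_comp] at e
    have := (eq_of_loop hf.1 e).1
    exact Or.inl (isId_pipow.2 (by omega))
  exact absurd e (h z hz hzs hzt g k)

theorem isIrreducibleOn_pi {s : P.Obj} (h0 : P.pi s ≠ P.zero s s)
    (h : ∀ z ∈ D, z ≠ s → ∀ (g : P.Hom z s) (k : P.Hom s z), P.pi s ≠ g ⊚ k) :
    P.IsIrreducibleOn D (P.pi s) := by
  refine ⟨h0, fun hi => absurd (isId_pipow.1 hi) (by omega), fun z hz g k e => ?_⟩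
  by_cases hzs : z = s
  · subst hzs
    obtain ⟨j, rfl⟩ := P.endo_cyclic _ k
    obtain ⟨i, rfl⟩ := P.endo_cyclic _ g
    rw [← pipow_add] at e
    have := pipow_inj e h0
    rw [isId_pipow, isId_pipow]
    omega
  exact absurd e (h z hz hzs g k)

theorem IsIrreducible.isIrreducibleOn {s t : P.Obj} {f : P.Hom s t} (hf : P.IsIrreducible f) :
    P.IsIrreducibleOn D f := ⟨hf.1, hf.2.1, fun z _ => hf.2.2 z⟩

/-- factorizations `x → z → y` -/
abbrev Split (P : RayCategory) (x y : P.Obj) : Type := Σ z : P.Obj, P.Hom z y × P.Hom x z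

/-- moving a morphism from the right-hand to the left-hand factor of a proper factorization -/
inductive Slide {x y : P.Obj} : P.Split x y → P.Split x y → Prop
  | mk {z z' : P.Obj} (g : P.Hom z y) (k : P.Hom z' z) (h : P.Hom x z')
      (hg : ¬ P.IsId g) (hh : ¬ P.IsId h) : Slide ⟨z, g, k ⊚ h⟩ ⟨z', g ⊚ k, h⟩

/-- proper factorizations which are connected by slides -/
def Linked {x y a b : P.Obj} (α : P.Hom a y) (v : P.Hom x a) (β : P.Hom b y) (w : P.Hom x b) :
    Prop := Relation.EqvGen Slide (⟨a, α, v⟩ : P.Split x y) ⟨b, β, w⟩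

section Linked

variable {x y a b c : P.Obj} {α : P.Hom a y} {v : P.Hom x a} {β : P.Hom b y} {w : P.Hom x b}
  {γ : P.Hom c y} {u : P.Hom x c}

theorem Linked.symm (h : Linked α v β w) : Linked β w α v := Relation.EqvGen.symm _ _ h

theorem Linked.trans (h : Linked α v β w) (h' : Linked β w γ u) : Linked α v γ u :=
  Relation.EqvGen.trans _ _ _ h h'

theorem Linked.of_eq (k : P.Hom b a) (hα : ¬ P.IsId α) (hw : ¬ P.IsId w) (h₁ : v = k ⊚ w)
    (h₂ : β = α ⊚ k) : Linked α v β w := by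
  subst h₁ h₂
  exact Relation.EqvGen.rel _ _ (Slide.mk α k w hα hw)

end Linked

/-- the data attached to a contour `(α v, β w)` from `x` to `y` -/
structure Cfg {x y a b : P.Obj} (α : P.Hom a y) (β : P.Hom b y) (v : P.Hom x a) (w : P.Hom x b) :
    Prop where
  irrα : P.IsIrreducible α
  irrβ : P.IsIrreducible β
  eq : α ⊚ v = β ⊚ w
  hay : a ≠ y
  hby : b ≠ y
  hab : a ≠ b
  nv : ¬ P.IsId v
  nw : ¬ P.IsId w
  ne_zero : P.pi y ⊚ α ⊚ v ≠ P.zero x y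
  transit : (α ⊚ v) ⊚ P.pi x = P.zero x y ∨
    ∃ l, 1 ≤ l ∧ (α ⊚ v) ⊚ P.pi x = P.pipow y l ⊚ α ⊚ v
  nα : ∀ ξ, P.pi y ≠ α ⊚ ξ
  nβ : ∀ ξ, P.pi y ≠ β ⊚ ξ
  nlinked : ¬ Linked α v β w
  repFin : ∀ D : Set P.Obj, x ∈ D → y ∈ D → D ⊆ {x, a, b, y} →
    RepFin P D (IdealOf P (P.pi y ⊚ α ⊚ v))

namespace Cfg

variable {x y a b : P.Obj} {α : P.Hom a y} {β : P.Hom b y} {v : P.Hom x a} {w : P.Hom x b}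

theorem symm (C : Cfg α β v w) : Cfg β α w v where
  irrα := C.irrβ
  irrβ := C.irrα
  eq := C.eq.symm
  hay := C.hby
  hby := C.hay
  hab := C.hab.symm
  nv := C.nw
  nw := C.nv
  ne_zero := C.eq ▸ C.ne_zero
  transit := C.eq ▸ C.transit
  nα := C.nβ
  nβ := C.nα
  nlinked := fun h => C.nlinked h.symm
  repFin := fun D hx hy hD => C.eq ▸ C.repFin D hx hy (fun z hz => by
    have := hD hz
    simp only [Set.mem_insert_iff, Set.mem_singleton_iff] at this ⊢
    tauto)

theorem repFinOn (C : Cfg α β v w) {D : Set P.Obj} (hx : x ∈ D) (hy : y ∈ D)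
    (hD : D ⊆ {x, a, b, y}) : RepFinOn D (P.pi y ⊚ α ⊚ v) where
  fin := Set.Finite.subset (by simp) hD
  left_mem := hx
  right_mem := hy
  nirr := fun h => by
    rcases h.2.2 y hy _ _ rfl with h | h
    · exact absurd (isId_pipow.1 h) (by omega)
    · exact C.nv (isId_of_comp_isId h).2
  nid := fun h => C.nv (isId_of_comp_isId (isId_of_comp_isId h).2).2
  rep := C.repFin D hx hy hD

end Cfg

end RayCategory

namespace RayCategory

local infixr:80 "⊚" => RayCategory.comp _

variable {P : RayCategory} {D : Set P.Obj} {x y : P.Obj} {mu : P.Hom x y}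

namespace RepFinOn

/-- a cycle formed by the morphisms `z : y → a`, `t : a → a`, `f : a → b` and the composition
of `n : y → x` with `m : x → b` -/
theorem no_cycle_five (h : RepFinOn D mu) {u c b a : P.Obj} (hu : u ∈ D) (hc : c ∈ D) (hb : b ∈ D)
    (ha : a ∈ D) (hcb : c ≠ b) (hca : c ≠ a) (hab : a ≠ b) (hau : a ≠ u) (hcu : c ≠ u)
    {n : P.Hom u c} {m : P.Hom c b} {f : P.Hom a b} {t : P.Hom a a} {z : P.Hom u a}
    (hn : P.IsIrreducibleOn D n) (hm : P.IsIrreducibleOn D m) (hf : P.IsIrreducibleOn D f)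
    (ht : P.IsIrreducibleOn D t) (hz : P.IsIrreducibleOn D z) (h₁ : m ⊚ n ≠ P.zero _ _)
    (n₁ : arr (m ⊚ n) ≠ arr mu) (o₁ : OnlyFactors D (m ⊚ n) [(arr m, arr n)]) : False := by
  have hL : IsCoverList D mu ![u, c, b, a, a]
      ([(0, 1, arr n), (1, 2, arr m), (3, 2, arr f), (3, 4, arr t), (0, 4, arr z)] ++
        [(0, 2, arr (m ⊚ n))]) := by
    apply isCoverList_append h.left_mem h.right_mem h.nirr h.nid
    · simp [Fin.forall_fin_succ, *]
    · simp
    · simp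
    · simp [hn, hm, hf, ht, hz]
    · simp [h₁]
    · simp only [List.forall_mem_cons]
      exact ⟨n₁, List.forall_mem_nil _⟩
    · simp only [List.forall_mem_cons]
      exact ⟨⟨_, hc, _, _, _, _, rfl, hm.2.1, hn.2.1⟩, List.forall_mem_nil _⟩
    · simp [*, hab.symm]
    · simp
    · simp only [List.forall_mem_cons]
      exact ⟨⟨_, o₁, exists_mid 1 (by simp) (by simp)⟩, List.forall_mem_nil _⟩
    · simp only [List.forall_mem_cons, List.cons_append, List.nil_append]
      and_intros
      all_goals first
        | exact fun h => absurd h (by decide)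
        | exact List.forall_mem_nil _
        | exact fun _ => ⟨_, _, _, _, _, rfl, rfl, by simp⟩
  refine hL.isCover.not_repFin h.fin (n := 1)
    (fun e p q => if p = 0 ∧ q = 4 then !![e] else 1) (fun e => IsCoverList.isRep ?_ ?_)
    (p₀ := 3) (q₀ := 2) (F₀ := arr f) (Or.inr (by simp)) ?_ ?_ ?_ h.rep
  · intro p
    fin_cases p <;> rfl
  · simp only [List.forall_mem_cons, List.cons_append, List.nil_append]
    and_intros
    all_goals first
      | exact fun h => absurd h (by decide)
      | exact List.forall_mem_nil _
      | (intro; simp)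
  · rintro p q (⟨rfl, h'⟩ | hl)
    · exact absurd (isId_of_arr_eq h') hf.2.1
    · have key : ∀ l ∈ ([(0, 1, arr n), (1, 2, arr m), (3, 2, arr f), (3, 4, arr t),
          (0, 4, arr z)] ++ [(0, 2, arr (m ⊚ n))] : List (Fin 5 × Fin 5 × P.Arr)),
          l.2.2 = arr f → l.1 = 3 := by
        simp only [List.forall_mem_cons, List.cons_append, List.nil_append]
        exact ⟨fun h => absurd h (arr_ne_of_right hcb _ _), fun h => absurd h (arr_ne_of_left hca _ _),
          fun _ => trivial, fun _ => trivial, fun h => absurd h (arr_ne_of_right hab _ _),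
          fun h => absurd h (hf.ne_comp hc hm.2.1 hn.2.1), List.forall_mem_nil _⟩
      exact key _ hl rfl
  · intro e
    simp
  · intro e d hed X hX
    have e1 := hX 0 1 (arr n) (Or.inr (by simp))
    have e2 := hX 1 2 (arr m) (Or.inr (by simp))
    have e3 := hX 3 2 (arr f) (Or.inr (by simp))
    have e4 := hX 3 4 (arr t) (Or.inr (by simp))
    have e5 := congrFun (congrFun (hX 0 4 (arr z) (Or.inr (by simp))) 0) 0
    simp [Matrix.mul_apply] at e1 e2 e3 e4 e5
    rw [← e4, e3, ← e2, ← e1] at e5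
    have h3 : X 0 0 0 * (d - e) = 0 := by linear_combination e5
    have h4 := (mul_eq_zero.1 h3).resolve_right (sub_ne_zero.2 hed.symm)
    have h5 : X 2 = 0 := by
      rw [← e2, ← e1]
      ext i j
      fin_cases i
      fin_cases j
      simpa using h4
    rw [h5, zero_mul]

/-- the configuration of morphisms `f : a → b` and `m : s → a` with an endomorphism `t` of `a` -/
theorem no_long_tail (h : RepFinOn D mu) {s a b : P.Obj} (hs : s ∈ D) (ha : a ∈ D) (hb : b ∈ D)
    (hsa : s ≠ a) (hab : a ≠ b)
    {f : P.Hom a b} {t : P.Hom a a} {m : P.Hom s a}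
    (hf : P.IsIrreducibleOn D f) (ht : P.IsIrreducibleOn D t) (hm : P.IsIrreducibleOn D m)
    (h₁ : f ⊚ t ≠ P.zero _ _) (h₂ : t ⊚ t ≠ P.zero _ _) (h₃ : t ⊚ t ⊚ t ≠ P.zero _ _)
    (h₄ : t ⊚ m ≠ P.zero _ _) (n₁ : arr (f ⊚ t) ≠ arr mu) (n₂ : arr (t ⊚ t) ≠ arr mu)
    (n₃ : arr (t ⊚ t ⊚ t) ≠ arr mu) (n₄ : arr (t ⊚ m) ≠ arr mu)
    (o₁ : OnlyFactors D (f ⊚ t) [(arr f, arr t)])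
    (o₂ : OnlyFactors D (t ⊚ t) [(arr t, arr t)])
    (o₃ : OnlyFactors D (t ⊚ t ⊚ t) [(arr t, arr (t ⊚ t)), (arr (t ⊚ t), arr t)])
    (o₄ : OnlyFactors D (t ⊚ m) [(arr t, arr m)]) : False := by
  have hne : t ⊚ t ≠ t ⊚ t ⊚ t := fun e => ht.2.1 (by
    rw [← P.comp_id (t ⊚ t), P.assoc] at e
    exact isId_iff.2 ((P.comp_id t).symm.trans (cancel_left (cancel_left e (by rwa [P.comp_id]))
      (by rw [P.comp_id]; exact ht.1)).symm))
  have hL : IsCoverList D mu ![a, b, a, a, s, a]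
      ([(0, 2, arr t), (2, 3, arr t), (3, 5, arr t), (2, 1, arr f), (4, 3, arr m)] ++
        [(0, 1, arr (f ⊚ t)), (0, 3, arr (t ⊚ t)), (2, 5, arr (t ⊚ t)), (0, 5, arr (t ⊚ t ⊚ t)),
          (4, 5, arr (t ⊚ m))]) := by
    apply isCoverList_append_of_ne h.left_mem h.right_mem h.nirr h.nid
    · simp [Fin.forall_fin_succ, *]
    · simp
    · simp
    · simp [hf, ht, hm]
    · simp [h₁, h₂, h₃, h₄]
    · simp only [List.forall_mem_cons]
      exact ⟨n₁, n₂, n₂, n₃, n₄, List.forall_mem_nil _⟩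
    · simp only [List.forall_mem_cons]
      exact ⟨⟨_, ha, _, _, _, _, rfl, hf.2.1, ht.2.1⟩,
        ⟨_, ha, _, _, _, _, rfl, ht.2.1, ht.2.1⟩,
        ⟨_, ha, _, _, _, _, rfl, ht.2.1, ht.2.1⟩,
        ⟨_, ha, _, _, _, _, rfl, ht.2.1, fun h => ht.2.1 (isId_of_comp_isId h).1⟩,
        ⟨_, ha, _, _, _, _, rfl, ht.2.1, hm.2.1⟩,
        List.forall_mem_nil _⟩
    · simp [*, hab.symm, hsa.symm]
    · simp [hab.symm, hsa.symm, hne]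
    · simp only [List.forall_mem_cons]
      refine ⟨⟨_, o₁, exists_mid 2 (by simp) (by simp)⟩,
        ⟨_, o₂, exists_mid 2 (by simp) (by simp)⟩,
        ⟨_, o₂, exists_mid 3 (by simp) (by simp)⟩,
        ⟨_, o₃, ?_⟩,
        ⟨_, o₄, exists_mid 3 (by simp) (by simp)⟩,
        List.forall_mem_nil _⟩
      simp only [List.forall_mem_cons]
      exact ⟨⟨3, by simp⟩, ⟨2, by simp⟩, List.forall_mem_nil _⟩
    · simp only [List.forall_mem_cons, List.cons_append, List.nil_append]
      and_intros
      all_goals first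
        | exact fun h => absurd h (by decide)
        | exact List.forall_mem_nil _
        | exact fun _ => ⟨_, _, _, _, _, rfl, rfl, by simp [P.assoc]⟩
  refine hL.not_repFin_of_leaves h.fin ![some 0, some 1, none, none, some 2, some 3] ?_ 2
    ?_ ?_ (2, 1, arr f) ?_ ?_ ?_ ?_ h.rep
  · simp
  · simp [Fin.forall_fin_succ]
    grind
  · simp [Fin.forall_fin_succ]
  · simp
  · simp
  · simp
  · simp only [List.forall_mem_cons, List.cons_append, List.nil_append]
    exact ⟨fun e => absurd e (arr_ne_of_right hab _ _),
      fun e => trivial,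
      fun e => absurd e (arr_ne_of_right hab _ _),
      fun _ => trivial,
      fun e => absurd e (arr_ne_of_left hsa _ _),
      fun e => absurd e (hf.ne_comp ha hf.2.1 ht.2.1),
      fun e => absurd e (arr_ne_of_right hab _ _),
      fun e => absurd e (arr_ne_of_right hab _ _),
      fun e => absurd e (arr_ne_of_right hab _ _),
      fun e => absurd e (arr_ne_of_left hsa _ _),
      List.forall_mem_nil _⟩

end RepFinOn

end RayCategory

namespace RayCategory

local infixr:80 "⊚" => RayCategory.comp _

variable {P : RayCategory} {D : Set P.Obj}

theorem pipow_comp_eq {x y : P.Obj} {f : P.Hom x y} {i : ℕ} (h : P.pi y ⊚ f = f ⊚ P.pipow x i)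
    (n : ℕ) : P.pipow y n ⊚ f = f ⊚ P.pipow x (n * i) := by
  induction n with
  | zero => rw [Nat.zero_mul, P.pipow_zero, P.pipow_zero, P.id_comp, P.comp_id]
  | succ n ih => rw [P.pipow_succ, P.assoc, ih, ← P.assoc, pipow_one, h, comp_pipow, Nat.succ_mul,
      Nat.add_comm]

theorem comp_pipow_eq {x y : P.Obj} {f : P.Hom x y} {i : ℕ} (h : f ⊚ P.pi x = P.pipow y i ⊚ f)
    (n : ℕ) : f ⊚ P.pipow x n = P.pipow y (n * i) ⊚ f := by
  induction n with
  | zero => rw [Nat.zero_mul, P.pipow_zero, P.pipow_zero, P.id_comp, P.comp_id]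
  | succ n ih => rw [pipow_add, ← P.assoc, ih, P.assoc, pipow_one, h, pipow_comp, Nat.succ_mul]

theorem not_isId_pi (x : P.Obj) : ¬ P.IsId (P.pi x) := fun h => absurd (isId_pipow.1 h) (by omega)

theorem ne_comp_pi {x z : P.Obj} {g : P.Hom z x} {k : P.Hom x z} {i j l : ℕ} (hxz : x ≠ z)
    (h0 : P.pi x ≠ P.zero x x) (e : P.pi x = P.pipow x i ⊚ (g ⊚ P.pipow z l ⊚ k) ⊚ P.pipow x j) :
    i = 0 ∧ j = 0 := by
  obtain ⟨n, hn⟩ := P.endo_cyclic x (g ⊚ P.pipow z l ⊚ k)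
  have hn0 : n ≠ 0 := by
    rintro rfl
    exact not_isId hxz.symm g (isId_of_comp_isId (hn ▸ isId_pipow.2 rfl)).1
  rw [hn, ← pipow_add, ← pipow_add] at e
  have := pipow_inj e h0
  omega

/-- if `π(y)` factors through `x` then it is the composition of the generators of `P(x,y)` and
`P(y,x)` -/
theorem Gen.exists_pi_eq {x y : P.Obj} (hxy : x ≠ y) {f : P.Hom x y} (hf : P.Gen f)
    (h0 : P.pi y ⊚ f ≠ P.zero x y) {g : P.Hom x y} {k : P.Hom y x} (e : P.pi y = g ⊚ k) :
    ∃ η : P.Hom y x, P.Gen η ∧ P.pi y = f ⊚ η := by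
  have hy0 := ne_zero_left h0
  obtain ⟨η, hη⟩ := exists_gen (ne_zero_right (e ▸ hy0))
  refine ⟨η, hη, ?_⟩
  obtain ⟨p, q, rfl⟩ := hf.exists_eq g
  obtain ⟨p', q', rfl⟩ := hη.exists_eq k
  have e' : P.pi y = P.pipow y p ⊚ (f ⊚ P.pipow x (q + p') ⊚ η) ⊚ P.pipow y q' := by
    rw [e]
    simp only [P.assoc, pipow_comp]
  obtain ⟨rfl, rfl⟩ := ne_comp_pi hxy.symm hy0 e'
  rw [P.pipow_zero, P.id_comp, P.comp_id] at e'
  obtain ⟨d, hd⟩ := P.endo_cyclic x (η ⊚ f)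
  obtain ⟨n, hn⟩ := P.endo_cyclic y (f ⊚ η)
  have hn0 : n ≠ 0 := by
    rintro rfl
    exact not_isId hxy f (isId_of_comp_isId (hn ▸ isId_pipow.2 rfl)).1
  have h1 : P.pi y ⊚ f = f ⊚ P.pipow x (q + p' + d) := by
    rw [e', P.assoc, P.assoc, hd, ← pipow_add]
  have h2 : f ⊚ P.pipow x d = f ⊚ P.pipow x (n * (q + p' + d)) := by
    rw [← pipow_comp_eq h1, ← hn, P.assoc, hd]
  have h3 : f ⊚ P.pipow x d ≠ P.zero x y := by
    rw [h1, Nat.add_comm, pipow_add, ← P.assoc] at h0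
    exact ne_zero_left h0
  have h4 := right_pow_inj h2 h3
  have h5 : q + p' + d ≤ n * (q + p' + d) := Nat.le_mul_of_pos_left _ (Nat.pos_of_ne_zero hn0)
  rw [e', show q + p' = 0 by omega, P.pipow_zero, P.id_comp]

theorem Gen.eq_of_comp_eq_pi {x y : P.Obj} (hxy : x ≠ y) {f : P.Hom x y} {η : P.Hom y x}
    (hf : P.Gen f) (hη : P.Gen η) (h0 : P.pi y ≠ P.zero y y) (e : P.pi y = f ⊚ η)
    {g : P.Hom x y} {k : P.Hom y x} (e' : P.pi y = g ⊚ k) : g = f ∧ k = η := by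
  obtain ⟨p, q, rfl⟩ := hf.exists_eq g
  obtain ⟨p', q', rfl⟩ := hη.exists_eq k
  have e'' : P.pi y = P.pipow y p ⊚ (f ⊚ P.pipow x (q + p') ⊚ η) ⊚ P.pipow y q' := by
    rw [e']
    simp only [P.assoc, pipow_comp]
  obtain ⟨rfl, rfl⟩ := ne_comp_pi hxy.symm h0 e''
  rw [P.pipow_zero, P.id_comp, P.comp_id, e] at e''
  have h1 := left_loop hη.1 (cancel_left e'' (e ▸ h0))
  obtain ⟨rfl, rfl⟩ : q = 0 ∧ p' = 0 := by omega
  simp only [P.pipow_zero, P.comp_id, P.id_comp, and_self]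

/-- factorizations of `π(y)` in a subcategory where it is not irreducible -/
theorem exists_eq_of_not_isIrreducibleOn {s : P.Obj} (h0 : P.pi s ≠ P.zero s s)
    (h : ¬ P.IsIrreducibleOn D (P.pi s)) :
    ∃ z ∈ D, z ≠ s ∧ ∃ (g : P.Hom z s) (k : P.Hom s z), P.pi s = g ⊚ k := by
  by_contra! h'
  exact h (isIrreducibleOn_pi h0 h')

namespace Cfg

variable {x y a b : P.Obj} {α : P.Hom a y} {β : P.Hom b y} {v : P.Hom x a} {w : P.Hom x b}

theorem comp_ne_zero (C : Cfg α β v w) : α ⊚ v ≠ P.zero x y := ne_zero_right C.ne_zero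

theorem pi_ne_zero (C : Cfg α β v w) : P.pi y ≠ P.zero y y := ne_zero_left C.ne_zero

theorem pi_comp_ne_zero (C : Cfg α β v w) : P.pi y ⊚ α ≠ P.zero a y := by
  have := C.ne_zero
  rw [← P.assoc] at this
  exact ne_zero_left this

theorem eq_one_of_comp_pipow_eq (C : Cfg α β v w) {n : ℕ}
    (h : (α ⊚ v) ⊚ P.pipow x n = P.pi y ⊚ α ⊚ v) : n = 1 := by
  obtain _ | n := n
  · rw [P.pipow_zero, P.comp_id] at h
    have := left_loop (ne_zero_right C.ne_zero) h
    omega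
  rcases C.transit with h0 | ⟨l, hl, e⟩
  · exfalso
    apply C.ne_zero
    rw [← h, Nat.add_comm, pipow_add, ← P.assoc, pipow_one, h0, P.zero_comp]
  · rw [comp_pipow_eq e] at h
    have := left_pow_inj h (h ▸ C.ne_zero)
    exact Nat.eq_one_of_mul_eq_one_right this

theorem comp_eq_pipow (C : Cfg α β v w) (g : P.Hom y a) : ∃ e, 2 ≤ e ∧ α ⊚ g = P.pipow y e := by
  obtain ⟨e, he⟩ := P.endo_cyclic y (α ⊚ g)
  refine ⟨e, ?_, he⟩
  obtain _ | _ | e := e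
  · exact absurd (isId_of_comp_isId (he ▸ isId_pipow.2 rfl : P.IsId (α ⊚ g))).1 C.irrα.2.1
  · exact absurd he.symm (C.nα g)
  · omega

/-- if `P(a, y)` is not cyclic over `P(y, y)`, then `P(x, a)` is not cyclic over `P(x, x)` -/
theorem exists_left_gen (C : Cfg α β v w) {i : ℕ} (hi : 2 ≤ i)
    (hc : P.pi y ⊚ α = α ⊚ P.pipow a i) :
    x ≠ a ∧ ∃ (μ : P.Hom x a) (j : ℕ), μ ≠ P.zero x a ∧ P.LGen μ ∧ 2 ≤ j ∧
      μ ⊚ P.pi x = P.pipow a j ⊚ μ := by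
  obtain ⟨μ, hμ⟩ := exists_gen (ne_zero_right C.comp_ne_zero)
  have hr : ¬ P.RGen μ := by
    intro hr
    obtain ⟨e, rfl⟩ := hr v
    obtain ⟨c, hc'⟩ := hr (P.pi a ⊚ μ)
    have : i * c = 1 := C.eq_one_of_comp_pipow_eq (by
      rw [← P.assoc (P.pi y), hc, P.assoc α (P.pipow a i), ← P.assoc (P.pipow a i),
        pipow_comp_eq hc']
      simp only [P.assoc, ← pipow_add, Nat.add_comm])
    have := Nat.eq_one_of_mul_eq_one_right this
    omega
  have hl := hμ.2.resolve_right hr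
  refine ⟨?_, μ, ?_⟩
  · rintro rfl
    obtain ⟨m, rfl⟩ := P.endo_cyclic _ μ
    obtain ⟨n, hn⟩ := hl (P.id x)
    have := isId_pipow.1 (isId_of_comp_isId (hn ▸ isId_id x)).2
    subst this
    exact hr fun f => by simpa only [P.pipow_zero, P.id_comp] using P.endo_cyclic x f
  · obtain ⟨j, hj⟩ := hl (μ ⊚ P.pi x)
    refine ⟨j, hμ.1, hl, ?_, hj⟩
    obtain _ | _ | j := j
    · rw [P.pipow_zero, P.id_comp] at hj
      have := right_loop (j := 1) hμ.1 hj.symm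
      omega
    · refine absurd (fun f => ?_) hr
      obtain ⟨n, rfl⟩ := hl f
      exact ⟨n * 1, pipow_comp_eq hj.symm n⟩
    · omega

end Cfg

end RayCategory

namespace RayCategory

local infixr:80 "⊚" => RayCategory.comp _

variable {P : RayCategory} {D : Set P.Obj}

/-- a generator `α` of `P(a, y)` and a generator `μ` of `P(x, a)` such that neither `P(a, y)` is
cyclic over `P(y, y)` nor `P(x, a)` is cyclic over `P(x, x)` -/
structure Steep {x a y : P.Obj} (α : P.Hom a y) (μ : P.Hom x a) (i j n : ℕ) : Prop where
  hxa : x ≠ a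
  hay : a ≠ y
  rgen : P.RGen α
  lgen : P.LGen μ
  hi : 2 ≤ i
  hj : 2 ≤ j
  hn : 2 ≤ n
  pi_comp : P.pi y ⊚ α = α ⊚ P.pipow a i
  comp_pi : μ ⊚ P.pi x = P.pipow a j ⊚ μ
  ne_zero : α ⊚ P.pipow a n ⊚ μ ≠ P.zero x y
  comp_eq_pipow : ∀ g : P.Hom y a, ∃ e, 2 ≤ e ∧ α ⊚ g = P.pipow y e

namespace Steep

variable {x y a : P.Obj} {α : P.Hom a y} {μ : P.Hom x a} {i j n : ℕ}

theorem comp_pipow_ne_zero (S : Steep α μ i j n) {d : ℕ} (hd : d ≤ n) :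
    α ⊚ P.pipow a d ≠ P.zero _ _ := by
  have := S.ne_zero
  obtain ⟨c, rfl⟩ := Nat.exists_eq_add_of_le hd
  rw [pipow_add, P.assoc, ← P.assoc] at this
  exact ne_zero_left this

theorem pipow_ne_zero (S : Steep α μ i j n) {d : ℕ} (hd : d ≤ n) : P.pipow a d ≠ P.zero _ _ :=
  ne_zero_right (S.comp_pipow_ne_zero hd)

theorem pipow_comp_ne_zero (S : Steep α μ i j n) {d : ℕ} (hd : d ≤ n) :
    P.pipow a d ⊚ μ ≠ P.zero _ _ := by
  have := ne_zero_right S.ne_zero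
  obtain ⟨c, rfl⟩ := Nat.exists_eq_add_of_le hd
  rw [Nat.add_comm, pipow_add, P.assoc] at this
  exact ne_zero_right this

theorem pi_ne_comp (S : Steep α μ i j n) (h0 : P.pi y ≠ P.zero y y) (g : P.Hom y a) :
    P.pi y ≠ α ⊚ g := by
  intro h
  obtain ⟨e, he, h'⟩ := S.comp_eq_pipow g
  have := pipow_inj (h.trans h') h0
  omega

theorem four_le (S : Steep α μ i j n) {d : ℕ} (hd : α ⊚ P.pipow a d ≠ P.zero _ _) {g : P.Hom y a}
    {h : P.Hom a y} (e : P.pipow a d = g ⊚ h) : 4 ≤ d := by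
  obtain ⟨c, rfl⟩ := S.rgen h
  obtain ⟨m, hm, hg⟩ := S.comp_eq_pipow g
  have h1 : α ⊚ P.pipow a d = α ⊚ P.pipow a (m * i + c) := by
    rw [e, ← P.assoc, hg, ← P.assoc, pipow_comp_eq S.pi_comp, comp_pipow]
  have h2 := right_pow_inj h1 hd
  have h3 : 2 * 2 ≤ m * i := Nat.mul_le_mul hm S.hi
  omega

theorem exists_eq (S : Steep α μ i j n) {d : ℕ} (hd : d ≤ n) {g : P.Hom x a}
    {h : P.Hom a x} (e : P.pipow a d = g ⊚ h) :
    ∃ m c, g = P.pipow a m ⊚ μ ∧ d = m + c * j ∧ 1 ≤ c := by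
  obtain ⟨m, rfl⟩ := S.lgen g
  obtain ⟨c, hc⟩ := P.endo_cyclic x (h ⊚ μ)
  refine ⟨m, c, rfl, ?_, ?_⟩
  · refine left_pow_inj (f := μ) ?_ (S.pipow_comp_ne_zero hd)
    rw [e, P.assoc, P.assoc, hc, comp_pipow_eq S.comp_pi, pipow_comp]
  · rcases Nat.eq_zero_or_pos c with rfl | h
    · exact absurd (isId_of_comp_isId (hc ▸ isId_pipow.2 rfl)).2 (not_isId S.hxa μ)
    · exact h

theorem pi_ne (S : Steep α μ i j n) (g : P.Hom x a) (h : P.Hom a x) : P.pi a ≠ g ⊚ h := by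
  intro e
  obtain ⟨m, c, -, h1, h2⟩ := S.exists_eq (d := 1) (by have := S.hn; omega) e
  have := Nat.mul_le_mul h2 S.hj
  omega

theorem isIrreducibleOn_pi (S : Steep α μ i j n) (hD : D ⊆ {x, a, y}) :
    P.IsIrreducibleOn D (P.pi a) := by
  have hn := S.hn
  refine RayCategory.isIrreducibleOn_pi (S.pipow_ne_zero (d := 1) (by omega)) fun z hz hza g k e => ?_
  rcases hD hz with rfl | rfl | rfl
  · exact S.pi_ne g k e
  · exact hza rfl
  · have := S.four_le (d := 1) (S.comp_pipow_ne_zero (by omega)) e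
    omega

theorem false_of_isIrreducibleOn (S : Steep α μ i j n) (hα : P.IsIrreducible α)
    (hR : RepFinOn {x, a, y} (α ⊚ P.pipow a n ⊚ μ))
    (h0 : ∀ f : P.Hom x y, P.Gen f → P.pi y ⊚ f ≠ P.zero x y) (hy0 : P.pi y ≠ P.zero y y)
    {ζ : P.Hom y a} (hζ : P.IsIrreducibleOn {x, a, y} ζ) : False := by
  have ht := S.isIrreducibleOn_pi (Set.Subset.refl _)
  have ha := hα.isIrreducibleOn (D := {x, a, y})
  by_cases hρ : P.IsIrreducibleOn {x, a, y} (P.pi y)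
  · exact hR.no_cycle_four (by simp) (by simp) (by simp) (by simp) S.hay.symm S.hay.symm
      hρ hζ ha ht
  obtain ⟨z, hz, hzy, g, k, e⟩ := exists_eq_of_not_isIrreducibleOn hy0 hρ
  have key : ∀ (g : P.Hom a y) (h : P.Hom y a), P.pi y ≠ g ⊚ h := by
    intro g h e
    obtain ⟨c, rfl⟩ := S.rgen g
    rw [P.assoc] at e
    exact S.pi_ne_comp hy0 _ e
  rcases hz with rfl | rfl | rfl
  · obtain ⟨φ, hφ⟩ := exists_gen (ne_zero_left (e ▸ hy0))
    obtain ⟨η, hη, e'⟩ := hφ.exists_pi_eq hzy (h0 φ hφ) e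
    have hφi : P.IsIrreducibleOn {z, a, y} φ := hφ.isIrreducibleOn hzy (by
      rintro u (rfl | rfl | rfl) h1 h2 g' k' e₁
      · exact h1 rfl
      · rw [e₁, P.assoc] at e'
        exact key _ _ e'
      · exact h2 rfl)
    have hηi : P.IsIrreducibleOn {z, a, y} η := hη.isIrreducibleOn hzy.symm (by
      rintro u (rfl | rfl | rfl) h1 h2 g' k' e₁
      · exact h2 rfl
      · rw [e₁, ← P.assoc] at e'
        exact key _ _ e'
      · exact h1 rfl)
    refine hR.no_cycle_five (by simp) (by simp) (by simp) (by simp) hzy S.hxa S.hay S.hay hzy hηi hφi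
      ha ht hζ (e' ▸ hy0) (arr_ne_of_left hzy.symm _ _) ?_
    rw [← e']
    rintro u (rfl | rfl | rfl) g' k' e₁
    · obtain ⟨rfl, rfl⟩ := hφ.eq_of_comp_eq_pi hzy hη hy0 e' e₁
      simp
    · exact absurd e₁ (key _ _)
    · obtain ⟨p, rfl⟩ := P.endo_cyclic _ g'
      obtain ⟨q, rfl⟩ := P.endo_cyclic _ k'
      rw [← pipow_add] at e₁
      have := pipow_inj e₁ hy0
      rw [isId_pipow, isId_pipow]
      omega
  · exact key _ _ e
  · exact hzy rfl

theorem onlyFactors_pi_comp (S : Steep α μ i j n)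
    (hH : ∀ h : P.Hom x y, ∃ c, h = α ⊚ P.pipow a c ⊚ μ) :
    OnlyFactors {x, a, y} (P.pi a ⊚ μ) [(arr (P.pi a), arr μ)] := by
  have hn := S.hn
  have hne := S.pipow_comp_ne_zero (d := 1) (by omega)
  rintro z (rfl | rfl | rfl) g h e
  · obtain ⟨m, rfl⟩ := S.lgen g
    obtain ⟨c, rfl⟩ := P.endo_cyclic _ h
    rw [P.assoc, comp_pipow_eq S.comp_pi, pipow_comp] at e
    have := left_pow_inj e hne
    have hc : c * 2 ≤ c * j := Nat.mul_le_mul_left _ S.hj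
    exact Or.inr (Or.inl (isId_pipow.2 (by omega)))
  · obtain ⟨m, rfl⟩ := S.lgen h
    obtain ⟨c, rfl⟩ := P.endo_cyclic _ g
    rw [pipow_comp] at e
    have := left_pow_inj e hne
    obtain _ | c := c
    · exact Or.inl (isId_pipow.2 rfl)
    · obtain rfl : m = 0 := by omega
      obtain rfl : c = 0 := by omega
      rw [P.pipow_zero, P.id_comp]
      simp [pipow_one]
  · obtain ⟨c, rfl⟩ := hH h
    rw [← P.assoc α, ← P.assoc] at e
    have := S.four_le (d := 1) (S.comp_pipow_ne_zero (by omega)) (cancel_right e hne)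
    omega

theorem onlyFactors_comp_pi (S : Steep α μ i j n)
    (hH : ∀ h : P.Hom x y, ∃ c, h = α ⊚ P.pipow a c ⊚ μ) :
    OnlyFactors {x, a, y} (α ⊚ P.pi a) [(arr α, arr (P.pi a))] := by
  have hn := S.hn
  have hne := S.comp_pipow_ne_zero (d := 1) (by omega)
  rintro z (rfl | rfl | rfl) g h e
  · obtain ⟨c, rfl⟩ := hH g
    rw [P.assoc] at e
    exact absurd (cancel_left e hne) (S.pi_ne _ _)
  · obtain ⟨m, rfl⟩ := S.rgen g
    obtain ⟨c, rfl⟩ := P.endo_cyclic _ h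
    rw [comp_pipow] at e
    have := right_pow_inj e hne
    obtain _ | c := c
    · exact Or.inr (Or.inl (isId_pipow.2 rfl))
    · obtain rfl : m = 0 := by omega
      obtain rfl : c = 0 := by omega
      rw [P.pipow_zero, P.comp_id]
      simp [pipow_one]
  · obtain ⟨m, rfl⟩ := S.rgen h
    obtain ⟨c, rfl⟩ := P.endo_cyclic _ g
    rw [← P.assoc, pipow_comp_eq S.pi_comp, comp_pipow] at e
    have := right_pow_inj e hne
    have hc : c * 2 ≤ c * i := Nat.mul_le_mul_left _ S.hi
    exact Or.inl (isId_pipow.2 (by omega))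

theorem onlyFactors_comp (S : Steep α μ i j n) (h0 : α ⊚ μ ≠ P.zero x y)
    (hH : ∀ h : P.Hom x y, ∃ c, h = α ⊚ P.pipow a c ⊚ μ) :
    OnlyFactors {x, a, y} (α ⊚ μ) [(arr α, arr μ)] := by
  have hn := S.hn
  have hμ0 := ne_zero_right h0
  have key : ∀ p, α ⊚ μ = α ⊚ P.pipow a p ⊚ μ → p = 0 := fun p e =>
    left_loop hμ0 (cancel_left e h0)
  rintro z (rfl | rfl | rfl) g h e
  · obtain ⟨c, rfl⟩ := hH g
    obtain ⟨q, rfl⟩ := P.endo_cyclic _ h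
    rw [P.assoc, P.assoc, comp_pipow_eq S.comp_pi, pipow_comp] at e
    have := key _ e
    have hc : q * 2 ≤ q * j := Nat.mul_le_mul_left _ S.hj
    exact Or.inr (Or.inl (isId_pipow.2 (by omega)))
  · obtain ⟨m, rfl⟩ := S.rgen g
    obtain ⟨c, rfl⟩ := S.lgen h
    rw [P.assoc, pipow_comp] at e
    have := key _ e
    obtain rfl : m = 0 := by omega
    obtain rfl : c = 0 := by omega
    simp only [P.pipow_zero, P.comp_id, P.id_comp]
    simp
  · obtain ⟨c, rfl⟩ := hH h
    obtain ⟨p, rfl⟩ := P.endo_cyclic _ g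
    rw [← P.assoc, pipow_comp_eq S.pi_comp, P.assoc, pipow_comp] at e
    have := key _ e
    have hc : p * 2 ≤ p * i := Nat.mul_le_mul_left _ S.hi
    exact Or.inl (isId_pipow.2 (by omega))

theorem onlyFactors_pow (S : Steep α μ i j n) {d : ℕ} (hd : d ≤ n) (hd' : d ≤ 3)
    (hx : ∀ (g : P.Hom x a) (h : P.Hom a x), P.pipow a d ≠ g ⊚ h)
    {L : List (P.Arr × P.Arr)} (hL : ∀ p q, d = p + q → 1 ≤ p → 1 ≤ q →
      (arr (P.pipow a p), arr (P.pipow a q)) ∈ L) :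
    OnlyFactors {x, a, y} (P.pipow a d) L := by
  rintro z (rfl | rfl | rfl) g h e
  · exact absurd e (hx _ _)
  · obtain ⟨p, rfl⟩ := P.endo_cyclic _ g
    obtain ⟨q, rfl⟩ := P.endo_cyclic _ h
    rw [← pipow_add] at e
    have := pipow_inj e (S.pipow_ne_zero hd)
    rw [isId_pipow, isId_pipow]
    by_cases hp : p = 0
    · exact Or.inl hp
    · by_cases hq : q = 0
      · exact Or.inr (Or.inl hq)
      · exact Or.inr (Or.inr (hL p q this (by omega) (by omega)))
  · have := S.four_le (S.comp_pipow_ne_zero hd) e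
    omega

theorem false_of_comp_eq_zero (S : Steep α μ i j n) (hα : P.IsIrreducible α)
    (hR : RepFinOn {x, a, y} (α ⊚ P.pipow a n ⊚ μ)) 
    (hμ : P.IsIrreducibleOn {x, a, y} μ) (h0 : α ⊚ μ = P.zero x y) (hn : 3 ≤ n)
    (hH : ∀ h : P.Hom x y, ∃ c, h = α ⊚ P.pipow a c ⊚ μ) : False := by
  have hxa := S.hxa
  have hay := S.hay
  have e₂ : P.pi a ⊚ P.pi a = P.pipow a 2 := (P.pipow_succ a 1).symm
  have e₃ : P.pi a ⊚ P.pi a ⊚ P.pi a = P.pipow a 3 := by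
    rw [e₂]
    exact (P.pipow_succ a 2).symm
  have hx : ∀ d ≤ n, ∀ (g : P.Hom x a) (h : P.Hom a x), P.pipow a d ≠ g ⊚ h := by
    intro d hd g h e
    obtain ⟨m, c, rfl, h1, h2⟩ := S.exists_eq hd e
    obtain ⟨l, rfl⟩ : ∃ l, d = m + l := ⟨_, h1⟩
    have h3 := S.comp_pipow_ne_zero (d := l) (by omega)
    rw [pipow_add, P.assoc] at e
    rw [cancel_left e (pipow_add a m l ▸ S.pipow_ne_zero hd), ← P.assoc, h0, P.zero_comp] at h3
    exact h3 rfl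
  refine hR.no_long_tail (by simp) (by simp) (by simp) hxa hay hα.isIrreducibleOn
    (S.isIrreducibleOn_pi (Set.Subset.refl _)) hμ (S.comp_pipow_ne_zero (d := 1) (by omega))
    (e₂ ▸ S.pipow_ne_zero (by omega)) (e₃ ▸ S.pipow_ne_zero (by omega))
    (S.pipow_comp_ne_zero (d := 1) (by omega)) (arr_ne_of_left hxa.symm _ _)
    (arr_ne_of_left hxa.symm _ _) (arr_ne_of_left hxa.symm _ _) (arr_ne_of_right hay _ _)
    (S.onlyFactors_comp_pi hH) ?_ ?_ (S.onlyFactors_pi_comp hH)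
  · rw [e₂]
    refine S.onlyFactors_pow (by omega) (by omega) (hx 2 (by omega)) fun p q h h1 h2 => ?_
    obtain rfl : p = 1 := by omega
    obtain rfl : q = 1 := by omega
    simp [pipow_one]
  · rw [e₃, e₂]
    refine S.onlyFactors_pow (by omega) (by omega) (hx 3 (by omega)) fun p q h h1 h2 => ?_
    have : p = 1 ∧ q = 2 ∨ p = 2 ∧ q = 1 := by omega
    rcases this with ⟨rfl, rfl⟩ | ⟨rfl, rfl⟩ <;> simp [pipow_one]

theorem ne_of_ne_zero (S : Steep α μ i j n) (h0 : α ⊚ μ ≠ P.zero x y) :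
    arr (α ⊚ μ) ≠ arr (α ⊚ P.pipow a n ⊚ μ) := by
  have hn := S.hn
  intro h
  have h1 : α ⊚ μ = α ⊚ P.pipow a n ⊚ μ := by simpa using h
  have := left_loop (ne_zero_right h0) (cancel_left h1 h0)
  omega

theorem false_of_comp_ne_zero (S : Steep α μ i j n) (hα : P.IsIrreducible α)
    (hR : RepFinOn {x, a, y} (α ⊚ P.pipow a n ⊚ μ)) (hxy : x ≠ y)
    (hμ : P.IsIrreducibleOn {x, a, y} μ) (h0 : α ⊚ μ ≠ P.zero x y)
    (hH : ∀ h : P.Hom x y, ∃ c, h = α ⊚ P.pipow a c ⊚ μ) : False := by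
  have hxa := S.hxa
  have hay := S.hay
  have hn := S.hn
  have hj := S.hj
  have e₂ : P.pi a ⊚ P.pi a = P.pipow a 2 := (P.pipow_succ a 1).symm
  have ht := S.isIrreducibleOn_pi (Set.Subset.refl _)
  have h1 := S.pipow_comp_ne_zero (d := 1) (by omega)
  by_cases hx : ∃ θ : P.Hom a x, P.pipow a 2 = μ ⊚ θ
  · obtain ⟨θ, e⟩ := hx
    have h2 := S.pipow_ne_zero hn
    have h3 : θ ⊚ μ ≠ P.zero _ _ := by
      have := S.pipow_comp_ne_zero hn
      rw [e, P.assoc] at this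
      exact ne_zero_right this
    have hy : ∀ (g : P.Hom y x) (h : P.Hom a y), θ ≠ g ⊚ h := by
      intro g h e'
      rw [e', ← P.assoc] at e
      have := S.four_le (S.comp_pipow_ne_zero hn) e
      omega
    have hθ : P.IsIrreducibleOn {x, a, y} θ := by
      refine ⟨ne_zero_left h3, not_isId hxa.symm θ, ?_⟩
      rintro z (rfl | rfl | rfl) g h e'
      · obtain ⟨q, rfl⟩ := P.endo_cyclic _ g
        rw [e', ← P.assoc, comp_pipow_eq S.comp_pi] at e
        obtain ⟨m, c, hm, h4, h5⟩ := S.exists_eq hn e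
        have h6 := left_pow_inj hm (ne_zero_left (e ▸ h2))
        have h7 : q * 2 ≤ q * j := Nat.mul_le_mul_left _ hj
        have h8 : 1 * 2 ≤ c * j := Nat.mul_le_mul h5 hj
        exact Or.inl (isId_pipow.2 (by omega))
      · obtain ⟨q, rfl⟩ := P.endo_cyclic _ h
        obtain _ | q := q
        · exact Or.inr (isId_pipow.2 rfl)
        · rw [e', pipow_add, ← P.assoc, ← P.assoc] at e
          have h4 : P.pipow z 1 ⊚ P.pipow z 1 = P.pipow z 2 := e₂
          exact absurd (cancel_right (h4.trans e) (h4 ▸ h2)) (by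
            rw [P.assoc]
            exact S.pi_ne _ _)
      · exact absurd e' (hy _ _)
    refine hR.no_star_one_three (by simp) (by simp) (by simp) (by simp) (by simp) hay hxa.symm
      hxy.symm hxa hμ ht hα.isIrreducibleOn hθ h1 h0 h3 (arr_ne_of_right hay _ _)
      (S.ne_of_ne_zero h0) (arr_ne_of_right hxy _ _) (S.onlyFactors_pi_comp hH)
      (S.onlyFactors_comp h0 hH) ?_
    rintro z (rfl | rfl | rfl) g h e'
    · have h4 : θ ⊚ μ = P.pi z := by
        obtain ⟨c, hc⟩ := P.endo_cyclic _ (θ ⊚ μ)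
        have h5 : P.pipow a 2 ⊚ μ = P.pipow a (c * j) ⊚ μ := by
          rw [e, P.assoc, hc, comp_pipow_eq S.comp_pi]
        have h6 := left_pow_inj h5 (S.pipow_comp_ne_zero hn)
        obtain _ | _ | c := c
        · omega
        · exact hc
        · have : 2 * 2 ≤ (c + 1 + 1) * j := Nat.mul_le_mul (by omega) hj
          omega
      obtain ⟨p, rfl⟩ := P.endo_cyclic _ g
      obtain ⟨q, rfl⟩ := P.endo_cyclic _ h
      rw [h4, ← pipow_add] at e'
      have := pipow_inj e' (by rwa [pipow_one, ← h4])
      rw [isId_pipow, isId_pipow]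
      omega
    · obtain ⟨m, rfl⟩ := S.lgen h
      rw [← P.assoc] at e'
      have h4 := cancel_right e' h3
      rcases hθ.2.2 z (by simp) _ _ h4 with h5 | h5
      · exact absurd h5 (not_isId hxa.symm g)
      · obtain rfl := isId_pipow.1 h5
        rw [P.pipow_zero, P.comp_id] at h4
        rw [P.pipow_zero, P.id_comp, h4]
        simp
    · obtain ⟨c, rfl⟩ := hH h
      rw [← P.assoc α, ← P.assoc] at e'
      exact absurd (cancel_right e' h3) (hy _ _)
  · refine hR.no_star_two_two (by simp) (by simp) (by simp) (by simp) (by simp) hxa hay hxa hμ ht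
      ht hα.isIrreducibleOn h1 (e₂ ▸ S.pipow_ne_zero hn) h0
      (S.comp_pipow_ne_zero (d := 1) (by omega)) (arr_ne_of_right hay _ _)
      (arr_ne_of_left hxa.symm _ _) (S.ne_of_ne_zero h0) (arr_ne_of_left hxa.symm _ _)
      (S.onlyFactors_pi_comp hH) ?_ (S.onlyFactors_comp h0 hH) (S.onlyFactors_comp_pi hH)
    rw [e₂]
    refine S.onlyFactors_pow hn (by omega) (fun g h e => hx ?_) fun p q h h1 h2 => ?_
    · obtain ⟨m, c, rfl, h4, h5⟩ := S.exists_eq hn e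
      have h8 : 1 * 2 ≤ c * j := Nat.mul_le_mul h5 hj
      obtain rfl : m = 0 := by omega
      exact ⟨h, by rw [e, P.pipow_zero, P.id_comp]⟩
    · obtain rfl : p = 1 := by omega
      obtain rfl : q = 1 := by omega
      simp [pipow_one]

end Steep

theorem Cfg.pi_comp_gen_ne_zero {x y a b : P.Obj} {α : P.Hom a y} {β : P.Hom b y} {v : P.Hom x a}
    {w : P.Hom x b} (C : Cfg α β v w) {f : P.Hom x y} (hf : P.Gen f) :
    P.pi y ⊚ f ≠ P.zero x y := by
  have := C.ne_zero
  obtain ⟨p, q, e⟩ := hf.exists_eq (α ⊚ v)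
  rw [e, ← pipow_one, pipow_comp, Nat.add_comm, ← pipow_comp, pipow_one, ← P.assoc (P.pi y)] at this
  exact ne_zero_left (ne_zero_right this)

theorem Cfg.false_of_two_le {x y a b : P.Obj} {α : P.Hom a y} {β : P.Hom b y} {v : P.Hom x a}
    {w : P.Hom x b} (C : Cfg α β v w) (hα : P.RGen α) {i : ℕ} (hi : 2 ≤ i)
    (hc : P.pi y ⊚ α = α ⊚ P.pipow a i) : False := by
  obtain ⟨hxa, μ, j, hμ0, hl, hj, hμ⟩ := C.exists_left_gen hi hc
  obtain ⟨k, rfl⟩ := hl v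
  have hV : P.pi y ⊚ α ⊚ P.pipow a k ⊚ μ = α ⊚ P.pipow a (i + k) ⊚ μ := by
    rw [← P.assoc, hc, P.assoc, pipow_comp]
  have S : Steep α μ i j (i + k) := ⟨hxa, C.hay, hα, hl, hi, hj, by omega, hc, hμ, hV ▸ C.ne_zero,
    C.comp_eq_pipow⟩
  have hR : RepFinOn {x, a, y} (α ⊚ P.pipow a (i + k) ⊚ μ) := by
    rw [← hV]
    refine C.repFinOn (by simp) (by simp) ?_
    intro z
    simp only [Set.mem_insert_iff, Set.mem_singleton_iff]
    tauto
  obtain ⟨z, hz, hza, ζ, k', l, hζ, e⟩ := exists_last_irreducibleOn (D := {x, a, y}) (by simp)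
    (by simp) (by simp) hxa (ne_zero_right C.comp_ne_zero)
  by_cases hzy : z = y
  · subst hzy
    exact S.false_of_isIrreducibleOn C.irrα hR (fun _ => C.pi_comp_gen_ne_zero) C.pi_ne_zero hζ
  have hzx : z = x := by
    rcases hz with h | h | h
    · exact h
    · exact absurd h hza
    · exact absurd h hzy
  subst hzx
  have hμi : P.IsIrreducibleOn {z, a, y} μ := by
    obtain ⟨m, rfl⟩ := hl ζ
    obtain rfl := isId_pipow.1 ((hζ.2.2 a (by simp) _ _ rfl).resolve_right (not_isId hxa μ))
    rwa [P.pipow_zero, P.id_comp] at hζ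
  have hH : ∀ h : P.Hom z y, ∃ c, h = α ⊚ P.pipow a c ⊚ μ := by
    obtain ⟨φ, hφ⟩ := exists_gen C.comp_ne_zero
    by_cases hφi : P.IsIrreducibleOn {z, a, y} φ
    · exact (hR.no_cycle_four (by simp) (by simp) (by simp) (by simp) hxa C.hay.symm hφi hμi
        C.irrα.isIrreducibleOn (S.isIrreducibleOn_pi (Set.Subset.refl _))).elim
    have : ∃ (g : P.Hom a y) (h : P.Hom z a), φ = g ⊚ h := by
      by_contra! h
      refine hφi (hφ.isIrreducibleOn hzy ?_)
      rintro u (rfl | rfl | rfl) h1 h2 g k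
      · exact absurd rfl h1
      · exact h g k
      · exact absurd rfl h2
    obtain ⟨g, f, rfl⟩ := this
    obtain ⟨c, rfl⟩ := hα g
    obtain ⟨m, rfl⟩ := hl f
    intro h
    obtain ⟨p, q, rfl⟩ := hφ.exists_eq h
    refine ⟨p * i + (c + (m + q * j)), ?_⟩
    rw [P.assoc, P.assoc, P.assoc, comp_pipow_eq hμ, ← P.assoc, pipow_comp_eq hc, P.assoc]
    simp only [pipow_comp]
  by_cases h0 : α ⊚ μ = P.zero z y
  · refine S.false_of_comp_eq_zero C.irrα hR hμi h0 ?_ hH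
    obtain _ | k := k
    · have := C.comp_ne_zero
      rw [P.pipow_zero, P.id_comp] at this
      exact absurd h0 this
    · omega
  · exact S.false_of_comp_ne_zero C.irrα hR hzy hμi h0 hH

end RayCategory

namespace RayCategory

local infixr:80 "⊚" => RayCategory.comp _

variable {P : RayCategory} {D : Set P.Obj}

theorem Linked.pipow {y : P.Obj} {i j : ℕ} (hi : 1 ≤ i) (hj : 1 ≤ j) :
    Linked (P.pipow y i) (P.pipow y j) (P.pi y) (P.pipow y (i + j - 1)) := by
  refine (Linked.of_eq (P.pipow y (i - 1)) (not_isId_pi y) (fun h => ?_) ?_ ?_).symm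
  · have := isId_pipow.1 h
    omega
  · rw [← pipow_add]
    congr 1
    omega
  · rw [← pipow_one, ← pipow_add]
    congr 1
    omega

namespace Cfg

theorem lgen {x y a b : P.Obj} {α : P.Hom a y} {β : P.Hom b y} {v : P.Hom x a}
    {w : P.Hom x b} (C : Cfg α β v w) : P.LGen α := by
  by_contra hl
  have hr := (C.irrα.gen C.hay).resolve_left hl
  obtain ⟨i, hi⟩ := hr (P.pi y ⊚ α)
  obtain _ | _ | i := i
  · rw [P.pipow_zero, P.comp_id] at hi
    have := left_loop (i := 1) C.irrα.1 hi.symm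
    omega
  · refine hl fun f => ?_
    obtain ⟨n, rfl⟩ := hr f
    exact ⟨n, by rw [pipow_comp_eq hi, Nat.zero_add, Nat.mul_one]⟩
  · exact C.false_of_two_le hr (by omega) hi

theorem exists_comp_pi_eq {x y a b : P.Obj} {α : P.Hom a y} {β : P.Hom b y} {v : P.Hom x a}
    {w : P.Hom x b} (C : Cfg α β v w) : ∃ s, 1 ≤ s ∧ α ⊚ P.pi a = P.pipow y s ⊚ α := by
  obtain ⟨s, hs⟩ := C.lgen (α ⊚ P.pi a)
  refine ⟨s, Nat.pos_of_ne_zero ?_, hs⟩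
  rintro rfl
  rw [P.pipow_zero, P.id_comp] at hs
  have := right_loop (j := 1) C.irrα.1 hs.symm
  omega

/-- `π(y)` does not factor through `a` -/
theorem pi_ne_comp {x y a b : P.Obj} {α : P.Hom a y} {β : P.Hom b y} {v : P.Hom x a}
    {w : P.Hom x b} (C : Cfg α β v w) (g : P.Hom a y) (h : P.Hom y a) : P.pi y ≠ g ⊚ h := by
  intro e
  obtain ⟨p, rfl⟩ := C.lgen g
  obtain ⟨n, hn, hg⟩ := C.comp_eq_pipow h
  rw [P.assoc, hg, ← pipow_add] at e
  have := pipow_inj e C.pi_ne_zero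
  omega

/-- a morphism `a → b` maps `β` to a proper multiple of `α` -/
theorem exists_comp_eq {x y a b : P.Obj} {α : P.Hom a y} {β : P.Hom b y} {v : P.Hom x a}
    {w : P.Hom x b} (C : Cfg α β v w) (δ : P.Hom a b) : ∃ c, 1 ≤ c ∧ β ⊚ δ = P.pipow y c ⊚ α := by
  obtain ⟨c, hc⟩ := C.lgen (β ⊚ δ)
  refine ⟨c, Nat.pos_of_ne_zero ?_, hc⟩
  rintro rfl
  rw [P.pipow_zero, P.id_comp] at hc
  exact (C.irrα.2.2 _ _ _ hc.symm).elim C.irrβ.2.1 (not_isId C.hab δ)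

section Loop

variable {y a b : P.Obj} {α : P.Hom a y} {β : P.Hom b y} {v : P.Hom y a} {w : P.Hom y b}

theorem gen_or_linked (C : Cfg α β v w) {m : ℕ} (hm : α ⊚ v = P.pipow y m) :
    P.Gen v ∨ Linked α v (P.pi y) (P.pipow y (m - 1)) := by
  obtain ⟨s, hs, hα⟩ := C.exists_comp_pi_eq
  obtain ⟨ζ, hζ⟩ := exists_gen (ne_zero_right C.comp_ne_zero)
  obtain ⟨p, q, rfl⟩ := hζ.exists_eq v
  obtain ⟨e, he, h⟩ := C.comp_eq_pipow ζ
  have h1 : α ⊚ P.pipow a p ⊚ ζ = P.pipow y (p * s + e) := by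
    rw [← P.assoc, comp_pipow_eq hα, P.assoc, h, ← pipow_add]
  have h2 : p * s + e + q = m := by
    rw [← P.assoc (P.pipow a p), ← P.assoc α, h1, ← pipow_add] at hm
    refine pipow_inj hm (fun h' => C.comp_ne_zero ?_)
    rw [← P.assoc (P.pipow a p), ← P.assoc α, h1, ← pipow_add, h']
  rcases Nat.eq_zero_or_pos q with rfl | hq
  · rcases Nat.eq_zero_or_pos p with rfl | hp
    · left
      simpa only [P.pipow_zero, P.id_comp, P.comp_id] using hζ
    · right
      have h3 : 1 * 1 ≤ p * s := Nat.mul_le_mul hp hs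
      have h4 := Linked.pipow (y := y) h3 (show 1 ≤ e by omega)
      rw [P.pipow_zero, P.comp_id, ← h2]
      refine (Linked.of_eq (P.pipow a p) C.irrα.2.1 (not_isId C.hay.symm ζ) rfl rfl).trans
        (Linked.trans ?_ h4)
      rw [comp_pipow_eq hα]
      exact (Linked.of_eq α (fun h => by have := isId_pipow.1 h; omega)
        (not_isId C.hay.symm ζ) h.symm rfl).symm
  · right
    rw [← h2]
    refine Linked.trans (Linked.of_eq _ C.irrα.2.1 (fun h => ?_) (P.assoc _ _ _).symm h1.symm)
      (Linked.pipow (by omega) hq)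
    have := isId_pipow.1 h
    omega

theorem false_of_gen (C : Cfg α β v w) (hw : P.Gen w) : False := by
  obtain ⟨m, hm, h⟩ := C.symm.comp_eq_pipow w
  obtain ⟨s, hs, hα⟩ := C.exists_comp_pi_eq
  obtain ⟨s', hs', hβ⟩ := C.symm.exists_comp_pi_eq
  have h' := C.eq.trans h
  have hm0 : P.pipow y m ≠ P.zero _ _ := h' ▸ C.comp_ne_zero
  obtain ⟨ζ, hζ⟩ := exists_gen (ne_zero_right C.comp_ne_zero)
  obtain ⟨e, he, h1⟩ := C.comp_eq_pipow ζ
  have hem : e ≤ m := by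
    obtain ⟨p, q, hv⟩ := hζ.exists_eq v
    rw [hv, ← P.assoc, comp_pipow_eq hα, P.assoc, ← P.assoc α, h1, ← pipow_add, ← pipow_add] at h'
    have := pipow_inj h' (h' ▸ hm0)
    omega
  have he0 : P.pipow y e ≠ P.zero _ _ := by
    intro h0
    apply hm0
    rw [← Nat.sub_add_cancel hem, pipow_add, h0, P.comp_zero]
  have hw' : ∀ ξ : P.Hom y b, ∃ n, m ≤ n ∧ β ⊚ ξ = P.pipow y n := by
    intro ξ
    obtain ⟨p, q, rfl⟩ := hw.exists_eq ξ
    refine ⟨p * s' + (m + q), by omega, ?_⟩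
    rw [← P.assoc, comp_pipow_eq hβ, P.assoc, ← P.assoc β, h, ← pipow_add, ← pipow_add]
  set D : Set P.Obj := {a, b, y} with hD
  have hwi : P.IsIrreducibleOn D w := hw.isIrreducibleOn C.hby.symm (by
    rintro z (rfl | rfl | rfl) h2 h3 δ ξ rfl
    · obtain ⟨c, hc, h4⟩ := C.exists_comp_eq δ
      obtain ⟨n, hn, h5⟩ := C.comp_eq_pipow ξ
      have h6 : c + n = m := by
        rw [← P.assoc, h4, P.assoc, h5, ← pipow_add] at h
        exact pipow_inj h (h ▸ hm0)
      have h7 : Linked β (δ ⊚ ξ) (P.pi y) (P.pipow y (m - 1)) := by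
        rw [← h6]
        refine (Linked.of_eq δ C.irrβ.2.1 (not_isId C.hay.symm ξ) rfl h4.symm).trans
          (Linked.trans (Linked.of_eq α (fun h => ?_) (not_isId C.hay.symm ξ) h5.symm rfl).symm
            (Linked.pipow hc (by omega)))
        exact absurd (isId_pipow.1 h) (by omega)
      rcases C.gen_or_linked h' with h8 | h8
      · obtain ⟨p, q, rfl⟩ := h8.exists_eq ξ
        rw [← P.assoc, comp_pipow_eq hα, P.assoc, ← P.assoc α, h', ← pipow_add, ← pipow_add] at h5
        have := pipow_inj h5.symm (fun h0 => hm0 (by rw [← h6, pipow_add, h0, P.comp_zero]))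
        omega
      · exact C.nlinked (h8.trans h7.symm)
    · exact h3 rfl
    · exact h2 rfl)
  have hζi : P.IsIrreducibleOn D ζ := hζ.isIrreducibleOn C.hay.symm (by
    rintro z (rfl | rfl | rfl) h2 h3 δ ξ rfl
    · exact h3 rfl
    · obtain ⟨c, hc, h4⟩ := C.symm.exists_comp_eq δ
      obtain ⟨n, hn, h5⟩ := hw' ξ
      rw [← P.assoc, h4, P.assoc, h5, ← pipow_add] at h1
      have := pipow_inj h1 (h1 ▸ he0)
      omega
    · exact h2 rfl)
  have hρi : P.IsIrreducibleOn D (P.pi y) := by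
    refine isIrreducibleOn_pi C.pi_ne_zero ?_
    rintro z (rfl | rfl | rfl) h2 g k
    · exact C.pi_ne_comp g k
    · exact C.symm.pi_ne_comp g k
    · exact absurd rfl h2
  have hR : RepFinOn D (P.pi y ⊚ α ⊚ v) := C.repFinOn (by simp [hD]) (by simp [hD]) (by
    intro z
    simp only [hD, Set.mem_insert_iff, Set.mem_singleton_iff]
    tauto)
  exact hR.no_three_in_three_out (s₁ := a) (s₂ := b) (s₃ := y) (t₁ := y) (t₂ := a) (t₃ := b)
    (by simp [hD]) (by simp [hD]) (by simp [hD]) (by simp [hD]) (by simp [hD]) (by simp [hD])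
    C.hab C.hay C.hby C.hay.symm C.hby.symm C.hab C.irrα.isIrreducibleOn C.irrβ.isIrreducibleOn
    hρi hζi hwi

theorem false_of_loop (C : Cfg α β v w) : False := by
  obtain ⟨m, hm, h⟩ := C.comp_eq_pipow v
  rcases C.gen_or_linked h with h1 | h1
  · exact C.symm.false_of_gen h1
  rcases C.symm.gen_or_linked (C.eq.symm.trans h) with h2 | h2
  · exact C.false_of_gen h2
  exact C.nlinked (h1.trans h2.symm)

end Loop

end Cfg

end RayCategory

namespace RayCategory

local infixr:80 "⊚" => RayCategory.comp _

variable {P : RayCategory} {D : Set P.Obj}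

theorem Gen.eq_zero_of_eq {x y : P.Obj} {f : P.Hom x y} (hf : P.Gen f) {p q : ℕ} {g : P.Hom x y}
    (e : f = P.pipow y p ⊚ g ⊚ P.pipow x q) : p = 0 ∧ q = 0 := by
  obtain ⟨i, j, rfl⟩ := hf.exists_eq g
  simp only [P.assoc, pipow_comp, ← pipow_add] at e
  have := eq_of_loop hf.1 e
  omega

theorem Gen.eq_zero_of_eq_left {x y : P.Obj} {f : P.Hom x y} (hf : P.Gen f) {p : ℕ} {g : P.Hom x y}
    (e : f = P.pipow y p ⊚ g) : p = 0 :=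
  (hf.eq_zero_of_eq (q := 0) (by rwa [P.pipow_zero, P.comp_id])).1

theorem Gen.eq_zero_of_eq_right {x y : P.Obj} {f : P.Hom x y} (hf : P.Gen f) {q : ℕ}
    {g : P.Hom x y} (e : f = g ⊚ P.pipow x q) : q = 0 :=
  (hf.eq_zero_of_eq (p := 0) (by rwa [P.pipow_zero, P.id_comp])).2

namespace Cfg

variable {x y a b : P.Obj} {α : P.Hom a y} {β : P.Hom b y} {v : P.Hom x a} {w : P.Hom x b}

/-- a nonidentity followed by a nonidentity is a proper multiple of `α` -/
theorem exists_comp_eq_of_ne (C : Cfg α β v w) {z : P.Obj} (hzy : z ≠ y) (hza : a ≠ z)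
    (φ : P.Hom z y) (g : P.Hom a z) : ∃ c, 1 ≤ c ∧ φ ⊚ g = P.pipow y c ⊚ α := by
  obtain ⟨c, hc⟩ := C.lgen (φ ⊚ g)
  refine ⟨c, Nat.pos_of_ne_zero ?_, hc⟩
  rintro rfl
  rw [P.pipow_zero, P.id_comp] at hc
  exact (C.irrα.2.2 _ _ _ hc.symm).elim (not_isId hzy φ) (not_isId hza g)

theorem exists_comp_of_gen (C : Cfg α β v w) {φ : P.Hom x y} (hφ : P.Gen φ) {g : P.Hom a y}
    {h : P.Hom x a} (e : φ = g ⊚ h) : φ = α ⊚ h := by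
  obtain ⟨p, rfl⟩ := C.lgen g
  rw [P.assoc] at e
  obtain rfl := hφ.eq_zero_of_eq_left e
  rwa [P.pipow_zero, P.id_comp] at e

theorem ne_of_gen (C : Cfg α β v w) {φ : P.Hom x y} (hφ : P.Gen φ)
    (hα : ∀ h : P.Hom x a, φ ≠ α ⊚ h) : x ≠ a := by
  rintro rfl
  exact hα _ (C.exists_comp_of_gen hφ (P.comp_id φ).symm)

theorem onlyFactors_star (C : Cfg α β v w) {φ : P.Hom x y} {η : P.Hom y x} (hxy : x ≠ y)
    (hxa : x ≠ a) (hxb : x ≠ b) (hη : P.Gen η) (e : P.pi y = φ ⊚ η) (e' : η ⊚ φ = P.pi x) :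
    η ⊚ α ≠ P.zero a x ∧ OnlyFactors {x, a, b, y} (η ⊚ α) [(arr η, arr α)] := by
  have h1 : P.pi y ⊚ α = φ ⊚ η ⊚ α := by rw [e, P.assoc]
  have h0 := C.pi_comp_ne_zero
  have h2 : η ⊚ α ≠ P.zero a x := ne_zero_right (h1 ▸ h0)
  refine ⟨h2, ?_⟩
  have key : ∀ n, P.pi y ⊚ α = P.pipow y n ⊚ α → n = 1 := fun n h =>
    (left_pow_inj (i := 1) h h0).symm
  rintro z (rfl | rfl | rfl | rfl) g h e₁
  · obtain ⟨i, rfl⟩ := P.endo_cyclic _ g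
    obtain _ | i := i
    · exact Or.inl (isId_pipow.2 rfl)
    · rw [P.pipow_succ, pipow_one, ← e', P.assoc, P.assoc] at e₁
      rcases C.irrα.2.2 _ _ _ (cancel_left e₁ h2) with h3 | h3
      · exact absurd h3 (not_isId hxy φ)
      · exact absurd h3 (not_isId hxa.symm _)
  · obtain ⟨q, rfl⟩ := P.endo_cyclic _ h
    obtain ⟨c, hc, h3⟩ := C.exists_comp_eq_of_ne hxy hxa.symm φ g
    obtain ⟨s, hs, h4⟩ := C.exists_comp_pi_eq
    rw [e₁, ← P.assoc, h3, P.assoc, comp_pipow_eq h4, pipow_comp] at h1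
    have h5 := key _ h1
    rcases Nat.eq_zero_or_pos q with rfl | hq
    · exact Or.inr (Or.inl (isId_pipow.2 rfl))
    · have : 1 * 1 ≤ q * s := Nat.mul_le_mul hq hs
      omega
  · obtain ⟨c, hc, h3⟩ := C.symm.exists_comp_eq_of_ne hxy hxb.symm φ g
    obtain ⟨d, hd, h4⟩ := C.exists_comp_eq h
    rw [e₁, ← P.assoc, h3, P.assoc, h4, pipow_comp] at h1
    have := key _ h1
    omega
  · obtain ⟨j, rfl⟩ := C.lgen h
    rw [← P.assoc] at e₁
    have h3 := cancel_right e₁ h2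
    obtain rfl := hη.eq_zero_of_eq_right h3
    rw [P.pipow_zero, P.comp_id] at h3
    rw [P.pipow_zero, P.id_comp, h3]
    simp

/-- a generator of `P(x, y)` factors through `α` or `β` -/
theorem exists_gen_eq (C : Cfg α β v w) (hxy : x ≠ y) {φ : P.Hom x y} (hφ : P.Gen φ) :
    (∃ μ, φ = α ⊚ μ) ∨ ∃ ν, φ = β ⊚ ν := by
  by_contra! hc
  obtain ⟨hα, hβ⟩ := hc
  have hxa := C.ne_of_gen hφ hα
  have hxb := C.symm.ne_of_gen hφ hβ
  set D : Set P.Obj := {x, a, b, y} with hD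
  have hx : x ∈ D := by simp [hD]
  have ha : a ∈ D := by simp [hD]
  have hb : b ∈ D := by simp [hD]
  have hy : y ∈ D := by simp [hD]
  have hR : RepFinOn D (P.pi y ⊚ α ⊚ v) := C.repFinOn hx hy (Set.Subset.refl _)
  have hφi : P.IsIrreducibleOn D φ := hφ.isIrreducibleOn hxy (by
    rintro z (rfl | rfl | rfl | rfl) h2 h3 g h e
    · exact h2 rfl
    · exact hα _ (C.exists_comp_of_gen hφ e)
    · exact hβ _ (C.symm.exists_comp_of_gen hφ e)
    · exact h3 rfl)
  by_cases hρ : P.IsIrreducibleOn D (P.pi y)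
  · exact hR.no_four_in ha hb hx hy hy C.hab hxa.symm C.hay hxb.symm C.hby hxy
      C.irrα.isIrreducibleOn C.irrβ.isIrreducibleOn hφi hρ
  obtain ⟨z, hz, hzy, g, k, e⟩ := exists_eq_of_not_isIrreducibleOn C.pi_ne_zero hρ
  rcases hz with rfl | rfl | rfl | rfl
  rotate_left
  · exact C.pi_ne_comp g k e
  · exact C.symm.pi_ne_comp g k e
  · exact hzy rfl
  have hρφ := C.pi_comp_gen_ne_zero hφ
  obtain ⟨η, hη, e'⟩ := hφ.exists_pi_eq hxy hρφ e
  have hηφ : η ⊚ φ = P.pi z := by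
    obtain ⟨c, hc⟩ := P.endo_cyclic _ (η ⊚ φ)
    have h1 : P.pi y ⊚ φ = φ ⊚ P.pipow z c := by rw [e', P.assoc, hc]
    obtain ⟨p, q, h2⟩ := hφ.exists_eq (α ⊚ v)
    rw [← P.assoc, pipow_comp_eq h1, comp_pipow] at h2
    rw [hc, C.eq_one_of_comp_pipow_eq (n := c) ?_, pipow_one]
    rw [h2, comp_pipow, ← P.assoc, h1, comp_pipow, Nat.add_comm]
  have hρφ' : P.pi y ⊚ φ = φ ⊚ P.pi z := by rw [e', P.assoc, hηφ]
  have hσ0 : P.pi z ≠ P.zero z z := ne_zero_right (hρφ' ▸ hρφ)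
  have hηi : P.IsIrreducibleOn D η := hη.isIrreducibleOn hxy.symm (by
    rintro u (rfl | rfl | rfl | rfl) h2 h3 g h rfl
    · exact h3 rfl
    · rw [← P.assoc] at e'
      exact C.pi_ne_comp _ _ e'
    · rw [← P.assoc] at e'
      exact C.symm.pi_ne_comp _ _ e'
    · exact h2 rfl)
  obtain ⟨h1, o1⟩ := C.onlyFactors_star hxy hxa hxb hη e' hηφ
  obtain ⟨h2, o2⟩ := C.symm.onlyFactors_star hxy hxb hxa hη e' hηφ
  have hD' : ({z, b, a, y} : Set P.Obj) = D := by
    rw [hD, Set.insert_comm b a]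
  rw [hD'] at o2
  refine hR.no_star_three_one ha hb hx hy hx C.hab hxa.symm hxb.symm C.hay C.irrα.isIrreducibleOn
    C.irrβ.isIrreducibleOn hφi hηi h1 h2 (hηφ ▸ hσ0) (arr_ne_of_right hxy _ _)
    (arr_ne_of_right hxy _ _) (arr_ne_of_right hxy _ _) o1 o2 ?_
  rw [hηφ]
  have key : ∀ {a b : P.Obj} {α : P.Hom a y} {β : P.Hom b y} {v : P.Hom z a} {w : P.Hom z b}
      (C : Cfg α β v w), z ≠ a → (∀ h, φ ≠ α ⊚ h) → ∀ (g : P.Hom a z) (h : P.Hom z a),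
      P.pi z ≠ g ⊚ h := by
    intro a b α β v w C hza hα g h e₁
    obtain ⟨c, hc, h3⟩ := C.exists_comp_eq_of_ne hxy hza.symm φ g
    obtain ⟨d, rfl⟩ := Nat.exists_eq_add_of_le hc
    rw [e₁, ← P.assoc, h3, pipow_add, P.assoc, P.assoc, pipow_one] at hρφ'
    have h4 := cancel_left hρφ' hρφ
    obtain rfl := hφ.eq_zero_of_eq_left h4
    rw [P.pipow_zero, P.id_comp] at h4
    exact hα _ h4
  rintro u (rfl | rfl | rfl | rfl) g h e₁
  · obtain ⟨p, rfl⟩ := P.endo_cyclic _ g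
    obtain ⟨q, rfl⟩ := P.endo_cyclic _ h
    rw [← pipow_add] at e₁
    have := pipow_inj e₁ hσ0
    rw [isId_pipow, isId_pipow]
    omega
  · exact absurd e₁ (key C hxa hα g h)
  · exact absurd e₁ (key C.symm hxb hβ g h)
  · obtain ⟨rfl, rfl⟩ := hη.eq_of_comp_eq_pi hxy.symm hφ hσ0 hηφ.symm e₁
    simp

end Cfg

end RayCategory

namespace RayCategory

local infixr:80 "⊚" => RayCategory.comp _

variable {P : RayCategory} {D : Set P.Obj}

theorem Gen.exists_eq_comp_of_pi_eq {x b : P.Obj} (hxb : x ≠ b) {w : P.Hom x b} (hw : P.Gen w)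
    (h0 : P.pi x ≠ P.zero x x) {g : P.Hom b x} {h : P.Hom x b} (e : P.pi x = g ⊚ h) :
    ∃ ξ, P.pi x = ξ ⊚ w := by
  obtain ⟨p, q, rfl⟩ := hw.exists_eq h
  obtain ⟨i, hi⟩ := P.endo_cyclic _ (g ⊚ P.pipow b p ⊚ w)
  have e' : P.pi x = (g ⊚ P.pipow b p ⊚ w) ⊚ P.pipow x q := by
    rw [e, P.assoc, P.assoc]
  rw [hi, ← pipow_add] at e'
  have h1 := pipow_inj (i := 1) e' h0
  have h2 : i ≠ 0 := by
    rintro rfl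
    exact not_isId hxb w (isId_of_comp_isId
      (isId_of_comp_isId (isId_pipow.2 rfl |> (hi ▸ ·))).2).2
  refine ⟨g ⊚ P.pipow b p, ?_⟩
  rw [P.assoc, hi, ← pipow_one]
  congr 1
  omega

/-- the cotransit situation, with an explicit generator of `P(x, y)` -/
structure Cot {x y a b : P.Obj} (α : P.Hom a y) (β : P.Hom b y) (v : P.Hom x a) (w : P.Hom x b)
    (μ : P.Hom x a) (k : ℕ) : Prop extends Cfg α β v w where
  hxy : x ≠ y
  gen : P.Gen (α ⊚ μ)
  comm : P.pi y ⊚ α ⊚ μ = (α ⊚ μ) ⊚ P.pi x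
  v_eq : v = μ ⊚ P.pipow x k

theorem Cfg.exists_cot {x y a b : P.Obj} {α : P.Hom a y} {β : P.Hom b y} {v : P.Hom x a}
    {w : P.Hom x b} (C : Cfg α β v w) (hxy : x ≠ y)
    (hc : P.pi y ⊚ α ⊚ v = (α ⊚ v) ⊚ P.pi x) {μ : P.Hom x a} (hφ : P.Gen (α ⊚ μ)) :
    ∃ k, Cot α β v w μ k := by
  obtain ⟨p, q, e⟩ := hφ.exists_eq (α ⊚ v)
  have comm : P.pi y ⊚ α ⊚ μ = (α ⊚ μ) ⊚ P.pi x := by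
    refine P.cancel (P.pipow x q) _ _ (P.pipow y p) ?_ ?_
    · have h1 := hc
      rw [e] at h1
      simp only [P.assoc, ← pipow_one, pipow_comp, ← pipow_add] at h1 ⊢
      rw [Nat.add_comm p, h1, Nat.add_comm q]
    · have h1 := C.ne_zero
      rw [e] at h1
      simp only [P.assoc, ← pipow_one, pipow_comp] at h1 ⊢
      rwa [Nat.add_comm p]
  refine ⟨p + q, C, hxy, hφ, comm, ?_⟩
  have h1 := pipow_comp_eq (i := 1) comm
  rw [← P.assoc, h1, Nat.mul_one, comp_pipow, P.assoc] at e
  exact cancel_left e C.comp_ne_zero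

namespace Cot

variable {x y a b : P.Obj} {α : P.Hom a y} {β : P.Hom b y} {v : P.Hom x a} {w : P.Hom x b}
  {μ : P.Hom x a} {k : ℕ}

theorem pow_comm (C : Cot α β v w μ k) (n : ℕ) :
    P.pipow y n ⊚ α ⊚ μ = (α ⊚ μ) ⊚ P.pipow x n := by
  rw [pipow_comp_eq (i := 1) C.comm, Nat.mul_one]

theorem exists_eq_right (C : Cot α β v w μ k) (g : P.Hom x y) :
    ∃ n, g = (α ⊚ μ) ⊚ P.pipow x n := by
  obtain ⟨p, q, e⟩ := C.gen.exists_eq g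
  exact ⟨p + q, by rw [e, ← P.assoc, C.pow_comm, comp_pipow]⟩

theorem exists_eq_left (C : Cot α β v w μ k) (g : P.Hom x y) :
    ∃ n, g = P.pipow y n ⊚ α ⊚ μ := by
  obtain ⟨n, e⟩ := C.exists_eq_right g
  exact ⟨n, by rw [e, C.pow_comm]⟩

theorem comp_eq (C : Cot α β v w μ k) : α ⊚ v = (α ⊚ μ) ⊚ P.pipow x k := by
  rw [C.v_eq, P.assoc]

theorem comp_eq_right (C : Cot α β v w μ k) : β ⊚ w = (α ⊚ μ) ⊚ P.pipow x k := by
  rw [← C.eq, C.comp_eq]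

theorem comp_ne_zero' (C : Cot α β v w μ k) : β ⊚ w ≠ P.zero x y :=
  C.toCfg.symm.comp_ne_zero

theorem pi_ne_zero' (C : Cot α β v w μ k) : P.pi x ≠ P.zero x x := by
  intro h
  have h1 := C.ne_zero
  rw [C.comp_eq, ← P.assoc, C.comm, P.assoc, h, P.zero_comp, P.comp_zero] at h1
  exact h1 rfl

theorem gen_right (C : Cot α β v w μ k) : P.Gen w := by
  obtain ⟨ν, hν⟩ := exists_gen (ne_zero_right C.comp_ne_zero')
  obtain ⟨p, q, e⟩ := hν.exists_eq w
  obtain ⟨s, hs, h1⟩ := C.toCfg.symm.exists_comp_pi_eq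
  obtain ⟨d, hd⟩ := C.exists_eq_right (β ⊚ ν)
  have h2 : w = ν ⊚ P.pipow x (p * s + q) := by
    have h3 : β ⊚ w = β ⊚ ν ⊚ P.pipow x (p * s + q) := by
      rw [e, ← P.assoc, comp_pipow_eq h1, P.assoc, ← P.assoc β, hd, ← P.assoc (P.pipow y _),
        ← P.assoc (P.pipow y _), C.pow_comm, comp_pipow, comp_pipow, ← P.assoc β, hd, comp_pipow]
      congr 2
      omega
    exact cancel_left h3 C.comp_ne_zero'
  generalize hn : p * s + q = n at h2
  rcases Nat.eq_zero_or_pos n with rfl | hn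
  · rw [P.pipow_zero, P.comp_id] at h2
    rwa [h2]
  have hk : k = d + n := by
    refine right_pow_inj (f := α ⊚ μ) ?_ (C.comp_eq_right ▸ C.comp_ne_zero')
    rw [← C.comp_eq_right, h2, ← P.assoc, hd, comp_pipow]
  have hσ : ¬ P.IsId (P.pipow x n) := fun h => by
    have := isId_pipow.1 h
    omega
  refine absurd ?_ C.nlinked
  refine (Linked.of_eq _ C.irrα.2.1 (w := P.pipow x k) (fun h => ?_) C.v_eq rfl).trans
    (Linked.trans (Linked.of_eq (P.pipow x d) (not_isId C.hxy _) hσ ?_ hd)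
      (Linked.of_eq _ C.irrβ.2.1 hσ h2 rfl).symm)
  · have := isId_pipow.1 h
    omega
  · rw [← pipow_add, hk]

theorem ne_right (C : Cot α β v w μ k) : x ≠ b := by
  rintro rfl
  obtain ⟨i, rfl⟩ := P.endo_cyclic _ w
  have := C.gen_right.eq_zero_of_eq_left (P.comp_id _).symm
  exact C.nw (isId_pipow.2 this)

theorem pi_ne_comp_left (C : Cot α β v w μ k) (g : P.Hom x y) (h : P.Hom y x) :
    P.pi y ≠ g ⊚ h := by
  intro e
  obtain ⟨n, rfl⟩ := C.exists_eq_right g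
  rw [P.assoc, P.assoc] at e
  exact C.nα _ e

theorem pi_ne_comp_right (C : Cot α β v w μ k) (g : P.Hom y x) (h : P.Hom x y) :
    P.pi x ≠ g ⊚ h := by
  intro e
  obtain ⟨ξ, hξ⟩ := C.gen.exists_eq_comp_of_pi_eq C.hxy C.pi_ne_zero' e
  refine C.pi_ne_comp_left (α ⊚ μ) ξ ?_
  have h1 := C.comm
  rw [hξ, ← P.assoc (α ⊚ μ) ξ] at h1
  refine cancel_right h1 (ne_zero_left (f := P.pipow x k) ?_)
  rw [P.assoc, ← C.comp_eq]
  exact C.ne_zero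

theorem isIrreducibleOn_pi_right (C : Cot α β v w μ k) (hD : D ⊆ {x, a, b, y}) :
    P.IsIrreducibleOn D (P.pi y) := by
  refine isIrreducibleOn_pi C.pi_ne_zero fun z hz hzy g h => ?_
  rcases hD hz with rfl | rfl | rfl | rfl
  · exact C.pi_ne_comp_left g h
  · exact C.pi_ne_comp g h
  · exact C.toCfg.symm.pi_ne_comp g h
  · exact absurd rfl hzy

theorem exists_of_pos (C : Cot α β v w μ k) (hk : 1 ≤ k) : ∃ ξ, P.pi x = ξ ⊚ w := by
  by_contra! hc
  have hxb := C.ne_right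
  set D : Set P.Obj := {x, b, y} with hD
  have hsub : D ⊆ {x, a, b, y} := by
    intro z
    simp only [hD, Set.mem_insert_iff, Set.mem_singleton_iff]
    tauto
  have hR : RepFinOn D (P.pi y ⊚ α ⊚ v) := C.repFinOn (by simp [hD]) (by simp [hD]) hsub
  have hφ : P.IsIrreducibleOn D (α ⊚ μ) := C.gen.isIrreducibleOn C.hxy (by
    rintro z (rfl | rfl | rfl) h2 h3 g h e
    · exact h2 rfl
    · have e' := C.toCfg.symm.exists_comp_of_gen C.gen e
      have h4 := C.comp_eq_right
      rw [e', P.assoc] at h4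
      have := C.gen_right.eq_zero_of_eq_right (cancel_left h4 C.comp_ne_zero')
      omega
    · exact h3 rfl)
  have hw : P.IsIrreducibleOn D w := C.gen_right.isIrreducibleOn hxb (by
    rintro z (rfl | rfl | rfl) h2 h3 ζ ψ e
    · exact h2 rfl
    · exact h3 rfl
    · obtain ⟨i, rfl⟩ := C.exists_eq_left ψ
      obtain ⟨n, hn, h4⟩ := C.toCfg.symm.comp_eq_pipow ζ
      have h5 : P.pipow z k ⊚ α ⊚ μ = P.pipow z (n + i) ⊚ α ⊚ μ := by
        rw [C.pow_comm, ← C.comp_eq_right, e, ← P.assoc, h4, pipow_comp]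
      have h6 : k = n + i := left_pow_inj h5 (by
        rw [C.pow_comm, ← C.comp_eq_right]
        exact C.comp_ne_zero')
      have hn' : ∀ j, 1 ≤ j → ¬ P.IsId (P.pipow z j) := fun j hj h => by
        have := isId_pipow.1 h
        omega
      have hn'' : ∀ j, 1 ≤ j → ¬ P.IsId (P.pipow x j) := fun j hj h => by
        have := isId_pipow.1 h
        omega
      have l1 : Linked β w (P.pipow z k) (α ⊚ μ) :=
        (Linked.of_eq ζ C.irrβ.2.1 (not_isId C.hxy _) e h4.symm).trans
          (Linked.of_eq (P.pipow z i) (hn' n (by omega)) (not_isId C.hxy _) rfl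
            (by rw [h6, pipow_add]))
      have l2 : Linked α v (α ⊚ μ) (P.pipow x k) :=
        Linked.of_eq μ C.irrα.2.1 (hn'' k hk) C.v_eq rfl
      have l3 : Linked (α ⊚ μ) (P.pipow x k) ((α ⊚ μ) ⊚ P.pi x) (P.pipow x (k - 1)) := by
        refine Linked.of_eq (P.pi x) (not_isId C.hxy _) (hn'' _ (by omega)) ?_ rfl
        rw [← pipow_one, ← pipow_add]
        congr 1
        omega
      have l4 : Linked (P.pi z) (P.pipow z (k - 1) ⊚ α ⊚ μ) ((α ⊚ μ) ⊚ P.pi x)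
          (P.pipow x (k - 1)) :=
        Linked.of_eq _ (not_isId_pi z) (hn'' _ (by omega)) (C.pow_comm _) C.comm.symm
      have l5 : Linked (P.pi z) (P.pipow z (k - 1) ⊚ α ⊚ μ) (P.pipow z k) (α ⊚ μ) := by
        refine Linked.of_eq _ (not_isId_pi z) (not_isId C.hxy _) rfl ?_
        rw [← pipow_one, ← pipow_add]
        congr 1
        omega
      exact C.nlinked (l2.trans (l3.trans (l4.symm.trans (l5.trans l1.symm)))))
  have hσ : P.IsIrreducibleOn D (P.pi x) := by
    refine isIrreducibleOn_pi C.pi_ne_zero' ?_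
    rintro z (rfl | rfl | rfl) h2 g h e
    · exact h2 rfl
    · obtain ⟨ξ, hξ⟩ := C.gen_right.exists_eq_comp_of_pi_eq hxb C.pi_ne_zero' e
      exact hc _ hξ
    · exact C.pi_ne_comp_right g h e
  exact hR.no_three_in_three_out (s₁ := b) (s₂ := y) (s₃ := x) (t₁ := y) (t₂ := b) (t₃ := x)
    (by simp [hD]) (by simp [hD]) (by simp [hD]) (by simp [hD]) (by simp [hD]) (by simp [hD])
    C.hby hxb.symm C.hxy.symm C.hby.symm C.hxy.symm hxb.symm C.irrβ.isIrreducibleOn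
    (C.isIrreducibleOn_pi_right hsub) hφ hw hσ

end Cot

end RayCategory

namespace RayCategory

local infixr:80 "⊚" => RayCategory.comp _

variable {P : RayCategory} {D : Set P.Obj}

/-- if no arrow of `D` starts in `B` and ends in `A`, and every point of `D` outside `B` is the
point `x` of `A`, then every morphism from `B` to `A` is zero or an identity -/
theorem isId_of_no_irreducibleOn (hD : D.Finite) {A B : Set P.Obj} (hB : B ⊆ D) (hA : A ⊆ D)
    {x : P.Obj} (hx : x ∈ A) (hBx : x ∉ B) (hDB : ∀ z ∈ D, z ≠ x → z ∈ B)
    (h : ∀ s ∈ B, ∀ t ∈ A, ∀ g : P.Hom s t, ¬ P.IsIrreducibleOn D g) {s t : P.Obj} (hs : s ∈ B)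
    (ht : t ∈ A) {g : P.Hom s t} (hg : g ≠ P.zero s t) : P.IsId g := by
  have ne : ∀ {s t : P.Obj}, s ∈ B → t ∈ A → s ≠ t → ∀ g : P.Hom s t, g = P.zero s t := by
    intro s t hs ht hst g
    by_contra hg
    obtain ⟨z, hz, hzt, k, l, n, hk, e⟩ := exists_last_irreducibleOn hD (hB hs) (hA ht) hst hg
    by_cases hzx : z = x
    · subst hzx
      have hl : l ≠ P.zero s z := ne_zero_right (ne_zero_right (e ▸ hg))
      obtain ⟨z', hz', hzx', k', l', n', hk', e'⟩ := exists_last_irreducibleOn hD (hB hs) (hA hx)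
        (fun h => hBx (h ▸ hs)) hl
      exact h _ (hDB z' hz' hzx') _ hx _ hk'
    · exact h _ (hDB z hz hzx) _ ht _ hk
  by_cases hst : s = t
  · subst hst
    obtain ⟨i, rfl⟩ := P.endo_cyclic _ g
    by_contra hi
    have hi0 : i ≠ 0 := fun h => hi (isId_pipow.2 h)
    obtain ⟨i, rfl⟩ := Nat.exists_eq_succ_of_ne_zero hi0
    have h0 : P.pi s ≠ P.zero s s := by
      rw [P.pipow_succ] at hg
      exact ne_zero_left hg
    obtain ⟨z, hz, hzs, g', k, e⟩ := exists_eq_of_not_isIrreducibleOn h0 (h s hs s ht (P.pi s))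
    by_cases hzx : z = x
    · subst hzx
      exact ne_zero_right (e ▸ h0) (ne hs hx (fun h => hBx (h ▸ hs)) k)
    · exact ne_zero_left (e ▸ h0) (ne (hDB z hz hzx) ht hzs g')
  · exact absurd (ne hs ht hst g) hg

namespace Cot

variable {x y a b : P.Obj} {α : P.Hom a y} {β : P.Hom b y} {v : P.Hom x a} {w : P.Hom x b}
  {μ : P.Hom x a}

theorem eq_of_zero (C : Cot α β v w μ 0) : v = μ := by
  rw [C.v_eq, P.pipow_zero, P.comp_id]

theorem symm (C : Cot α β v w μ 0) : Cot β α w v w 0 := by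
  have h : α ⊚ μ = β ⊚ w := by rw [← C.eq, C.eq_of_zero]
  exact ⟨C.toCfg.symm, C.hxy, h ▸ C.gen, h ▸ C.comm, by rw [P.pipow_zero, P.comp_id]⟩

theorem isIrreducibleOn_right (C : Cot α β v w μ 0) : P.IsIrreducibleOn {x, a, b, y} w := by
  refine C.gen_right.isIrreducibleOn C.ne_right ?_
  have hg : P.Gen (β ⊚ w) := C.symm.gen
  rintro z (rfl | rfl | rfl | rfl) h2 h3 g h rfl
  · exact h2 rfl
  · obtain ⟨c, hc, h4⟩ := C.exists_comp_eq g
    rw [← P.assoc, h4, P.assoc] at hg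
    have := hg.eq_zero_of_eq_left rfl
    omega
  · exact h3 rfl
  · obtain ⟨c, hc, h4⟩ := C.toCfg.symm.comp_eq_pipow g
    rw [← P.assoc, h4] at hg
    have := hg.eq_zero_of_eq_left rfl
    omega

theorem exists_of_zero (C : Cot α β v w μ 0) :
    (∃ ξ, P.pi x = ξ ⊚ v) ∨ ∃ ξ, P.pi x = ξ ⊚ w := by
  by_contra! hc
  obtain ⟨hv, hw⟩ := hc
  have hxa := C.symm.ne_right
  have hxb := C.ne_right
  set D : Set P.Obj := {x, a, b, y} with hD
  have hx : x ∈ D := by simp [hD]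
  have ha : a ∈ D := by simp [hD]
  have hb : b ∈ D := by simp [hD]
  have hy : y ∈ D := by simp [hD]
  have hfin : D.Finite := by simp [hD]
  have hR : RepFinOn D (P.pi y ⊚ α ⊚ v) := C.repFinOn hx hy (Set.Subset.refl _)
  have hwi := C.isIrreducibleOn_right
  have hvi := C.symm.isIrreducibleOn_right
  have hD' : ({x, b, a, y} : Set P.Obj) = D := by rw [hD, Set.insert_comm b a]
  rw [hD'] at hvi
  have hρ := C.isIrreducibleOn_pi_right (Set.Subset.refl _)
  have hσ : P.IsIrreducibleOn D (P.pi x) := by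
    refine isIrreducibleOn_pi C.pi_ne_zero' ?_
    rintro z (rfl | rfl | rfl | rfl) h2 g h e
    · exact h2 rfl
    · obtain ⟨ξ, hξ⟩ := C.symm.gen_right.exists_eq_comp_of_pi_eq hxa C.pi_ne_zero' e
      exact hv _ hξ
    · obtain ⟨ξ, hξ⟩ := C.gen_right.exists_eq_comp_of_pi_eq hxb C.pi_ne_zero' e
      exact hw _ hξ
    · exact C.pi_ne_comp_right g h e
  have ho : ∀ t ∈ ({x, a, b} : Set P.Obj), ∃ g : P.Hom x t, P.IsIrreducibleOn D g := by
    rintro t (rfl | rfl | rfl)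
    exacts [⟨_, hσ⟩, ⟨_, hvi⟩, ⟨_, hwi⟩]
  have hi : ∀ s ∈ ({a, b, y} : Set P.Obj), ∃ g : P.Hom s y, P.IsIrreducibleOn D g := by
    rintro t (rfl | rfl | rfl)
    exacts [⟨_, C.irrα.isIrreducibleOn⟩, ⟨_, C.irrβ.isIrreducibleOn⟩, ⟨_, hρ⟩]
  have hAD : ({x, a, b} : Set P.Obj) ⊆ D := by
    intro z
    simp only [hD, Set.mem_insert_iff, Set.mem_singleton_iff]
    tauto
  have hBD : ({a, b, y} : Set P.Obj) ⊆ D := by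
    intro z
    simp only [hD, Set.mem_insert_iff, Set.mem_singleton_iff]
    tauto
  have hxB : x ∉ ({a, b, y} : Set P.Obj) := by simp [hxa, hxb, C.hxy]
  have hyA : y ∉ ({x, a, b} : Set P.Obj) := by simp [C.hxy.symm, C.hay.symm, C.hby.symm]
  have others : ∀ {p q r : P.Obj}, p ≠ q → p ≠ r → q ≠ r → ∀ u ∈ ({p, q, r} : Set P.Obj),
      ∃ s ∈ ({p, q, r} : Set P.Obj), ∃ t ∈ ({p, q, r} : Set P.Obj), s ≠ t ∧ u ≠ s ∧ u ≠ t := by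
    rintro p q r hpq hpr hqr u (rfl | rfl | rfl)
    exacts [⟨q, by simp, r, by simp, hqr, hpq, hpr⟩, ⟨p, by simp, r, by simp, hpr, hpq.symm, hqr⟩,
      ⟨p, by simp, q, by simp, hpq, hpr.symm, hqr.symm⟩]
  have none : ∀ r ∈ ({a, b, y} : Set P.Obj), ∀ u ∈ ({x, a, b} : Set P.Obj), ∀ g : P.Hom r u,
      ¬ P.IsIrreducibleOn D g := by
    intro r hr u hu g hg
    obtain ⟨s₁, hs₁, s₂, hs₂, hs, hr₁, hr₂⟩ := others C.hab C.hay C.hby r hr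
    obtain ⟨t₁, ht₁, t₂, ht₂, ht, hu₁, hu₂⟩ := others hxa hxb C.hab u hu
    obtain ⟨f₁, hf₁⟩ := ho t₁ ht₁
    obtain ⟨f₂, hf₂⟩ := ho t₂ ht₂
    obtain ⟨f₃, hf₃⟩ := ho u hu
    obtain ⟨k₁, hk₁⟩ := hi s₁ hs₁
    obtain ⟨k₂, hk₂⟩ := hi s₂ hs₂
    obtain ⟨k₃, hk₃⟩ := hi r hr
    exact hR.no_joined_stars hx hy (hBD hr) (hAD hu) (hAD ht₁) (hAD ht₂) (hBD hs₁) (hBD hs₂)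
      hs hr₁ hr₂ ht hu₁ hu₂ (fun h => hxB (h ▸ hr)) (fun h => hyA (h ▸ hu))
      (fun h => hyA (h ▸ ht₁)) hf₁ hf₂ hf₃ hg hk₁ hk₂ hk₃
  have only : ∀ {s : P.Obj} (f : P.Hom s y), s ∈ ({a, b, y} : Set P.Obj) → P.LGen f → s ≠ y →
      P.pi y ⊚ f ≠ P.zero s y → OnlyFactors D (P.pi y ⊚ f) [(arr (P.pi y), arr f)] := by
    intro s f hs hf hsy h0 z hz g h e
    by_cases hzy : z = y
    · subst hzy
      obtain ⟨i, rfl⟩ := P.endo_cyclic _ g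
      obtain ⟨j, rfl⟩ := hf h
      rw [pipow_comp] at e
      have h1 := left_pow_inj (i := 1) e h0
      obtain ⟨rfl, rfl⟩ | ⟨rfl, rfl⟩ : i = 0 ∧ j = 1 ∨ i = 1 ∧ j = 0 := by omega
      · exact Or.inl (isId_pipow.2 rfl)
      · simp [pipow_one, P.pipow_zero, P.id_comp]
    · refine Or.inr (Or.inl (isId_of_no_irreducibleOn hfin hBD hAD (by simp) hxB ?_ none hs ?_ ?_))
      · rintro u (rfl | h) h1
        exacts [absurd rfl h1, h]
      · rcases hz with rfl | rfl | rfl | rfl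
        exacts [by simp, by simp, by simp, absurd rfl hzy]
      · exact ne_zero_right (e ▸ h0)
  exact hR.no_double_star ha hb hy C.hab C.hay C.hby C.irrα.isIrreducibleOn C.irrβ.isIrreducibleOn
    hρ C.pi_comp_ne_zero C.symm.pi_comp_ne_zero (arr_ne_of_left hxa.symm _ _)
    (arr_ne_of_left hxb.symm _ _) (only α (by simp) C.lgen C.hay C.pi_comp_ne_zero)
    (only β (by simp) C.toCfg.symm.lgen C.hby C.symm.pi_comp_ne_zero)

end Cot

/-- the cotransit case -/
theorem Cfg.exists_pi_eq_of_cotransit {x y a b : P.Obj} {α : P.Hom a y} {β : P.Hom b y}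
    {v : P.Hom x a} {w : P.Hom x b} (C : Cfg α β v w) (hxy : x ≠ y)
    (hc : P.pi y ⊚ α ⊚ v = (α ⊚ v) ⊚ P.pi x) : (∃ ξ, P.pi x = ξ ⊚ v) ∨ ∃ ξ, P.pi x = ξ ⊚ w := by
  have key : ∀ {a b : P.Obj} {α : P.Hom a y} {β : P.Hom b y} {v : P.Hom x a} {w : P.Hom x b},
      Cfg α β v w → P.pi y ⊚ α ⊚ v = (α ⊚ v) ⊚ P.pi x → ∀ μ : P.Hom x a, P.Gen (α ⊚ μ) →
      (∃ ξ, P.pi x = ξ ⊚ v) ∨ ∃ ξ, P.pi x = ξ ⊚ w := by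
    intro a b α β v w C hc μ hφ
    obtain ⟨k, hk⟩ := C.exists_cot hxy hc hφ
    rcases Nat.eq_zero_or_pos k with rfl | h
    exacts [hk.exists_of_zero, Or.inr (hk.exists_of_pos h)]
  obtain ⟨φ, hφ⟩ := exists_gen C.comp_ne_zero
  rcases C.exists_gen_eq hxy hφ with ⟨μ, rfl⟩ | ⟨ν, rfl⟩
  · exact key C hc _ hφ
  · rw [C.eq] at hc
    exact (key C.symm hc _ hφ).symm

end RayCategory

namespace RayCategory

local infixr:80 "⊚" => RayCategory.comp _

variable {P : RayCategory} {D : Set P.Obj}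

theorem Cfg.gen_of_gen_comp {x y a b : P.Obj} {α : P.Hom a y} {β : P.Hom b y} {v : P.Hom x a}
    {w : P.Hom x b} (C : Cfg α β v w) {μ : P.Hom x a} (h : P.Gen (α ⊚ μ)) : P.Gen μ := by
  obtain ⟨ζ, hζ⟩ := exists_gen (ne_zero_right h.1)
  obtain ⟨p, q, rfl⟩ := hζ.exists_eq μ
  obtain ⟨s, hs, h1⟩ := C.exists_comp_pi_eq
  have e : α ⊚ P.pipow a p ⊚ ζ ⊚ P.pipow x q = P.pipow y (p * s) ⊚ (α ⊚ ζ) ⊚ P.pipow x q := by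
    rw [← P.assoc, comp_pipow_eq h1, P.assoc, P.assoc]
  obtain ⟨h2, rfl⟩ := h.eq_zero_of_eq e
  obtain rfl : p = 0 := by
    rcases Nat.mul_eq_zero.1 h2 with h3 | h3 <;> omega
  simpa only [P.pipow_zero, P.comp_id, P.id_comp] using hζ

/-- the situation where the morphism `α ⊚ v` is not cotransit, with an explicit generator of
`P(x, y)` -/
structure Ncot {x y a b : P.Obj} (α : P.Hom a y) (β : P.Hom b y) (v : P.Hom x a) (w : P.Hom x b)
    (φ : P.Hom x y) (j : ℕ) : Prop extends Cfg α β v w where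
  hxy : x ≠ y
  gen : P.Gen φ
  left : P.LGen φ
  hj : 2 ≤ j
  shift : φ ⊚ P.pi x = P.pipow y j ⊚ φ

theorem Cfg.exists_ncot {x y a b : P.Obj} {α : P.Hom a y} {β : P.Hom b y} {v : P.Hom x a}
    {w : P.Hom x b} (C : Cfg α β v w) (hxy : x ≠ y)
    (hc : P.pi y ⊚ α ⊚ v ≠ (α ⊚ v) ⊚ P.pi x) : ∃ φ j, Ncot α β v w φ j := by
  obtain ⟨φ, hφ⟩ := exists_gen C.comp_ne_zero
  have hl : P.LGen φ := by
    rcases hφ.2 with h | h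
    · exact h
    obtain ⟨c, hc'⟩ := h (P.pi y ⊚ φ)
    obtain ⟨k, hk⟩ := h (α ⊚ v)
    have h1 : P.pi y ⊚ α ⊚ v = (α ⊚ v) ⊚ P.pipow x c := by
      rw [hk, ← P.assoc, hc', comp_pipow, comp_pipow, Nat.add_comm]
    obtain rfl := C.eq_one_of_comp_pipow_eq h1.symm
    exact absurd h1 hc
  obtain ⟨k, hk⟩ := hl (α ⊚ v)
  refine ⟨φ, ?_⟩
  by_cases h0 : φ ⊚ P.pi x = P.zero x y
  · refine ⟨P.nilp y + 2, C, hxy, hφ, hl, by omega, ?_⟩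
    rw [h0, pipow_add, P.pipow_nilp, P.zero_comp, P.zero_comp]
  obtain ⟨j, hj⟩ := hl (φ ⊚ P.pi x)
  refine ⟨j, C, hxy, hφ, hl, ?_, hj⟩
  by_contra hj2
  obtain rfl | rfl : j = 0 ∨ j = 1 := by omega
  · rw [P.pipow_zero, P.id_comp] at hj
    have := right_loop (j := 1) hφ.1 hj.symm
    omega
  · refine hc ?_
    rw [hk, P.assoc, hj, ← pipow_one, pipow_comp, pipow_comp, Nat.add_comm]

namespace Ncot

variable {x y a b : P.Obj} {α : P.Hom a y} {β : P.Hom b y} {v : P.Hom x a} {w : P.Hom x b}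
  {φ : P.Hom x y} {j : ℕ}

theorem symm (C : Ncot α β v w φ j) : Ncot β α w v φ j :=
  ⟨C.toCfg.symm, C.hxy, C.gen, C.left, C.hj, C.shift⟩

theorem pi_comp_ne_zero' (C : Ncot α β v w φ j) : P.pi y ⊚ φ ≠ P.zero x y :=
  C.toCfg.pi_comp_gen_ne_zero C.gen

theorem comp_pipow_right (C : Ncot α β v w φ j) (n : ℕ) :
    φ ⊚ P.pipow x n = P.pipow y (n * j) ⊚ φ := comp_pipow_eq C.shift n

theorem pi_ne_comp_left (C : Ncot α β v w φ j) (g : P.Hom x y) (h : P.Hom y x) :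
    P.pi y ≠ g ⊚ h := by
  intro e
  obtain ⟨η, -, e'⟩ := C.gen.exists_pi_eq C.hxy C.pi_comp_ne_zero' e
  rcases C.toCfg.exists_gen_eq C.hxy C.gen with ⟨μ, rfl⟩ | ⟨ν, rfl⟩
  · exact C.nα _ (e'.trans (P.assoc _ _ _))
  · exact C.nβ _ (e'.trans (P.assoc _ _ _))

theorem isIrreducibleOn_pi_right (C : Ncot α β v w φ j) (hD : D ⊆ {x, a, b, y}) :
    P.IsIrreducibleOn D (P.pi y) := by
  refine isIrreducibleOn_pi C.pi_ne_zero fun z hz hzy g h => ?_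
  rcases hD hz with rfl | rfl | rfl | rfl
  · exact C.pi_ne_comp_left g h
  · exact C.pi_ne_comp g h
  · exact C.toCfg.symm.pi_ne_comp g h
  · exact absurd rfl hzy

/-- the morphism `π(y) α` is not a multiple of `β` -/
theorem pi_comp_ne (C : Ncot α β v w φ j) {s : ℕ} (hs : 2 ≤ s)
    (hβ : β ⊚ P.pi b = P.pipow y s ⊚ β) (δ : P.Hom a b) : P.pi y ⊚ α ≠ β ⊚ δ := by
  intro e
  have e1 : β ⊚ δ ⊚ v = P.pi y ⊚ β ⊚ w := by
    rw [← P.assoc, ← e, P.assoc, C.eq]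
  have h0 : P.pi y ⊚ β ⊚ w ≠ P.zero x y := C.toCfg.symm.ne_zero
  generalize δ ⊚ v = κ at e1
  obtain ⟨ζ, hζ⟩ := exists_gen (ne_zero_right C.toCfg.symm.comp_ne_zero)
  rcases hζ.2 with h | h
  · obtain ⟨p, rfl⟩ := h w
    obtain ⟨q, rfl⟩ := h κ
    rw [← P.assoc, comp_pipow_eq hβ, ← P.assoc β, comp_pipow_eq hβ, P.assoc, P.assoc,
      ← pipow_one, pipow_comp] at e1
    rw [← P.assoc β, comp_pipow_eq hβ, P.assoc, ← pipow_one, pipow_comp, ← e1] at h0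
    have h1 := left_pow_inj e1 h0
    rcases le_or_gt q p with hle | hlt
    · have := Nat.mul_le_mul_right s hle
      omega
    · obtain ⟨d, rfl⟩ := Nat.exists_eq_add_of_lt hlt
      rw [Nat.add_assoc, Nat.add_mul, Nat.add_mul] at h1
      omega
  · obtain ⟨p, rfl⟩ := h w
    obtain ⟨q, rfl⟩ := h κ
    obtain ⟨c, hc⟩ := C.left (β ⊚ ζ)
    rw [← P.assoc, ← P.assoc β, hc, P.assoc, P.assoc, C.comp_pipow_right, C.comp_pipow_right,
      ← pipow_one, pipow_comp, pipow_comp, pipow_comp] at e1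
    rw [← P.assoc β, hc, P.assoc, C.comp_pipow_right, ← pipow_one, pipow_comp, pipow_comp,
      ← e1] at h0
    have h1 := left_pow_inj e1 h0
    have hj := C.hj
    rcases le_or_gt q p with hle | hlt
    · have := Nat.mul_le_mul_right j hle
      omega
    · obtain ⟨d, rfl⟩ := Nat.exists_eq_add_of_lt hlt
      rw [Nat.add_assoc, Nat.add_mul, Nat.add_mul] at h1
      omega

theorem arr_ne (C : Ncot α β v w φ j) : arr (P.pi y ⊚ α) ≠ arr (P.pi y ⊚ α ⊚ v) := by
  by_cases hxa : x = a
  · subst hxa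
    intro h
    simp only [arr, Sigma.mk.injEq, heq_eq_eq, true_and] at h
    have h1 : P.id x = v := by
      refine P.cancel (P.id x) _ _ (P.pi y ⊚ α) ?_ ?_
      · rw [P.comp_id, P.comp_id, P.comp_id, P.assoc, h]
      · rw [P.comp_id, P.comp_id]
        exact C.pi_comp_ne_zero
    exact C.nv (h1 ▸ isId_id x)
  · exact arr_ne_of_left (Ne.symm hxa) _ _

theorem onlyFactors (C : Ncot α β v w φ j) {s : ℕ} (hs : 2 ≤ s)
    (hα : α ⊚ P.pi a = P.pipow y s ⊚ α) (hne : ∀ δ : P.Hom a b, P.pi y ⊚ α ≠ β ⊚ δ) :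
    OnlyFactors {x, a, b, y} (P.pi y ⊚ α) [(arr (P.pi y), arr α)] := by
  have h0 := C.pi_comp_ne_zero
  have key : ∀ n, P.pi y ⊚ α = P.pipow y n ⊚ α → n = 1 := fun n h =>
    (left_pow_inj (i := 1) h h0).symm
  have cross : ∀ (i : ℕ) (δ : P.Hom a b), P.pi y ⊚ α ≠ P.pipow y i ⊚ β ⊚ δ := by
    intro i δ e
    obtain ⟨c, hc, h1⟩ := C.exists_comp_eq δ
    rw [h1, pipow_comp] at e
    obtain rfl : c = 1 := by
      have := key _ e
      omega
    exact hne δ h1.symm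
  have loop : ∀ (i : ℕ) (δ : P.Hom a a), P.pi y ⊚ α = P.pipow y i ⊚ α ⊚ δ → P.IsId δ := by
    intro i δ e
    obtain ⟨q, rfl⟩ := P.endo_cyclic _ δ
    rw [comp_pipow_eq hα, pipow_comp] at e
    have h1 := key _ e
    rcases Nat.eq_zero_or_pos q with rfl | hq
    · exact isId_pipow.2 rfl
    · have := Nat.mul_le_mul hq hs
      omega
  rintro z (rfl | rfl | rfl | rfl) g h e
  · obtain ⟨i, rfl⟩ := C.left g
    rcases C.toCfg.exists_gen_eq C.hxy C.gen with ⟨μ, rfl⟩ | ⟨ν, rfl⟩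
    · rw [P.assoc, P.assoc] at e
      exact Or.inr (Or.inl (isId_of_comp_isId (loop _ _ e)).2)
    · rw [P.assoc, P.assoc] at e
      exact absurd e (cross _ _)
  · obtain ⟨i, rfl⟩ := C.lgen g
    rw [P.assoc] at e
    exact Or.inr (Or.inl (loop _ _ e))
  · obtain ⟨i, rfl⟩ := C.toCfg.symm.lgen g
    rw [P.assoc] at e
    exact absurd e (cross _ _)
  · obtain ⟨i, rfl⟩ := P.endo_cyclic _ g
    obtain ⟨j, rfl⟩ := C.lgen h
    rw [pipow_comp] at e
    have h1 := key _ e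
    obtain ⟨rfl, rfl⟩ | ⟨rfl, rfl⟩ : i = 0 ∧ j = 1 ∨ i = 1 ∧ j = 0 := by omega
    · exact Or.inl (isId_pipow.2 rfl)
    · simp [pipow_one, P.pipow_zero, P.id_comp]

theorem false_of_two_le (C : Ncot α β v w φ j) {s t : ℕ} (hs : 2 ≤ s) (ht : 2 ≤ t)
    (hα : α ⊚ P.pi a = P.pipow y s ⊚ α) (hβ : β ⊚ P.pi b = P.pipow y t ⊚ β) : False := by
  have hR : RepFinOn {x, a, b, y} (P.pi y ⊚ α ⊚ v) :=
    C.repFinOn (by simp) (by simp) (Set.Subset.refl _)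
  have h1 := C.onlyFactors hs hα (C.pi_comp_ne ht hβ)
  have h2 := C.symm.onlyFactors ht hβ (C.symm.pi_comp_ne hs hα)
  rw [Set.insert_comm b a] at h2
  exact hR.no_double_star (by simp) (by simp) (by simp) C.hab C.hay C.hby C.irrα.isIrreducibleOn
    C.irrβ.isIrreducibleOn (C.isIrreducibleOn_pi_right (Set.Subset.refl _)) C.pi_comp_ne_zero
    C.toCfg.symm.pi_comp_ne_zero C.arr_ne (C.eq ▸ C.symm.arr_ne) h1 h2

end Ncot

end RayCategory

namespace RayCategory

local infixr:80 "⊚" => RayCategory.comp _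

variable {P : RayCategory} {D : Set P.Obj}

theorem comp_pow_of_comm {y a : P.Obj} {α : P.Hom a y} (hα : P.pi y ⊚ α = α ⊚ P.pi a) (n : ℕ)
    {z : P.Obj} (f : P.Hom z a) : α ⊚ P.pipow a n ⊚ f = P.pipow y n ⊚ α ⊚ f := by
  rw [← P.assoc (P.pipow y n), pipow_comp_eq (i := 1) hα, Nat.mul_one, P.assoc]

namespace Ncot

variable {x y a b : P.Obj} {α : P.Hom a y} {β : P.Hom b y} {v : P.Hom x a} {w : P.Hom x b}
  {φ : P.Hom x y} {j : ℕ}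

theorem repFinOn' (C : Ncot α β v w φ j) : RepFinOn {x, a, b, y} (P.pi y ⊚ α ⊚ v) :=
  C.repFinOn (by simp) (by simp) (Set.Subset.refl _)

theorem pi_ne_zero_left (C : Ncot α β v w φ j)
    (hα : P.pi y ⊚ α = α ⊚ P.pi a) : P.pi a ≠ P.zero a a := by
  intro h
  apply C.pi_comp_ne_zero
  rw [hα, h, P.comp_zero]

theorem ne_left (C : Ncot α β v w φ j)
    (hα : P.pi y ⊚ α = α ⊚ P.pi a) : x ≠ a := by
  rintro rfl
  have h1 := C.gen
  obtain ⟨i, rfl⟩ := C.lgen φ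
  obtain rfl := h1.eq_zero_of_eq_left rfl
  have h2 := C.shift
  rw [P.pipow_zero, P.id_comp, ← hα] at h2
  have := left_pow_inj (i := 1) h2 C.pi_comp_ne_zero
  have := C.hj
  omega

theorem pi_comp_gen_ne_zero' (C : Ncot α β v w φ j)
    (hα : P.pi y ⊚ α = α ⊚ P.pi a) {μ : P.Hom x a} (hμ : P.Gen μ) :
    P.pi y ⊚ α ⊚ μ ≠ P.zero x y := by
  obtain ⟨p, q, e⟩ := hμ.exists_eq v
  intro h
  apply C.ne_zero
  rw [e, comp_pow_of_comm hα, ← pipow_one, pipow_comp, Nat.add_comm, pipow_add, P.assoc, pipow_one,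
    ← P.assoc α, ← P.assoc (P.pi y), h, P.zero_comp, P.comp_zero]

theorem isIrreducibleOn_pi_left (C : Ncot α β v w φ j)
    (hα : P.pi y ⊚ α = α ⊚ P.pi a) : P.IsIrreducibleOn {x, a, b, y} (P.pi a) := by
  have h0 := C.pi_comp_ne_zero
  have hxa := C.ne_left hα
  refine isIrreducibleOn_pi (C.pi_ne_zero_left hα) ?_
  have key : ∀ n, P.pi y ⊚ α = P.pipow y n ⊚ α → n = 1 := fun n h =>
    (left_pow_inj (i := 1) h h0).symm
  rintro z (rfl | rfl | rfl | rfl) h2 g h e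
  · obtain ⟨μ, hμ⟩ := exists_gen (ne_zero_right C.toCfg.comp_ne_zero)
    obtain ⟨p, q, rfl⟩ := hμ.exists_eq g
    obtain ⟨r, hr⟩ := P.endo_cyclic _ (μ ⊚ P.pipow z q ⊚ h)
    have e1 : P.pi a = P.pipow a (p + r) := by
      rw [e, P.assoc, P.assoc, hr, ← pipow_add]
    have h3 := pipow_inj (i := 1) e1 (C.pi_ne_zero_left hα)
    have h4 : r ≠ 0 := by
      rintro rfl
      exact not_isId hxa μ (isId_of_comp_isId (hr ▸ isId_pipow.2 rfl)).1
    obtain rfl : r = 1 := by omega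
    obtain ⟨c, hc⟩ := P.endo_cyclic _ ((P.pipow z q ⊚ h) ⊚ μ)
    obtain ⟨i, hi⟩ := C.left (α ⊚ μ)
    have e2 : P.pi y ⊚ α ⊚ μ = (α ⊚ μ) ⊚ P.pipow z c := by
      rw [← hc, ← P.assoc, hα, P.assoc, P.assoc, ← P.assoc μ, hr, pipow_one]
    have h5 := C.pi_comp_gen_ne_zero' hα hμ
    rw [hi, P.assoc, C.comp_pipow_right, ← pipow_one, pipow_comp, pipow_comp] at e2
    rw [hi, ← pipow_one, pipow_comp] at h5
    have h6 := left_pow_inj e2 h5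
    have := C.hj
    rcases Nat.eq_zero_or_pos c with rfl | hc0
    · omega
    · have := Nat.mul_le_mul hc0 C.hj
      omega
  · exact h2 rfl
  · obtain ⟨c, hc, h3⟩ := C.toCfg.symm.exists_comp_eq g
    obtain ⟨d, hd, h4⟩ := C.exists_comp_eq h
    rw [e, ← P.assoc, h3, P.assoc, h4, pipow_comp] at hα
    have := key _ hα
    omega
  · obtain ⟨l, rfl⟩ := C.lgen h
    rw [e, ← P.assoc, ← P.assoc, P.assoc α] at hα
    exact C.nα _ (cancel_right hα h0)

theorem not_isIrreducibleOn (C : Ncot α β v w φ j)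
    (hα : P.pi y ⊚ α = α ⊚ P.pi a) {z : P.Obj} (hz : z ∈ ({a, b, y} : Set P.Obj)) (hza : z ≠ a)
    (g : P.Hom z a) : ¬ P.IsIrreducibleOn {x, a, b, y} g := by
  intro hg
  have hτ := C.isIrreducibleOn_pi_left hα
  rcases hz with rfl | rfl | rfl
  · exact hza rfl
  · exact C.repFinOn'.no_cycle_four (by simp) (by simp) (by simp) (by simp) C.hab C.hay hτ
      C.irrα.isIrreducibleOn hg C.irrβ.isIrreducibleOn
  · exact C.repFinOn'.no_cycle_four (by simp) (by simp) (by simp) (by simp) C.hay C.hay hτ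
      C.irrα.isIrreducibleOn hg (C.isIrreducibleOn_pi_right (Set.Subset.refl _))

theorem exists_isIrreducibleOn (C : Ncot α β v w φ j)
    (hα : P.pi y ⊚ α = α ⊚ P.pi a) {s : P.Obj} (hs : s ∈ ({x, a, b, y} : Set P.Obj)) (hsa : s ≠ a)
    {f : P.Hom s a} (hf : f ≠ P.zero s a) :
    ∃ (g : P.Hom x a) (k : P.Hom s x) (l : ℕ), P.IsIrreducibleOn {x, a, b, y} g ∧
      f = P.pipow a l ⊚ g ⊚ k := by
  obtain ⟨z, hz, hza, g, k, l, hg, e⟩ := exists_last_irreducibleOn (D := {x, a, b, y}) (by simp)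
    hs (by simp) hsa hf
  obtain rfl | hz := hz
  · exact ⟨g, k, l, hg, e⟩
  · exact absurd hg (C.not_isIrreducibleOn hα hz hza g)

theorem ne_right (C : Ncot α β v w φ j)
    (hα : P.pi y ⊚ α = α ⊚ P.pi a) : x ≠ b := by
  obtain ⟨g, -, -, hg, -⟩ := C.exists_isIrreducibleOn hα (by simp) (C.ne_left hα)
    (ne_zero_right C.toCfg.comp_ne_zero)
  rintro rfl
  exact C.not_isIrreducibleOn hα (by simp) (C.ne_left hα) g hg

theorem exists_arrow (C : Ncot α β v w φ j)
    (hα : P.pi y ⊚ α = α ⊚ P.pi a) : ∃ g : P.Hom x a, P.IsIrreducibleOn {x, a, b, y} g := by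
  obtain ⟨g, -, -, hg, -⟩ := C.exists_isIrreducibleOn hα (by simp) (C.ne_left hα)
    (ne_zero_right C.toCfg.comp_ne_zero)
  exact ⟨g, hg⟩

theorem false_of_commuting (C : Ncot α β v w φ j)
    (hα : P.pi y ⊚ α = α ⊚ P.pi a) (hβ : P.pi y ⊚ β = β ⊚ P.pi b) : False := by
  obtain ⟨g, hg⟩ := C.exists_arrow hα
  obtain ⟨g', hg'⟩ := C.symm.exists_arrow hβ
  have hτ := C.symm.isIrreducibleOn_pi_left hβ
  rw [Set.insert_comm b a] at hg' hτ
  exact C.repFinOn'.no_cycle_six (s₁ := x) (s₂ := a) (s₃ := b) (t₁ := a) (t₂ := b) (t₃ := y)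
    (by simp) (by simp) (by simp) (by simp) (by simp) (by simp) (C.ne_left hα) C.hab C.hab C.hay
    C.hby (C.ne_right hα) hg hg' (C.isIrreducibleOn_pi_left hα) C.irrα.isIrreducibleOn hτ
    C.irrβ.isIrreducibleOn

theorem exists_gen_eq (C : Ncot α β v w φ j)
    (hα : P.pi y ⊚ α = α ⊚ P.pi a) : ∃ μ, φ = α ⊚ μ := by
  rcases C.toCfg.exists_gen_eq C.hxy C.gen with h | h
  · exact h
  by_contra! hc
  obtain ⟨g, hg⟩ := C.exists_arrow hα
  set D : Set P.Obj := {x, a, y} with hD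
  have hsub : D ⊆ {x, a, b, y} := by
    intro z
    simp only [hD, Set.mem_insert_iff, Set.mem_singleton_iff]
    tauto
  have hg' : P.IsIrreducibleOn D g := ⟨hg.1, hg.2.1, fun z hz => hg.2.2 z (hsub hz)⟩
  have hτ' : P.IsIrreducibleOn D (P.pi a) :=
    have hτ := C.isIrreducibleOn_pi_left hα
    ⟨hτ.1, hτ.2.1, fun z hz => hτ.2.2 z (hsub hz)⟩
  have hφ : P.IsIrreducibleOn D φ := C.gen.isIrreducibleOn C.hxy (by
    rintro z (rfl | rfl | rfl) h2 h3 g h e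
    · exact h2 rfl
    · exact hc _ (C.toCfg.exists_comp_of_gen C.gen e)
    · exact h3 rfl)
  have hR : RepFinOn D (P.pi y ⊚ α ⊚ v) := C.repFinOn (by simp [hD]) (by simp [hD]) hsub
  exact hR.no_cycle_four (by simp [hD]) (by simp [hD]) (by simp [hD]) (by simp [hD])
    (C.ne_left hα) C.hay.symm hφ hg' C.irrα.isIrreducibleOn hτ'

theorem eq_of_isIrreducibleOn (C : Ncot α β v w φ j)
    (hα : P.pi y ⊚ α = α ⊚ P.pi a) {μ g : P.Hom x a} (hμ : P.Gen μ)
    (hg : P.IsIrreducibleOn {x, a, b, y} g) : g = μ := by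
  obtain ⟨p, q, rfl⟩ := hμ.exists_eq g
  obtain rfl := isId_pipow.1 ((hg.2.2 a (by simp) _ _ rfl).resolve_right
    (not_isId (C.ne_left hα) _))
  rw [P.pipow_zero, P.id_comp] at hg ⊢
  obtain rfl := isId_pipow.1 ((hg.2.2 x (by simp) _ _ rfl).resolve_left
    (not_isId (C.ne_left hα) _))
  rw [P.pipow_zero, P.comp_id]

theorem not_isIrreducibleOn_cross (C : Ncot α β v w φ j)
    (hα : P.pi y ⊚ α = α ⊚ P.pi a) (δ : P.Hom a b) : ¬ P.IsIrreducibleOn {x, a, b, y} δ := by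
  intro hδ
  exact C.repFinOn'.no_three_in_three_out (s₁ := b) (s₂ := y) (s₃ := a) (t₁ := y) (t₂ := a)
    (t₃ := b) (by simp) (by simp) (by simp) (by simp) (by simp) (by simp)
    C.hby C.hab.symm C.hay.symm C.hay.symm C.hby.symm C.hab C.irrβ.isIrreducibleOn
    (C.isIrreducibleOn_pi_right (Set.Subset.refl _)) C.irrα.isIrreducibleOn
    (C.isIrreducibleOn_pi_left hα) hδ

end Ncot

end RayCategory

namespace RayCategory

local infixr:80 "⊚" => RayCategory.comp _

variable {P : RayCategory} {D : Set P.Obj}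

/-- the situation where `α` commutes with the generators of the radicals and `β` does not -/
structure Mixed {x y a b : P.Obj} (α : P.Hom a y) (β : P.Hom b y) (v : P.Hom x a) (w : P.Hom x b)
    (μ : P.Hom x a) (j s : ℕ) : Prop extends Ncot α β v w (α ⊚ μ) j where
  hα : P.pi y ⊚ α = α ⊚ P.pi a
  hs : 2 ≤ s
  hβ : β ⊚ P.pi b = P.pipow y s ⊚ β

namespace Mixed

variable {x y a b : P.Obj} {α : P.Hom a y} {β : P.Hom b y} {v : P.Hom x a} {w : P.Hom x b}
  {μ : P.Hom x a} {j s : ℕ}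

theorem hxa (C : Mixed α β v w μ j s) : x ≠ a := C.toNcot.ne_left C.hα

theorem hxb (C : Mixed α β v w μ j s) : x ≠ b := C.toNcot.ne_right C.hα

theorem gen_left (C : Mixed α β v w μ j s) : P.Gen μ := C.toCfg.gen_of_gen_comp C.gen

theorem isIrreducibleOn_left (C : Mixed α β v w μ j s) : P.IsIrreducibleOn {x, a, b, y} μ := by
  obtain ⟨g, hg⟩ := C.toNcot.exists_arrow C.hα
  rwa [← C.toNcot.eq_of_isIrreducibleOn C.hα C.gen_left hg]

theorem comp_pow (C : Mixed α β v w μ j s) (n : ℕ) {z : P.Obj} (f : P.Hom z a) :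
    α ⊚ P.pipow a n ⊚ f = P.pipow y n ⊚ α ⊚ f := comp_pow_of_comm C.hα n f

theorem comp_pow_right (C : Mixed α β v w μ j s) (n : ℕ) {z : P.Obj} (f : P.Hom z b) :
    β ⊚ P.pipow b n ⊚ f = P.pipow y (n * s) ⊚ β ⊚ f := by
  rw [← P.assoc, comp_pipow_eq C.hβ, P.assoc]

theorem pipow_left (C : Mixed α β v w μ j s) (n : ℕ) :
    α ⊚ μ ⊚ P.pipow x n = P.pipow y (n * j) ⊚ α ⊚ μ := by
  rw [← P.assoc, C.comp_pipow_right]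

/-- the morphism `w` does not factor through `y` -/
theorem ne_comp (C : Mixed α β v w μ j s) (ζ : P.Hom y b) (κ : P.Hom x y) : w ≠ ζ ⊚ κ := by
  intro e
  obtain ⟨i, rfl⟩ := C.left κ
  obtain ⟨n, hn, h1⟩ := C.toCfg.symm.comp_eq_pipow ζ
  have h2 : α ⊚ v = α ⊚ P.pipow a (n + i) ⊚ μ := by
    rw [C.eq, C.comp_pow, pipow_add, P.assoc, ← h1, e, P.assoc]
  have h3 := cancel_left h2 C.comp_ne_zero
  have hn' : ∀ m, 1 ≤ m → ¬ P.IsId (P.pipow y m) := fun m hm h => by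
    have := isId_pipow.1 h
    omega
  have l1 : Linked β w (P.pipow y (n + i)) (α ⊚ μ) :=
    (Linked.of_eq ζ C.irrβ.2.1 (not_isId C.hxy _) e h1.symm).trans
      (Linked.of_eq (P.pipow y i) (hn' n (by omega)) (not_isId C.hxy _) rfl (pipow_add _ _ _))
  have l2 : Linked α v (α ⊚ P.pipow a (n + i)) μ :=
    Linked.of_eq _ C.irrα.2.1 (not_isId C.hxa _) h3 rfl
  have l3 : Linked (P.pipow y (n + i)) (α ⊚ μ) (α ⊚ P.pipow a (n + i)) μ := by
    refine Linked.of_eq α (hn' _ (by omega)) (not_isId C.hxa _) rfl ?_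
    rw [pipow_comp_eq (i := 1) C.hα, Nat.mul_one]
  exact C.nlinked (l2.trans (l3.symm.trans l1.symm))

theorem isIrreducibleOn_right (C : Mixed α β v w μ j s) {ν : P.Hom x b} (hν : P.Gen ν) :
    P.IsIrreducibleOn {x, a, b, y} ν := by
  have hy : ∀ (ζ : P.Hom y b) (κ : P.Hom x y), ν ≠ ζ ⊚ κ := by
    intro ζ κ e
    obtain ⟨p, q, h⟩ := hν.exists_eq w
    refine C.ne_comp (P.pipow b p ⊚ ζ) (κ ⊚ P.pipow x q) ?_
    rw [h, e]
    simp only [P.assoc]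
  refine hν.isIrreducibleOn C.hxb ?_
  rintro z (rfl | rfl | rfl | rfl) h2 h3 g h e
  · exact h2 rfl
  · obtain ⟨z', hz', hzb, g', k, l, hg', e'⟩ := exists_last_irreducibleOn
      (D := {x, z, b, y}) (by simp) (by simp) (by simp) C.hab (ne_zero_left (e ▸ hν.1))
    rcases hz' with rfl | rfl | rfl | rfl
    · obtain ⟨p, q, rfl⟩ := hν.exists_eq g'
      obtain ⟨c, hc⟩ := P.endo_cyclic _ (k ⊚ h)
      rw [e'] at e
      simp only [P.assoc, pipow_comp, hc, ← pipow_add] at e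
      have h4 := eq_of_loop hν.1 e
      obtain rfl : c = 0 := by omega
      exact not_isId C.hxa h (isId_of_comp_isId (hc ▸ isId_pipow.2 rfl)).2
    · exact C.toNcot.not_isIrreducibleOn_cross C.hα g' hg'
    · exact hzb rfl
    · refine hy (P.pipow b l ⊚ g') (k ⊚ h) ?_
      rw [e, e']
      simp only [P.assoc]
  · exact h3 rfl
  · exact hy _ _ e

theorem pi_comp_left_ne_zero (C : Mixed α β v w μ j s) : P.pi a ⊚ μ ≠ P.zero x a := by
  refine ne_zero_right (g := α) ?_
  rw [← P.assoc, ← C.hα, P.assoc]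
  exact C.pi_comp_ne_zero'

theorem gen_cases (C : Mixed α β v w μ j s) {z : P.Obj} (hz : z ∈ ({x, a, b, y} : Set P.Obj))
    {g : P.Hom z y} {h : P.Hom x z} (e : α ⊚ μ = g ⊚ h) :
    P.IsId g ∨ P.IsId h ∨ (arr g, arr h) = (arr α, arr μ) ∨
      ∃ h' : P.Hom x b, arr g = arr β ∧ arr h = arr h' ∧ α ⊚ μ = β ⊚ h' := by
  rcases hz with rfl | rfl | rfl | rfl
  · obtain ⟨q, rfl⟩ := P.endo_cyclic _ h
    exact Or.inr (Or.inl (isId_pipow.2 (C.gen.eq_zero_of_eq_right e)))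
  · obtain ⟨p, rfl⟩ := C.lgen g
    rw [P.assoc] at e
    obtain rfl := C.gen.eq_zero_of_eq_left e
    rw [P.pipow_zero, P.id_comp] at e ⊢
    rw [cancel_left e C.gen.1]
    exact Or.inr (Or.inr (Or.inl rfl))
  · obtain ⟨p, rfl⟩ := C.toCfg.symm.lgen g
    rw [P.assoc] at e
    obtain rfl := C.gen.eq_zero_of_eq_left e
    rw [P.pipow_zero, P.id_comp] at e ⊢
    exact Or.inr (Or.inr (Or.inr ⟨h, rfl, rfl, e⟩))
  · obtain ⟨p, rfl⟩ := P.endo_cyclic _ g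
    exact Or.inl (isId_pipow.2 (C.gen.eq_zero_of_eq_left e))

theorem onlyFactors_loop (C : Mixed α β v w μ j s) {ν : P.Hom x b} (hν : P.Gen ν) {d : ℕ}
    (hd : β ⊚ ν = P.pipow y d ⊚ α ⊚ μ) (hc : d = 0 → ∀ δ : P.Hom b a, P.pi y ⊚ β ≠ α ⊚ δ) :
    OnlyFactors {x, a, b, y} (P.pi a ⊚ μ) [(arr (P.pi a), arr μ)] := by
  have e0 : α ⊚ P.pi a ⊚ μ = P.pi y ⊚ α ⊚ μ := C.comp_pow 1 μ
  have h0 := C.pi_comp_ne_zero'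
  have hj := C.hj
  have hs := C.hs
  have key : ∀ n, P.pi y ⊚ α ⊚ μ = P.pipow y n ⊚ α ⊚ μ → n = 1 := fun n h =>
    (left_pow_inj (i := 1) h h0).symm
  have small : ∀ {n m : ℕ}, 2 ≤ m → n * m ≤ 1 → n = 0 := by
    intro n m hm hn
    rcases Nat.eq_zero_or_pos n with h | h
    · exact h
    · have := Nat.mul_le_mul h hm
      omega
  rintro z (rfl | rfl | rfl | rfl) g h e
  · obtain ⟨q, rfl⟩ := P.endo_cyclic _ h
    obtain ⟨p, r, rfl⟩ := C.gen_left.exists_eq g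
    rw [e, P.assoc, P.assoc, ← pipow_add, C.comp_pow, C.pipow_left, pipow_comp] at e0
    have h1 := key _ e0.symm
    have h2 := small hj (n := r + q) (by omega)
    exact Or.inr (Or.inl (isId_pipow.2 (by omega)))
  · obtain ⟨p, rfl⟩ := P.endo_cyclic _ g
    obtain ⟨c, r, rfl⟩ := C.gen_left.exists_eq h
    rw [e, pipow_comp, C.comp_pow, C.pipow_left, pipow_comp] at e0
    have h1 := key _ e0.symm
    obtain rfl := small hj (n := r) (by omega)
    obtain ⟨rfl, rfl⟩ | ⟨rfl, rfl⟩ : p = 0 ∧ c = 1 ∨ p = 1 ∧ c = 0 := by omega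
    · exact Or.inl (isId_pipow.2 rfl)
    · simp [pipow_one, P.pipow_zero, P.id_comp, P.comp_id]
  · obtain ⟨p, q, rfl⟩ := hν.exists_eq h
    obtain ⟨c, hc', h1⟩ := C.toCfg.symm.exists_comp_eq g
    have e1 : α ⊚ P.pi a ⊚ μ = P.pipow y (c + (p * s + (d + q * j))) ⊚ α ⊚ μ := by
      rw [e, ← P.assoc, h1, P.assoc, C.comp_pow_right, ← P.assoc β, hd, P.assoc, P.assoc,
        C.pipow_left, pipow_comp, pipow_comp, pipow_comp]
      simp only [Nat.add_assoc]
    have h2 := key _ (e0.symm.trans e1)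
    obtain rfl : c = 1 := by omega
    exact absurd h1.symm (hc (by omega) g)
  · obtain ⟨c, rfl⟩ := C.left h
    rw [← P.assoc, ← P.assoc] at e
    have h1 := cancel_right e C.pi_comp_left_ne_zero
    rcases (C.toNcot.isIrreducibleOn_pi_left C.hα).2.2 _ (by simp) _ _ (h1.trans (P.assoc _ _ _))
      with h2 | h2
    · exact absurd h2 (not_isId C.hay.symm g)
    · exact absurd h2 (not_isId C.hay _)

theorem pi_comp_ne_left (C : Mixed α β v w μ j s) {ν : P.Hom x b} (hν : β ⊚ ν = α ⊚ μ)
    (δ : P.Hom b a) : P.pi y ⊚ β ≠ α ⊚ δ := by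
  intro e
  have h0 := C.toCfg.symm.pi_comp_ne_zero
  obtain ⟨g, k, l, hg, rfl⟩ := C.toNcot.exists_isIrreducibleOn C.hα (by simp) C.hab.symm
    (ne_zero_right (e ▸ h0))
  obtain rfl := C.toNcot.eq_of_isIrreducibleOn C.hα C.gen_left hg
  obtain ⟨n, hn⟩ := P.endo_cyclic _ (ν ⊚ k)
  rw [C.comp_pow, ← P.assoc α, ← hν, P.assoc, hn, comp_pipow_eq C.hβ, pipow_comp] at e
  have h1 := left_pow_inj (i := 1) e h0
  have hs := C.hs
  rcases Nat.eq_zero_or_pos n with rfl | h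
  · exact not_isId C.hxb ν (isId_of_comp_isId (hn ▸ isId_pipow.2 rfl)).1
  · have := Nat.mul_le_mul h hs
    omega

theorem false (C : Mixed α β v w μ j s) : False := by
  obtain ⟨ν, hν⟩ := exists_gen (ne_zero_right C.toCfg.symm.comp_ne_zero)
  obtain ⟨d, hd⟩ := C.left (β ⊚ ν)
  have hνi := C.isIrreducibleOn_right hν
  have hρ := C.isIrreducibleOn_pi_right (Set.Subset.refl _)
  have hτ := C.toNcot.isIrreducibleOn_pi_left C.hα
  have hμ := C.isIrreducibleOn_left
  have n₁ : arr (α ⊚ μ) ≠ arr (P.pi y ⊚ α ⊚ v) := by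
    intro h
    simp only [arr, Sigma.mk.injEq, heq_eq_eq, true_and] at h
    have := C.gen.eq_zero_of_eq_left (p := 1) h
    omega
  have n₂ : arr (P.pi a ⊚ μ) ≠ arr (P.pi y ⊚ α ⊚ v) := arr_ne_of_right C.hay _ _
  rcases Nat.eq_zero_or_pos d with rfl | hd0
  · rw [P.pipow_zero, P.id_comp] at hd
    have hne := C.pi_comp_ne_left hd
    have o₁ := C.toNcot.symm.onlyFactors C.hs C.hβ hne
    rw [Set.insert_comm b a] at o₁
    refine C.repFinOn'.no_linked_square (by simp) (by simp) (by simp) (by simp) C.hab C.hay C.hby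
      C.hxa C.hxb C.hxy C.irrα.isIrreducibleOn C.irrβ.isIrreducibleOn hρ hμ hνi hτ hd
      C.toCfg.symm.pi_comp_ne_zero C.gen.1 C.pi_comp_left_ne_zero (arr_ne_of_left C.hxb.symm _ _)
      n₁ n₂ o₁ (fun z hz g h e => ?_)
      (C.onlyFactors_loop hν (by rw [hd, P.pipow_zero, P.id_comp]) fun _ => hne)
    rcases C.gen_cases hz e with h1 | h1 | h1 | ⟨h', h1, h2, h3⟩
    · exact Or.inl h1
    · exact Or.inr (Or.inl h1)
    · simp [h1]
    · rw [← hd] at h3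
      obtain rfl := cancel_left h3 (hd ▸ C.gen.1)
      simp [h1, h2]
  · refine C.repFinOn'.no_linked_stars (s := x) (a := a) (b := b) (c := y) (by simp) (by simp)
      (by simp) (by simp) C.hab C.hay C.hby C.irrα.isIrreducibleOn C.irrβ.isIrreducibleOn hρ hμ hτ
      C.gen.1 C.pi_comp_left_ne_zero n₁ n₂ (fun z hz g h e => ?_)
      (C.onlyFactors_loop hν hd fun h => by omega)
    rcases C.gen_cases hz e with h1 | h1 | h1 | ⟨h', h1, h2, h3⟩
    · exact Or.inl h1
    · exact Or.inr (Or.inl h1)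
    · simp [h1]
    · obtain ⟨p, q, rfl⟩ := hν.exists_eq h'
      have h4 : α ⊚ μ = P.pipow y (p * s + d) ⊚ (α ⊚ μ) ⊚ P.pipow x q := by
        refine h3.trans ?_
        rw [C.comp_pow_right, ← P.assoc β, hd, pipow_add]
        simp only [P.assoc]
      have := C.gen.eq_zero_of_eq h4
      omega

end Mixed

/-- the morphism `α ⊚ v` is cotransit -/
theorem Cfg.pi_comp_eq {x y a b : P.Obj} {α : P.Hom a y} {β : P.Hom b y} {v : P.Hom x a}
    {w : P.Hom x b} (C : Cfg α β v w) (hxy : x ≠ y) :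
    P.pi y ⊚ α ⊚ v = (α ⊚ v) ⊚ P.pi x := by
  by_contra hc
  obtain ⟨φ, j, N⟩ := C.exists_ncot hxy hc
  have key : ∀ {a b : P.Obj} {α : P.Hom a y} {β : P.Hom b y} {v : P.Hom x a} {w : P.Hom x b}
      {s : ℕ}, Ncot α β v w φ j → P.pi y ⊚ α = α ⊚ P.pi a → 2 ≤ s →
      β ⊚ P.pi b = P.pipow y s ⊚ β → False := by
    intro a b α β v w s N hα hs hβ
    obtain ⟨μ, rfl⟩ := N.exists_gen_eq hα
    exact (Mixed.mk N hα hs hβ).false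
  obtain ⟨s, hs, hα⟩ := C.exists_comp_pi_eq
  obtain ⟨t, ht, hβ⟩ := C.symm.exists_comp_pi_eq
  obtain rfl | hs := hs.eq_or_lt'
  · obtain rfl | ht := ht.eq_or_lt'
    · exact N.false_of_commuting hα.symm hβ.symm
    · exact key N hα.symm ht hβ
  · obtain rfl | ht := ht.eq_or_lt'
    · exact key N.symm hβ.symm hs hα
    · exact N.false_of_two_le hs ht hα hβ

/-- the main combinatorial statement -/
theorem Cfg.exists_pi_eq {x y a b : P.Obj} {α : P.Hom a y} {β : P.Hom b y} {v : P.Hom x a}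
    {w : P.Hom x b} (C : Cfg α β v w) : P.pi y ⊚ α ⊚ v = (α ⊚ v) ⊚ P.pi x ∧
      ((∃ ξ, P.pi x = ξ ⊚ v) ∨ ∃ ξ, P.pi x = ξ ⊚ w) := by
  by_cases hxy : x = y
  · subst hxy
    exact C.false_of_loop.elim
  · have h := C.pi_comp_eq hxy
    exact ⟨h, C.exists_pi_eq_of_cotransit hxy h⟩

end RayCategory

namespace RayCategory

local infixr:80 "⊚" => RayCategory.comp _

variable {P : RayCategory}

/-- the morphisms through which `f` factors -/
def middleFactors {x y : P.Obj} (f : P.Hom x y) : Set P.Arr :=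
  {A | ∃ (g : P.Hom A.2.1 y) (h : P.Hom x A.1), f = g ⊚ A.2.2 ⊚ h}

theorem finite_middleFactors {x y : P.Obj} {f : P.Hom x y} (hf : f ≠ P.zero x y) :
    (middleFactors f).Finite := by
  refine ((P.finite_target x).biUnion fun s _ => (P.finite_source y).biUnion fun t _ =>
    Set.finite_range fun k : P.Hom s t => (⟨s, t, k⟩ : P.Arr)).subset ?_
  rintro ⟨s, t, k⟩ ⟨g, h, rfl⟩
  simp only [Set.mem_iUnion]
  exact ⟨s, ⟨h, ne_zero_right (ne_zero_right hf)⟩, t, ⟨g, ne_zero_left hf⟩, k, rfl⟩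

theorem middleFactors_ncard_lt {x y s t : P.Obj} {f : P.Hom x y} {k : P.Hom s t}
    {g : P.Hom t y} {h : P.Hom x s} (hf : f ≠ P.zero x y) (e : f = g ⊚ k ⊚ h)
    (hn : ¬ (P.IsId g ∧ P.IsId h)) : (middleFactors k).ncard < (middleFactors f).ncard := by
  refine Set.ncard_lt_ncard ⟨?_, fun hs => ?_⟩ (finite_middleFactors hf)
  · rintro A ⟨g', h', e'⟩
    exact ⟨g ⊚ g', h' ⊚ h, by rw [e, e']; simp only [P.assoc]⟩
  · obtain ⟨g', h', e'⟩ := hs (show (⟨x, y, f⟩ : P.Arr) ∈ middleFactors f from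
      ⟨P.id y, P.id x, by simp only [P.id_comp, P.comp_id]⟩)
    simp only at g' h' e'
    obtain ⟨i, hi⟩ := P.endo_cyclic _ (g ⊚ g')
    obtain ⟨j, hj⟩ := P.endo_cyclic _ (h' ⊚ h)
    have e1 : f = P.pipow y i ⊚ f ⊚ P.pipow x j := by
      rw [← hi, ← hj]
      nth_rewrite 1 [e, e']
      simp only [P.assoc]
    obtain ⟨rfl, rfl⟩ := eq_of_loop hf e1
    exact hn ⟨(isId_of_comp_isId (hi ▸ isId_pipow.2 rfl)).1,
      (isId_of_comp_isId (hj ▸ isId_pipow.2 rfl)).2⟩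

end RayCategory

namespace RPath

local infixr:80 "⊚" => RayCategory.comp _

open RayCategory

variable {P : RayCategory}

theorem toHom_nil (x : P.Obj) : (nil x : RPath P x x).toHom = P.id x := by
  simp only [toHom]

theorem toHom_cons {x y z : P.Obj} (f : P.Hom y z) (hf : P.IsIrreducible f) (p : RPath P x y) :
    (cons f hf p).toHom = f ⊚ p.toHom := by
  simp only [toHom]

theorem nil_append {x y : P.Obj} (p : RPath P x y) : (nil y).append p = p := by
  simp only [append]

theorem cons_append {x y z w : P.Obj} (f : P.Hom z w) (hf : P.IsIrreducible f)
    (p : RPath P y z) (q : RPath P x y) : (cons f hf p).append q = cons f hf (p.append q) := by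
  simp only [append]

theorem toHom_append {x y z : P.Obj} (p : RPath P y z) (q : RPath P x y) :
    (p.append q).toHom = p.toHom ⊚ q.toHom := by
  induction p with
  | nil => rw [nil_append, toHom_nil, P.id_comp]
  | cons f hf p ih => rw [cons_append, toHom_cons, toHom_cons, ih, P.assoc]

theorem append_assoc {x y z w : P.Obj} (p : RPath P z w) (q : RPath P y z) (r : RPath P x y) :
    (p.append q).append r = p.append (q.append r) := by
  induction p with
  | nil => simp only [nil_append]
  | cons f hf p ih => simp only [cons_append, ih]

theorem append_nil {x y : P.Obj} (p : RPath P x y) : p.append (nil x) = p := by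
  induction p with
  | nil => simp only [nil_append]
  | cons f hf p ih => simp only [cons_append, ih]

theorem length_ne_zero {x y : P.Obj} {p : RPath P x y} (h : ¬ P.IsId p.toHom) : p.length ≠ 0 := by
  cases p with
  | nil => exact absurd (toHom_nil x ▸ isId_id x) h
  | cons f hf p => simp [length]

theorem eq_nil_of_isId {x y : P.Obj} {p : RPath P x y} (h : P.IsId p.toHom) :
    ∃ e : x = y, p = e ▸ nil x := by
  cases p with
  | nil => exact ⟨rfl, rfl⟩
  | cons f hf p => exact absurd (isId_of_comp_isId (toHom_cons f hf p ▸ h)).1 hf.2.1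

/-- every nonzero morphism is the composition of a path -/
theorem exists_toHom_eq {x y : P.Obj} (f : P.Hom x y) (hf : f ≠ P.zero x y) :
    ∃ p : RPath P x y, p.toHom = f := by
  induction hn : (middleFactors f).ncard using Nat.strong_induction_on generalizing x y with
  | _ n ih =>
    subst hn
    by_cases hi : P.IsId f
    · obtain ⟨rfl, h⟩ := hi
      exact ⟨nil x, (toHom_nil x).trans (eq_of_heq h).symm⟩
    by_cases hr : P.IsIrreducible f
    · exact ⟨cons f hr (nil x), by rw [toHom_cons, toHom_nil, P.comp_id]⟩
    simp only [RayCategory.IsIrreducible, hf, hi, ne_eq, not_false_eq_true, true_and, not_forall,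
      not_or] at hr
    obtain ⟨z, g, h, e, hg, hh⟩ := hr
    have hf' := hf
    rw [e] at hf'
    obtain ⟨p, hp⟩ := ih _ (middleFactors_ncard_lt (k := g) (g := P.id _) (h := h) hf
      (by rw [P.id_comp, e]) fun h' => hh h'.2) g (ne_zero_left hf') rfl
    obtain ⟨q, hq⟩ := ih _ (middleFactors_ncard_lt (k := h) (g := g) (h := P.id _) hf
      (by rw [P.comp_id, e]) fun h' => hg h'.1) h (ne_zero_right hf') rfl
    exact ⟨p.append q, by rw [toHom_append, hp, hq, e]⟩

/-- the first arrow of a non-trivial path -/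
theorem exists_eq_append {x y : P.Obj} (p : RPath P x y) (h : ¬ P.IsId p.toHom) :
    ∃ (s : P.Obj) (f : P.Hom x s) (hf : P.IsIrreducible f) (rest : RPath P s y),
      p = rest.append (cons f hf (nil x)) := by
  induction p with
  | nil => exact absurd (by rw [toHom_nil]; exact isId_id _) h
  | cons f hf p ih =>
    by_cases hp : P.IsId p.toHom
    · obtain ⟨rfl, rfl⟩ := eq_nil_of_isId hp
      exact ⟨_, f, hf, nil _, (nil_append _).symm⟩
    · obtain ⟨s, f', hf', rest, rfl⟩ := ih hp
      exact ⟨s, f', hf', cons f hf rest, (cons_append _ _ _ _).symm⟩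

theorem interlaced_append {x y z : P.Obj} {p p' : RPath P z y} {q q' : RPath P x z}
    (hp : p.toHom = p'.toHom) (hq : q.toHom = q'.toHom) (hpi : ¬ P.IsId p.toHom)
    (hqi : ¬ P.IsId q.toHom) (h : p.toHom ⊚ q.toHom ≠ P.zero x y) :
    Interlaced (p.append q) (p'.append q') := by
  refine Relation.TransGen.tail (b := p'.append q) (Relation.TransGen.single ?_) ?_
  · exact ⟨z, y, nil y, p, p', q, (nil_append _).symm, (nil_append _).symm, hp, ne_zero_left h,
      fun hl => length_ne_zero hqi hl.2⟩
  · exact ⟨x, z, p', q, q', nil x, by rw [append_nil], by rw [append_nil], hq, ne_zero_right h,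
      fun hl => length_ne_zero (hp ▸ hpi) hl.1⟩

/-- `u` is interlaced with every path through the factorization `S` -/
def InterlacedSplit {x y : P.Obj} (u : RPath P x y) (S : P.Split x y) : Prop :=
  ¬ P.IsId S.2.1 ∧ ¬ P.IsId S.2.2 ∧ S.2.1 ⊚ S.2.2 ≠ P.zero x y ∧
    ∀ (p : RPath P S.1 y) (q : RPath P x S.1), p.toHom = S.2.1 → q.toHom = S.2.2 →
      Interlaced u (p.append q)

theorem interlacedSplit_iff {x y : P.Obj} {u : RPath P x y} {S T : P.Split x y}
    (h : Slide S T) : InterlacedSplit u S ↔ InterlacedSplit u T := by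
  obtain ⟨g, k, h, hg, hh⟩ := h
  have hkh : ¬ P.IsId (k ⊚ h) := fun h' => hh (isId_of_comp_isId h').2
  have hgk : ¬ P.IsId (g ⊚ k) := fun h' => hg (isId_of_comp_isId h').1
  simp only [InterlacedSplit, P.assoc, hg, hh, hkh, hgk, not_false_eq_true, true_and]
  refine and_congr_right fun h0 => ?_
  have h0' := h0
  rw [← P.assoc] at h0'
  obtain ⟨p, hp⟩ := exists_toHom_eq g (ne_zero_left h0)
  obtain ⟨r, hr⟩ := exists_toHom_eq k (ne_zero_left (ne_zero_right h0))
  obtain ⟨q, hq⟩ := exists_toHom_eq h (ne_zero_right (ne_zero_right h0))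
  constructor
  · intro H p' q' hp' hq'
    refine Relation.TransGen.trans (H p (r.append q) hp (by rw [toHom_append, hr, hq])) ?_
    rw [← append_assoc]
    refine interlaced_append ?_ ?_ ?_ ?_ ?_ <;>
      simp only [toHom_append, hp, hr, hq, hp', hq', hgk, hh, h0', ne_eq, not_false_eq_true]
  · intro H p' q' hp' hq'
    refine Relation.TransGen.trans (H (p.append r) q (by rw [toHom_append, hr, hp]) hq) ?_
    rw [append_assoc]
    refine interlaced_append ?_ ?_ ?_ ?_ ?_ <;>
      simp only [toHom_append, hp, hr, hq, hp', hq', hg, hkh, h0, ne_eq, not_false_eq_true]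

/-- paths through linked factorizations are interlaced -/
theorem interlaced_of_linked {x y a b : P.Obj} {p : RPath P a y} {q : RPath P x a}
    {p' : RPath P b y} {q' : RPath P x b} (hp : ¬ P.IsId p.toHom) (hq : ¬ P.IsId q.toHom)
    (h0 : p.toHom ⊚ q.toHom ≠ P.zero x y)
    (h : Linked p.toHom q.toHom p'.toHom q'.toHom) :
    Interlaced (p.append q) (p'.append q') := by
  have key : ∀ S T : P.Split x y, Relation.EqvGen Slide S T →
      (InterlacedSplit (p.append q) S ↔ InterlacedSplit (p.append q) T) := by
    intro S T h
    induction h with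
    | rel _ _ h => exact interlacedSplit_iff h
    | refl => exact Iff.rfl
    | symm _ _ _ ih => exact ih.symm
    | trans _ _ _ _ _ ih ih' => exact ih.trans ih'
  exact ((key _ _ h).1 ⟨hp, hq, h0, fun r s hr hs =>
    interlaced_append hr.symm hs.symm hp hq h0⟩).2.2.2 p' q' rfl rfl

end RPath

namespace RayCategory

local infixr:80 "⊚" => RayCategory.comp _

variable {P : RayCategory}

theorem IsIrreducible.eq {x y : P.Obj} {f g : P.Hom x y} (hf : P.IsIrreducible f)
    (hg : P.IsIrreducible g) (hxy : x ≠ y) : f = g := by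
  rcases hf.gen hxy with h | h <;> obtain ⟨i, rfl⟩ := h g
  · rw [isId_pipow.1 ((hg.2.2 _ _ _ rfl).resolve_right (not_isId hxy f)), P.pipow_zero, P.id_comp]
  · rw [isId_pipow.1 ((hg.2.2 _ _ _ rfl).resolve_left (not_isId hxy f)), P.pipow_zero, P.comp_id]

theorem IsTransit.exists_comp_pi_eq {x y : P.Obj} {f : P.Hom x y} (hf : P.IsTransit f) :
    ∃ l, 1 ≤ l ∧ f ⊚ P.pi x = P.pipow y l ⊚ f := by
  obtain ⟨h0, g, ⟨i, j, rfl⟩, hg⟩ := hf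
  obtain ⟨m, hm⟩ := hg f ⟨0, 0, by simp only [P.pipow_zero, P.id_comp, P.comp_id]⟩
  rw [pipow_comp] at hm
  obtain ⟨hi, rfl⟩ := eq_of_loop h0 hm
  obtain rfl : i = 0 := by omega
  simp only [P.pipow_zero, P.id_comp, P.comp_id] at hg
  obtain ⟨l, hl⟩ := hg (f ⊚ P.pi x) ⟨0, 1, by rw [P.pipow_zero, P.id_comp, pipow_one]⟩
  refine ⟨l, Nat.pos_of_ne_zero ?_, hl⟩
  rintro rfl
  rw [P.pipow_zero, P.id_comp] at hl
  exact one_ne_zero (right_loop h0 hl.symm)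

theorem IsCotransit.exists_pi_comp_eq {x y : P.Obj} {f : P.Hom x y} (hf : P.IsCotransit f) :
    ∃ l, 1 ≤ l ∧ P.pi y ⊚ f = f ⊚ P.pipow x l := by
  obtain ⟨h0, g, ⟨i, j, rfl⟩, hg⟩ := hf
  obtain ⟨m, hm⟩ := hg f ⟨0, 0, by simp only [P.pipow_zero, P.id_comp, P.comp_id]⟩
  rw [P.assoc, P.assoc, ← pipow_add] at hm
  obtain ⟨rfl, hj⟩ := eq_of_loop h0 hm
  obtain rfl : j = 0 := by omega
  simp only [P.pipow_zero, P.id_comp, P.comp_id] at hg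
  obtain ⟨l, hl⟩ := hg (P.pi y ⊚ f) ⟨1, 0, by rw [P.pipow_zero, P.comp_id, pipow_one]⟩
  refine ⟨l, Nat.pos_of_ne_zero ?_, hl⟩
  rintro rfl
  rw [P.pipow_zero, P.comp_id] at hl
  exact one_ne_zero (left_loop h0 hl.symm)

theorem IsTransit.pi_comp_ne_zero {x y : P.Obj} {f : P.Hom x y} (hf : P.IsTransit f)
    (h : ¬ P.IsDeep f) : P.pi y ⊚ f ≠ P.zero x y := by
  intro h0
  obtain ⟨l, hl, e⟩ := hf.exists_comp_pi_eq
  obtain ⟨l, rfl⟩ := Nat.exists_eq_add_of_le' hl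
  exact h ⟨hf.1, h0, by rw [e, pipow_add, P.assoc, pipow_one, h0, P.comp_zero]⟩

theorem IsTransit.pi_comp_eq {x y : P.Obj} {f : P.Hom x y} (hf : P.IsTransit f)
    (hf' : P.IsCotransit f) (h : ¬ P.IsDeep f) : P.pi y ⊚ f = f ⊚ P.pi x := by
  obtain ⟨l, hl, e⟩ := hf.exists_comp_pi_eq
  obtain ⟨m, hm, e'⟩ := hf'.exists_pi_comp_eq
  obtain ⟨l, rfl⟩ := Nat.exists_eq_add_of_le' hl
  obtain ⟨m, rfl⟩ := Nat.exists_eq_add_of_le' hm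
  have : P.pi y ⊚ f = P.pipow y l ⊚ (P.pi y ⊚ f) ⊚ P.pipow x m := by
    nth_rewrite 1 [e']
    rw [Nat.add_comm m, pipow_add, pipow_one, ← P.assoc, e, ← pipow_one y, pipow_add]
    simp only [P.assoc]
  obtain ⟨rfl, rfl⟩ := eq_of_loop (hf.pi_comp_ne_zero h) this
  exact e'

theorem isCotransit_of_pi_comp_eq {x y : P.Obj} {f : P.Hom x y} (h0 : f ≠ P.zero x y)
    (e : P.pi y ⊚ f = f ⊚ P.pi x) : P.IsCotransit f := by
  have key : ∀ i, P.pipow y i ⊚ f = f ⊚ P.pipow x i := by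
    intro i
    induction i with
    | zero => simp only [P.pipow_zero, P.id_comp, P.comp_id]
    | succ i ih => rw [pipow_add, P.assoc, pipow_one, e, ← P.assoc, ih, ← pipow_one x, comp_pipow]
  refine ⟨h0, f, ⟨0, 0, by simp only [P.pipow_zero, P.id_comp, P.comp_id]⟩, ?_⟩
  rintro _ ⟨i, j, rfl⟩
  exact ⟨i + j, by rw [← P.assoc, key, comp_pipow]⟩

theorem IsIrreducible.not_idealOf {x y z : P.Obj} {f : P.Hom z y} (hf : P.IsIrreducible f)
    {g : P.Hom x y} (hg : ¬ P.IsId g) : ¬ IdealOf P (P.pi y ⊚ g) z y f := by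
  rintro ⟨k, h, e⟩
  have hgh : ¬ P.IsId (g ⊚ h) := fun h' => hg (isId_of_comp_isId h').1
  rcases hf.2.2 _ _ _ e with h' | h'
  · rw [isId_iff.1 h', P.id_comp, P.assoc] at e
    rcases hf.2.2 _ _ _ e with h' | h'
    · exact absurd (isId_pipow.1 h') one_ne_zero
    · exact hgh h'
  · rw [P.assoc] at h'
    exact hgh (isId_of_comp_isId h').2

theorem not_idealOf_id {x y z : P.Obj} {g : P.Hom x y} (hg : ¬ P.IsId g) :
    ¬ IdealOf P (P.pi y ⊚ g) z z (P.id z) := by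
  rintro ⟨k, h, e⟩
  have h1 : P.IsId (k ⊚ (P.pi y ⊚ g) ⊚ h) := e ▸ isId_id z
  exact hg (isId_of_comp_isId (isId_of_comp_isId (isId_of_comp_isId h1).2).1).2

end RayCategory

namespace Contour

local infixr:80 "⊚" => RayCategory.comp _

open RayCategory

variable {P : RayCategory} {x y : P.Obj} {C : Contour P x y}

theorem Mild.nonDeep (hM : C.Mild) : ¬ P.IsDeep C.v.toHom := by
  rcases hM with h | h <;> exact h.1

theorem Mild.repFin (hM : C.Mild) (hT : P.IsTransit C.v.toHom) {D : Set P.Obj}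
    (hD : C.DecisiveT D) (hfin : D.Finite) (hcard : D.ncard ≤ 4) : RepFin P D C.It := by
  rcases id hM with h | h
  · exact h.2.2 D hD hfin hcard
  · have e : C.It = C.Ic := by rw [It, Ic, hT.pi_comp_eq h.2.1 hM.nonDeep]
    rw [e]
    exact h.2.2 D (by rwa [DecisiveT, e] at hD) hfin hcard

theorem Mild.cfg (hM : C.Mild) (hT : P.IsTransit C.v.toHom)
    {a b : P.Obj} {α : P.Hom a y} {hα : P.IsIrreducible α} {p : RPath P x a}
    (hv : C.v = RPath.cons α hα p) {β : P.Hom b y} {hβ : P.IsIrreducible β} {q : RPath P x b}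
    (hw : C.w = RPath.cons β hβ q) (nα : ∀ ξ, P.pi y ≠ α ⊚ ξ) (nβ : ∀ ξ, P.pi y ≠ β ⊚ ξ) :
    Cfg α β p.toHom q.toHom := by
  have hv' : C.v.toHom = α ⊚ p.toHom := by rw [hv, RPath.toHom_cons]
  have e : α ⊚ p.toHom = β ⊚ q.toHom := by
    rw [← hv', C.hom_eq, hw, RPath.toHom_cons]
  have nz := C.nz
  have nint := C.nint
  have ne := C.ne
  have nd := hM.nonDeep
  rw [hv'] at nz nd
  rw [hv, hw] at nint ne
  have hay : a ≠ y := by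
    rintro rfl
    exact nα (P.id a) (by rw [P.comp_id, hα.eq_pi])
  have hby : b ≠ y := by
    rintro rfl
    exact nβ (P.id b) (by rw [P.comp_id, hβ.eq_pi])
  have npq : ¬ (P.IsId p.toHom ∧ P.IsId q.toHom) := by
    rintro ⟨hp, hq⟩
    obtain ⟨rfl, rfl⟩ := RPath.eq_nil_of_isId hp
    obtain ⟨rfl, rfl⟩ := RPath.eq_nil_of_isId hq
    obtain rfl := hα.eq hβ hay
    exact ne rfl
  have irr_iff : ∀ {a : P.Obj} {α : P.Hom a y} {g : P.Hom x a}, P.IsIrreducible α →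
      (P.IsIrreducible (α ⊚ g) ↔ P.IsId g) := by
    intro a α g hα
    constructor
    · intro h
      exact (h.2.2 _ _ _ rfl).resolve_left hα.2.1
    · rintro ⟨rfl, h⟩
      rwa [eq_of_heq h, P.comp_id]
  have hpq : P.IsId p.toHom ↔ P.IsId q.toHom := by rw [← irr_iff hα, e, irr_iff hβ]
  have nv : ¬ P.IsId p.toHom := fun h => npq ⟨h, hpq.1 h⟩
  have nw : ¬ P.IsId q.toHom := fun h => npq ⟨hpq.2 h, h⟩
  have cons_eq : ∀ {a : P.Obj} {α : P.Hom a y} (hα : P.IsIrreducible α) (p : RPath P x a),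
      RPath.cons α hα p = (RPath.cons α hα (RPath.nil a)).append p := by
    intro a α hα p
    rw [RPath.cons_append, RPath.nil_append]
  have toHom_arrow : ∀ {a : P.Obj} {α : P.Hom a y} (hα : P.IsIrreducible α),
      (RPath.cons α hα (RPath.nil a)).toHom = α := by
    intro a α hα
    rw [RPath.toHom_cons, RPath.toHom_nil, P.comp_id]
  have nlinked : ¬ Linked α p.toHom β q.toHom := by
    intro h
    rw [cons_eq, cons_eq hβ] at nint
    exact nint (RPath.interlaced_of_linked (by rw [toHom_arrow]; exact hα.2.1) nv
      (by rwa [toHom_arrow]) (by rwa [toHom_arrow, toHom_arrow]))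
  have hV : ¬ P.IsId (α ⊚ p.toHom) := fun h => nv (isId_of_comp_isId h).2
  have hT' : P.IsTransit (α ⊚ p.toHom) := hv' ▸ hT
  refine ⟨hα, hβ, e, hay, hby, ?_, nv, nw, hT'.pi_comp_ne_zero nd, Or.inr hT'.exists_comp_pi_eq,
    nα, nβ, nlinked, fun D hx hy hD => ?_⟩
  · rintro rfl
    obtain rfl := hα.eq hβ hay
    exact nlinked (cancel_left e nz ▸ Relation.EqvGen.refl _)
  · have hfin : D.Finite := Set.Finite.subset (by simp) hD
    have hI : C.It = IdealOf P (P.pi y ⊚ α ⊚ p.toHom) := by rw [It, hv']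
    rw [← hI]
    refine hM.repFin hT ⟨hx, hy, fun z hz => ?_⟩ hfin ?_
    · rw [hI]
      obtain rfl | rfl | rfl | rfl := hD hz
      · exact Or.inl ⟨P.id _, id_ne_zero _, not_idealOf_id hV⟩
      · exact Or.inr ⟨α, hα.1, hα.not_idealOf hV⟩
      · exact Or.inr ⟨β, hβ.1, hβ.not_idealOf hV⟩
      · exact Or.inr ⟨P.id _, id_ne_zero _, not_idealOf_id hV⟩
    · refine (Set.ncard_le_ncard hD (by simp)).trans ?_
      refine (Set.ncard_insert_le _ _).trans (Nat.succ_le_succ ?_)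
      refine (Set.ncard_insert_le _ _).trans (Nat.succ_le_succ ?_)
      refine (Set.ncard_insert_le _ _).trans (Nat.succ_le_succ ?_)
      rw [Set.ncard_singleton]

/-- `π(x)` factors through the first arrow of a path through which it factors -/
theorem exists_first_arrow {x y a : P.Obj} {v : RPath P x y} {α : P.Hom a y}
    {hα : P.IsIrreducible α} {p : RPath P x a} (hv : v = RPath.cons α hα p)
    (hp : ¬ P.IsId p.toHom) {ξ : P.Hom a x} (h : P.pi x = ξ ⊚ p.toHom) :
    ∃ (s : P.Obj) (f : P.Hom x s) (hf : P.IsIrreducible f) (rest : RPath P s y),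
      v = rest.append (RPath.cons f hf (RPath.nil x)) ∧ ∃ ξ : P.Hom s x, P.pi x = ξ ⊚ f := by
  obtain ⟨s, f, hf, rest, rfl⟩ := p.exists_eq_append hp
  refine ⟨s, f, hf, RPath.cons α hα rest, by rw [hv, RPath.cons_append], ξ ⊚ rest.toHom, ?_⟩
  rw [h, RPath.toHom_append, RPath.toHom_cons, RPath.toHom_nil, P.comp_id, P.assoc]

end Contour

/-- **Lemma 2.1.** Let `C = {v,w}` be a mild contour from `x` to `y` with `v⃗` transit,
`v = v_1 ⋯ v_n`, `w = w_1 ⋯ w_m`, `α = v⃗_1`, `β = w⃗_1` and `ρ = π(y)`.  Then either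
(a) `ρ` factors through `α` or through `β`, or (b) `v⃗` is also cotransit and the
generator `π(x)` of the radical of `P(x,x)` factors through `v⃗_n` or through `w⃗_m`. -/
theorem mild_contour_factor (P : RayCategory) {x y : P.Obj} (C : Contour P x y)
    (hM : C.Mild) (hT : P.IsTransit C.v.toHom)
    {a1 b1 : P.Obj} (alp : P.Hom a1 y) (halp : P.IsIrreducible alp) (p : RPath P x a1)
    (hv : C.v = RPath.cons alp halp p)
    (bet : P.Hom b1 y) (hbet : P.IsIrreducible bet) (q : RPath P x b1)
    (hw : C.w = RPath.cons bet hbet q) :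
    ((∃ ξ : P.Hom y a1, P.pi y = P.comp alp ξ) ∨
     (∃ ξ : P.Hom y b1, P.pi y = P.comp bet ξ)) ∨
    (P.IsCotransit C.v.toHom ∧
      ((∃ (s : P.Obj) (vn : P.Hom x s) (hvn : P.IsIrreducible vn) (rest : RPath P s y),
          C.v = rest.append (RPath.cons vn hvn (RPath.nil x)) ∧
          ∃ ξ : P.Hom s x, P.pi x = P.comp ξ vn) ∨
       (∃ (s : P.Obj) (wm : P.Hom x s) (hwm : P.IsIrreducible wm) (rest : RPath P s y),
          C.w = rest.append (RPath.cons wm hwm (RPath.nil x)) ∧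
          ∃ ξ : P.Hom s x, P.pi x = P.comp ξ wm))) := by
  refine or_iff_not_imp_left.2 fun h => ?_
  simp only [not_or, not_exists] at h
  have hC := hM.cfg hT hv hw h.1 h.2
  obtain ⟨e, h1⟩ := hC.exists_pi_eq
  refine ⟨RayCategory.isCotransit_of_pi_comp_eq C.nz (by rw [hv, RPath.toHom_cons, e]), ?_⟩
  rcases h1 with ⟨ξ, h1⟩ | ⟨ξ, h1⟩
  · exact Or.inl (Contour.exists_first_arrow hv hC.nv h1)
  · exact Or.inr (Contour.exists_first_arrow hw hC.nw h1)
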